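/- arXiv:1603.05033 — 5 statements merged into one kernel-verified Lean document; each statement's English description precedes it below -/
import Mathlib

section
/- Let a < b be real numbers and s, α ∈ (0,1) with s + α < 1. Then I_{a+}^s is an isomorphism between the Hölder classes of exponents α and s+α vanishing at a. Precisely: (i) for every u : [a,b] → ℝ Hölder continuous of exponent α with u(a) = 0, the function I_{a+}^s[u] is Hölder continuous of exponent s+α on [a,b] and vanishes at a; (ii) for every f : [a,b] → ℝ Hölder continuous of exponent s+α with f(a) = 0, there exists a unique u : [a,b] → ℝ Hölder continuous of exponent α with u(a) = 0 such that f(x) = I_{a+}^s[u](x) for every x ∈ [a,b]; (iii) there exist constants C, D > 0, depending only on a, b, s, α, such that C‖f‖_{C^{0,s+α}} ≤ ‖u‖_{C^{0,α}} ≤ D‖f‖_{C^{0,s+α}}, where ‖v‖_{C^{0,λ}} := sup_{[a,b]}|v| + sup_{x≠y}|v(x)−v(y)|/|x−y|^λ. -/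
open MeasureTheory Set Filter ENNReal

/-- The left Riemann–Liouville fractional integral of order `σ` with base point `a`. -/
noncomputable def RLint (a σ : ℝ) (u : ℝ → ℝ) (x : ℝ) : ℝ :=
  (Real.Gamma σ)⁻¹ * ∫ t in a..x, u t * (x - t) ^ (σ - 1)
/-- `v` is Hölder continuous of exponent `lam` on `[a,b]`. -/
def IsHolderOn (a b lam : ℝ) (v : ℝ → ℝ) : Prop :=
  ∃ M ≥ (0:ℝ), ∀ x ∈ Set.Icc a b, ∀ y ∈ Set.Icc a b, |v x - v y| ≤ M * |x - y| ^ lam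

/-- The Hölder norm `‖v‖_{C^{0,lam}} = sup |v| + sup |v x - v y| / |x - y|^lam` on `[a,b]`. -/
noncomputable def holderNorm (a b lam : ℝ) (v : ℝ → ℝ) : ℝ :=
  (⨆ x : Set.Icc a b, |v x|) +
    ⨆ q : {q : Set.Icc a b × Set.Icc a b // (q.1 : ℝ) ≠ (q.2 : ℝ)},
      |v q.val.1 - v q.val.2| / |(q.val.1 : ℝ) - (q.val.2 : ℝ)| ^ lam

/-- The power kernel, extended by zero to the nonpositive half line. -/
noncomputable def rlp (σ r : ℝ) : ℝ := if 0 < r then r ^ (σ - 1) else 0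

/-- Unnormalised fractional integral on the whole line. -/
noncomputable def rlA (σ : ℝ) (v : ℝ → ℝ) (x : ℝ) : ℝ := ∫ t, v t * rlp σ (x - t)

lemma rlp_nonneg (σ r : ℝ) : 0 ≤ rlp σ r := by
  unfold rlp; split_ifs with h
  · positivity
  · exact le_rfl

lemma rlp_measurable (σ : ℝ) : Measurable (rlp σ) := by
  unfold rlp
  exact Measurable.ite measurableSet_Ioi (by fun_prop) (by fun_prop)

lemma rlp_scale (σ : ℝ) {h : ℝ} (hh : 0 < h) (r : ℝ) :
    rlp σ (h * r) = h ^ (σ - 1) * rlp σ r := by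
  unfold rlp
  by_cases hr : 0 < r
  · rw [if_pos hr, if_pos (mul_pos hh hr), Real.mul_rpow hh.le hr.le]
  · rw [if_neg hr, if_neg, mul_zero]
    intro h1; exact hr (pos_of_mul_pos_right h1 hh.le)

lemma rlA_integrand (σ a : ℝ) (v : ℝ → ℝ) (h0 : ∀ x ≤ a, v x = 0) (x : ℝ) :
    (fun t => v t * rlp σ (x - t)) = (Ioo a x).indicator (fun t => v t * (x - t) ^ (σ - 1)) := by
  funext t
  by_cases h : t ∈ Ioo a x
  · rw [indicator_of_mem h, rlp, if_pos (by linarith [h.2])]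
  · rw [indicator_of_notMem h]
    by_cases hta : t ≤ a
    · rw [h0 t hta, zero_mul]
    · rw [rlp, if_neg, mul_zero]
      intro h1; exact h ⟨by linarith, by linarith⟩

lemma kernel_intervalIntegrable {σ : ℝ} (hσ : 0 < σ) (a x : ℝ) :
    IntervalIntegrable (fun t => (x - t) ^ (σ - 1)) volume a x := by
  have := (intervalIntegral.intervalIntegrable_rpow' (a := x - a) (b := 0) (r := σ - 1)
    (by linarith)).comp_sub_left x
  simpa using this

lemma rlA_integrable {σ : ℝ} (hσ : 0 < σ) {a : ℝ} {v : ℝ → ℝ} (hv : Continuous v)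
    (h0 : ∀ x ≤ a, v x = 0) (x : ℝ) : Integrable (fun t => v t * rlp σ (x - t)) := by
  rw [rlA_integrand σ a v h0 x, integrable_indicator_iff measurableSet_Ioo]
  by_cases hx : a ≤ x
  · have := (kernel_intervalIntegrable hσ a x).continuousOn_mul hv.continuousOn
    rw [intervalIntegrable_iff_integrableOn_Ioo_of_le hx] at this
    exact this
  · rw [Ioo_eq_empty (by linarith)]; exact integrableOn_empty

lemma rlA_eq (σ : ℝ) {a : ℝ} {v : ℝ → ℝ} (h0 : ∀ x ≤ a, v x = 0) {x : ℝ} (hx : a ≤ x) :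
    rlA σ v x = ∫ t in a..x, v t * (x - t) ^ (σ - 1) := by
  rw [rlA, rlA_integrand σ a v h0 x, integral_indicator measurableSet_Ioo,
    intervalIntegral.integral_of_le hx, integral_Ioc_eq_integral_Ioo]

lemma rlA_zero (σ : ℝ) {a : ℝ} {v : ℝ → ℝ} (h0 : ∀ x ≤ a, v x = 0) {x : ℝ} (hx : x ≤ a) :
    rlA σ v x = 0 := by
  rw [rlA, rlA_integrand σ a v h0 x, Ioo_eq_empty (by linarith)]
  simp

lemma rlp_one_add_bound {s : ℝ} (hs : s ∈ Ioo (0:ℝ) 1) {w : ℝ} (hw : 0 < w) :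
    |rlp s (1 + w) - rlp s w| ≤ w ^ (s - 1) ∧ |rlp s (1 + w) - rlp s w| ≤ w ^ (s - 2) := by
  rw [rlp, rlp, if_pos (by linarith), if_pos hw, abs_sub_comm]
  have h1 : (1 + w) ^ (s - 1) ≤ w ^ (s - 1) :=
    Real.rpow_le_rpow_of_nonpos hw (by linarith) (by linarith [hs.2])
  have h2 : 0 < (1 + w) ^ (s - 1) := by positivity
  rw [abs_of_nonneg (by linarith)]
  refine ⟨by linarith, ?_⟩
  have h3 : w ^ s ≤ (1 + w) ^ s := Real.rpow_le_rpow hw.le (by linarith) hs.1.le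
  have e1 : (1 + w) ^ (s - 1) = (1 + w) ^ s / (1 + w) := by
    rw [Real.rpow_sub (by linarith), Real.rpow_one]
  have e2 : w ^ (s - 1) = w ^ s / w := by rw [Real.rpow_sub hw, Real.rpow_one]
  have e3 : w ^ (s - 2) = w ^ s / w ^ 2 := by
    rw [Real.rpow_sub hw]; norm_num
  have hp : 0 < w ^ s := by positivity
  rw [e1, e2, e3]
  have h4 : w ^ s / (1 + w) ≤ (1 + w) ^ s / (1 + w) := by gcongr
  have h5 : w ^ s / w - w ^ s / (1 + w) ≤ w ^ s / w ^ 2 := by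
    have : w ^ s / w - w ^ s / (1 + w) = w ^ s / (w * (1 + w)) := by field_simp; ring
    rw [this]
    apply div_le_div_of_nonneg_left hp.le (by positivity)
    nlinarith
  linarith

lemma rlq_integrable {s γ : ℝ} (hs : s ∈ Ioo (0:ℝ) 1) (hγ : 0 ≤ γ) (hsγ : s + γ < 1) :
    Integrable (fun w : ℝ => |w| ^ γ * |rlp s (1 + w) - rlp s w|) := by
  have i1 : Integrable ((Ioc (-1:ℝ) 0).indicator (fun w => (w + 1) ^ (s - 1))) := by
    rw [integrable_indicator_iff measurableSet_Ioc]
    have := (intervalIntegral.intervalIntegrable_rpow' (a := 0) (b := 1) (r := s - 1)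
      (by linarith [hs.1])).comp_add_right 1
    rw [intervalIntegrable_iff_integrableOn_Ioc_of_le (by norm_num)] at this
    simpa using this
  have i2 : Integrable ((Ioc (0:ℝ) 1).indicator (fun w => w ^ (s - 1))) := by
    rw [integrable_indicator_iff measurableSet_Ioc]
    have := (intervalIntegral.intervalIntegrable_rpow' (a := 0) (b := 1) (r := s - 1)
      (by linarith [hs.1]))
    rwa [intervalIntegrable_iff_integrableOn_Ioc_of_le (by norm_num)] at this
  have i3 : Integrable ((Ioi (1:ℝ)).indicator (fun w => w ^ (s + γ - 2))) := by
    rw [integrable_indicator_iff measurableSet_Ioi]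
    exact integrableOn_Ioi_rpow_of_lt (by linarith) one_pos
  refine ((i1.add i2).add i3).mono' ?_ ?_
  · have := rlp_measurable s
    apply Measurable.aestronglyMeasurable
    fun_prop
  · refine Eventually.of_forall fun w => ?_
    simp only [Pi.add_apply]
    rw [Real.norm_of_nonneg (by positivity)]
    rcases le_or_gt w (-1) with h | h
    · rw [rlp, rlp, if_neg (by linarith), if_neg (by linarith)]
      simp only [sub_zero, abs_zero, mul_zero]
      have : ∀ (S : Set ℝ) (g : ℝ → ℝ), (∀ x ∈ S, 0 ≤ g x) → 0 ≤ S.indicator g w :=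
        fun S g hg => indicator_nonneg hg w
      refine add_nonneg (add_nonneg (this _ _ ?_) (this _ _ ?_)) (this _ _ ?_)
      · intro x hx; exact Real.rpow_nonneg (by linarith [hx.1]) _
      · intro x hx; exact Real.rpow_nonneg hx.1.le _
      · intro x hx; exact Real.rpow_nonneg (by linarith [mem_Ioi.1 hx]) _
    rcases le_or_gt w 0 with h' | h'
    · rw [indicator_of_mem (by exact ⟨h, h'⟩), indicator_of_notMem (by simp [h']),
        indicator_of_notMem (by simp; linarith), rlp, rlp, if_pos (by linarith),
        if_neg (by linarith), sub_zero, add_zero, add_zero, add_comm w 1]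
      have h1 : |w| ^ γ ≤ 1 := Real.rpow_le_one (abs_nonneg _) (abs_le.2 ⟨h.le, by linarith⟩) hγ
      have h2 : 0 ≤ (1 + w) ^ (s - 1) := Real.rpow_nonneg (by linarith) _
      rw [abs_of_nonneg h2]
      nlinarith
    obtain ⟨b1, b2⟩ := rlp_one_add_bound hs h'
    rw [abs_of_pos h']
    rcases le_or_gt w 1 with h'' | h''
    · rw [indicator_of_notMem (by simp [h']), indicator_of_mem (by exact ⟨h', h''⟩),
        indicator_of_notMem (by simp; linarith), zero_add, add_zero]
      have h1 : w ^ γ ≤ 1 := Real.rpow_le_one h'.le h'' hγ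
      have h2 : 0 ≤ w ^ γ := by positivity
      calc _ ≤ 1 * w ^ (s - 1) := by gcongr
        _ = _ := one_mul _
    · rw [indicator_of_notMem (by simp [h']), indicator_of_notMem (by simp [h'']),
        indicator_of_mem (by exact h''), zero_add, zero_add]
      calc _ ≤ w ^ γ * w ^ (s - 2) := by gcongr
        _ = _ := by rw [← Real.rpow_add h']; ring_nf

lemma rlq_integral {s : ℝ} (hs : s ∈ Ioo (0:ℝ) 1) :
    Integrable (fun w : ℝ => rlp s (1 + w) - rlp s w) ∧
      ∫ w : ℝ, (rlp s (1 + w) - rlp s w) = 0 := by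
  have hm : Measurable (fun w : ℝ => rlp s (1 + w) - rlp s w) := by
    have := rlp_measurable s
    fun_prop
  have hi : Integrable (fun w : ℝ => rlp s (1 + w) - rlp s w) := by
    have := rlq_integrable hs le_rfl (by linarith [hs.2])
    simp only [Real.rpow_zero, one_mul] at this
    exact (integrable_norm_iff hm.aestronglyMeasurable).1 this
  refine ⟨hi, ?_⟩
  have hs0 := hs.1
  rw [← intervalIntegral.integral_Iic_add_Ioi (b := 0) hi.integrableOn hi.integrableOn]
  have e1 : ∫ w in Iic (0:ℝ), (rlp s (1 + w) - rlp s w) = 1 / s := by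
    have : ∀ w ∈ Iic (0:ℝ), rlp s (1 + w) - rlp s w
        = (Ioc (-1:ℝ) 0).indicator (fun w => (w + 1) ^ (s - 1)) w := by
      intro w hw
      rw [mem_Iic] at hw
      rcases le_or_gt w (-1) with h | h
      · rw [rlp, rlp, if_neg (by linarith), if_neg (by linarith), indicator_of_notMem, sub_zero]
        simp [h]
      · rw [rlp, rlp, if_pos (by linarith), if_neg (by linarith), indicator_of_mem (by exact ⟨h, hw⟩),
          sub_zero, add_comm]
    rw [setIntegral_congr_fun measurableSet_Iic this, setIntegral_indicator measurableSet_Ioc,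
      inter_eq_self_of_subset_right (fun x hx => hx.2),
      ← intervalIntegral.integral_of_le (by norm_num),
      intervalIntegral.integral_comp_add_right (fun w => w ^ (s - 1)),
      integral_rpow (Or.inl (by linarith))]
    norm_num
    rw [Real.zero_rpow hs0.ne']; simp
  have e2 : ∫ w in Ioi (0:ℝ), (rlp s (1 + w) - rlp s w)
      = 0 - (fun w : ℝ => ((1 + w) ^ s - w ^ s) / s) 0 := by
    apply integral_Ioi_of_hasDerivAt_of_tendsto (a := 0) (m := 0)
      (f := fun w : ℝ => ((1 + w) ^ s - w ^ s) / s)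
    · apply Continuous.continuousWithinAt
      have h1 : Continuous fun w : ℝ => w ^ s := Real.continuous_rpow_const hs0.le
      have h2 : Continuous fun w : ℝ => (1 + w) ^ s := h1.comp (by fun_prop)
      fun_prop
    · intro x hx
      rw [mem_Ioi] at hx
      rw [rlp, rlp, if_pos (by linarith), if_pos hx]
      have d1 := (Real.hasDerivAt_rpow_const (x := 1 + x) (p := s) (Or.inl (by linarith)))
      have d1' := d1.comp_const_add 1 x
      have d2 := (Real.hasDerivAt_rpow_const (x := x) (p := s) (Or.inl hx.ne'))
      have d3 := (d1'.sub d2).div_const s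
      rw [← mul_sub, mul_div_cancel_left₀ _ hs0.ne'] at d3
      exact d3
    · exact hi.integrableOn
    · have hl : Tendsto (fun w : ℝ => w ^ (-(1 - s))) atTop (nhds 0) :=
        tendsto_rpow_neg_atTop (by linarith [hs.2])
      refine squeeze_zero' (g := fun w : ℝ => w ^ (-(1 - s))) ?_ ?_ hl
      · filter_upwards [eventually_gt_atTop 0] with w hw
        have h3 : w ^ s ≤ (1 + w) ^ s := Real.rpow_le_rpow hw.le (by linarith) hs.1.le
        apply div_nonneg (by linarith) hs0.le
      · filter_upwards [eventually_gt_atTop 0] with w hw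
        rw [div_le_iff₀ hs0]
        have hb := rpow_one_add_le_one_add_mul_self (s := 1 / w) (by have : 0 < 1 / w := by positivity
                                                                     linarith)
          hs0.le hs.2.le
        have e : 1 + w = w * (1 + 1 / w) := by field_simp; ring
        have hw0 : 0 < w ^ s := by positivity
        have e' : w ^ (-(1 - s)) = w ^ s / w := by
          rw [show -(1 - s) = s - 1 by ring, Real.rpow_sub hw, Real.rpow_one]
        rw [e', e, Real.mul_rpow hw.le (by positivity)]
        have := mul_le_mul_of_nonneg_left hb hw0.le
        calc _ ≤ w ^ s * (1 + s * (1 / w)) - w ^ s := by linarith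
          _ = _ := by field_simp; ring
  rw [e1, e2]
  simp [Real.zero_rpow hs0.ne']

lemma holder_continuous {lam M : ℝ} (hl : 0 < lam) {v : ℝ → ℝ}
    (hv : ∀ x y, |v x - v y| ≤ M * |x - y| ^ lam) : Continuous v := by
  rw [continuous_iff_continuousAt]
  intro x
  rw [ContinuousAt, tendsto_iff_dist_tendsto_zero]
  have h1 : Continuous fun w : ℝ => w ^ lam := Real.continuous_rpow_const hl.le
  have h2 : Continuous fun y : ℝ => M * |y - x| ^ lam :=
    continuous_const.mul (h1.comp (by fun_prop))
  have h3 := h2.tendsto x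
  simp only [sub_self, abs_zero, Real.zero_rpow hl.ne', mul_zero] at h3
  exact squeeze_zero (fun _ => dist_nonneg) (fun y => by rw [Real.dist_eq]; exact hv y x) h3

lemma rlA_holder_lt {s α : ℝ} (hs : s ∈ Ioo (0:ℝ) 1) (hα : 0 < α) (hsα : s + α < 1)
    {a M : ℝ} {v : ℝ → ℝ} (hv : ∀ x y, |v x - v y| ≤ M * |x - y| ^ α)
    (h0 : ∀ x ≤ a, v x = 0) {x y : ℝ} (hxy : y < x) :
    |rlA s v x - rlA s v y| ≤
      (∫ w : ℝ, |w| ^ α * |rlp s (1 + w) - rlp s w|) * M * |x - y| ^ (s + α) := by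
  have hc := holder_continuous hα hv
  have hs0 := hs.1
  obtain ⟨h, hh⟩ : ∃ h, h = x - y := ⟨_, rfl⟩
  have hpos : 0 < h := by linarith
  have hx : x = y + h := by linarith
  have ix := rlA_integrable hs0 hc h0 x
  have iy := rlA_integrable hs0 hc h0 y
  have e1 : rlA s v x - rlA s v y
      = h ^ s * ∫ w : ℝ, v (y - h * w) * (rlp s (1 + w) - rlp s w) := by
    rw [rlA, rlA, ← integral_sub ix iy,
      ← integral_sub_left_eq_self (fun t => v t * rlp s (x - t) - v t * rlp s (y - t)) volume y]
    have h1 := Measure.integral_comp_mul_left (fun r => v (y - r) * rlp s (x - (y - r))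
      - v (y - r) * rlp s (y - (y - r))) h
    rw [abs_of_pos (inv_pos.2 hpos), smul_eq_mul, inv_mul_eq_div, eq_div_iff hpos.ne'] at h1
    rw [← h1, ← integral_mul_const, ← integral_const_mul]
    congr 1
    funext w
    have e2 : x - (y - h * w) = h * (1 + w) := by rw [hx]; ring
    have e3 : y - (y - h * w) = h * w := by ring
    rw [e2, e3, rlp_scale s hpos, rlp_scale s hpos]
    have e4 : h ^ s = h ^ (s - 1) * h := by
      rw [Real.rpow_sub hpos, Real.rpow_one]; field_simp
    rw [e4]; ring
  obtain ⟨qi, q0⟩ := rlq_integral hs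
  have hq := rlq_integrable hs hα.le hsα
  have hb : ∀ w : ℝ, ‖(v (y - h * w) - v y) * (rlp s (1 + w) - rlp s w)‖
      ≤ M * h ^ α * (|w| ^ α * |rlp s (1 + w) - rlp s w|) := by
    intro w
    rw [norm_mul, Real.norm_eq_abs, Real.norm_eq_abs]
    have h1 := hv (y - h * w) y
    have h2 : |y - h * w - y| = h * |w| := by
      rw [show y - h * w - y = -(h * w) by ring, abs_neg, abs_mul, abs_of_pos hpos]
    rw [h2, Real.mul_rpow hpos.le (abs_nonneg _)] at h1
    calc _ ≤ (M * (h ^ α * |w| ^ α)) * |rlp s (1 + w) - rlp s w| := by gcongr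
      _ = _ := by ring
  have i1 : Integrable fun w : ℝ => (v (y - h * w) - v y) * (rlp s (1 + w) - rlp s w) := by
    refine (hq.const_mul (M * h ^ α)).mono' ?_ (Eventually.of_forall hb)
    have := rlp_measurable s
    have := hc.measurable
    apply Measurable.aestronglyMeasurable
    fun_prop
  have e5 : ∫ w : ℝ, v (y - h * w) * (rlp s (1 + w) - rlp s w)
      = ∫ w : ℝ, (v (y - h * w) - v y) * (rlp s (1 + w) - rlp s w) := by
    have : (fun w : ℝ => v (y - h * w) * (rlp s (1 + w) - rlp s w)) =
      fun w => (v (y - h * w) - v y) * (rlp s (1 + w) - rlp s w)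
        + v y * (rlp s (1 + w) - rlp s w) := by funext w; ring
    rw [this, integral_add i1 (qi.const_mul _), integral_const_mul, q0, mul_zero, add_zero]
  have hfin := norm_integral_le_of_norm_le (hq.const_mul (M * h ^ α)) (Eventually.of_forall hb)
  rw [integral_const_mul, Real.norm_eq_abs] at hfin
  rw [e1, e5, abs_mul, abs_of_pos (by positivity : 0 < h ^ s), ← hh, abs_of_pos hpos,
    Real.rpow_add hpos]
  calc _ ≤ h ^ s * (M * h ^ α * ∫ w : ℝ, |w| ^ α * |rlp s (1 + w) - rlp s w|) := by gcongr
    _ = _ := by ring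

lemma rlA_holder {s α : ℝ} (hs : s ∈ Ioo (0:ℝ) 1) (hα : 0 < α) (hsα : s + α < 1)
    {a M : ℝ} {v : ℝ → ℝ} (hv : ∀ x y, |v x - v y| ≤ M * |x - y| ^ α)
    (h0 : ∀ x ≤ a, v x = 0) (x y : ℝ) :
    |rlA s v x - rlA s v y| ≤
      (∫ w : ℝ, |w| ^ α * |rlp s (1 + w) - rlp s w|) * M * |x - y| ^ (s + α) := by
  rcases lt_trichotomy x y with h | h | h
  · rw [abs_sub_comm, abs_sub_comm x y]
    exact rlA_holder_lt hs hα hsα hv h0 h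
  · have : s + α ≠ 0 := by linarith [hs.1]
    rw [h]; simp [Real.zero_rpow this]
  · exact rlA_holder_lt hs hα hsα hv h0 h

/-- The constant in the semigroup identity (a Beta value). -/
noncomputable def rlB (s : ℝ) : ℝ := ∫ w : ℝ, rlp s w * rlp (1 - s) (1 - w)

lemma rlB_integrand (s : ℝ) : (fun w : ℝ => rlp s w * rlp (1 - s) (1 - w))
    = (Ioo (0:ℝ) 1).indicator (fun w => w ^ (s - 1) * (1 - w) ^ (-s)) := by
  funext w
  by_cases h : w ∈ Ioo (0:ℝ) 1
  · rw [indicator_of_mem h, rlp, rlp, if_pos h.1, if_pos (by linarith [h.2])]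
    ring_nf
  · rw [indicator_of_notMem h]
    by_cases h1 : 0 < w
    · rw [rlp, rlp, if_neg (c := 0 < 1 - w), mul_zero]
      intro h2; exact h ⟨h1, by linarith⟩
    · rw [rlp, if_neg h1, zero_mul]

lemma rlB_intervalIntegrable {s : ℝ} (hs : s ∈ Ioo (0:ℝ) 1) :
    IntervalIntegrable (fun w : ℝ => w ^ (s - 1) * (1 - w) ^ (-s)) volume 0 1 := by
  have h := Complex.betaIntegral_convergent (u := (s : ℂ)) (v := ((1 - s : ℝ) : ℂ))
    (by simpa using hs.1) (by simpa using hs.2)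
  rw [intervalIntegrable_iff_integrableOn_Ioo_of_le (by norm_num)] at h ⊢
  refine h.norm.congr ?_
  refine (ae_restrict_iff' measurableSet_Ioo).2 (Eventually.of_forall fun w hw => ?_)
  have h1 : (1 - (w:ℂ)) = ((1 - w : ℝ) : ℂ) := by push_cast; rfl
  simp only [norm_mul]
  rw [h1, Complex.norm_cpow_eq_rpow_re_of_pos hw.1,
    Complex.norm_cpow_eq_rpow_re_of_pos (by linarith [hw.2])]
  simp

lemma rlB_integrable {s : ℝ} (hs : s ∈ Ioo (0:ℝ) 1) :
    Integrable (fun w : ℝ => rlp s w * rlp (1 - s) (1 - w)) := by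
  rw [rlB_integrand, integrable_indicator_iff measurableSet_Ioo,
    ← intervalIntegrable_iff_integrableOn_Ioo_of_le (by norm_num)]
  exact rlB_intervalIntegrable hs

lemma rlB_pos {s : ℝ} (hs : s ∈ Ioo (0:ℝ) 1) : 0 < rlB s := by
  rw [rlB, rlB_integrand, integral_indicator measurableSet_Ioo, ← integral_Ioc_eq_integral_Ioo,
    ← intervalIntegral.integral_of_le (by norm_num)]
  refine intervalIntegral.intervalIntegral_pos_of_pos_on (rlB_intervalIntegrable hs) ?_ one_pos
  intro w hw
  have h1 : 0 < 1 - w := by linarith [hw.2]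
  have h2 := hw.1
  positivity

lemma rlB_shift {s : ℝ} (hs : s ∈ Ioo (0:ℝ) 1) {τ x : ℝ} :
    Integrable (fun t : ℝ => rlp s (t - τ) * rlp (1 - s) (x - t)) ∧
    ∫ t : ℝ, rlp s (t - τ) * rlp (1 - s) (x - t) = (Iio x).indicator (fun _ => rlB s) τ := by
  by_cases h : τ < x
  · obtain ⟨L, hL⟩ : ∃ L, L = x - τ := ⟨_, rfl⟩
    have hpos : 0 < L := by linarith
    have key : ∀ w : ℝ, rlp s (L * w) * rlp (1 - s) (L - L * w)
        = L⁻¹ * (rlp s w * rlp (1 - s) (1 - w)) := by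
      intro w
      rw [show L - L * w = L * (1 - w) by ring, rlp_scale _ hpos, rlp_scale _ hpos]
      have : L⁻¹ = L ^ (s - 1) * L ^ (1 - s - 1) := by
        rw [← Real.rpow_add hpos, ← Real.rpow_neg_one]; ring_nf
      rw [this]; ring
    have e : (fun t : ℝ => rlp s (t - τ) * rlp (1 - s) (x - t))
        = fun t => (fun r => rlp s r * rlp (1 - s) (L - r)) (t - τ) := by
      funext t
      simp only
      rw [show L - (t - τ) = x - t by rw [hL]; ring]
    rw [indicator_of_mem (by exact h), e]
    constructor
    · apply Integrable.comp_sub_right (f := fun r => rlp s r * rlp (1 - s) (L - r))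
      rw [← integrable_comp_mul_left_iff _ hpos.ne']
      simp_rw [key]
      exact (rlB_integrable hs).const_mul _
    · rw [integral_sub_right_eq_self (fun r => rlp s r * rlp (1 - s) (L - r))]
      have h1 := Measure.integral_comp_mul_left (fun r => rlp s r * rlp (1 - s) (L - r)) L
      simp_rw [key] at h1
      rw [integral_const_mul, abs_of_pos (inv_pos.2 hpos), smul_eq_mul] at h1
      exact (mul_left_cancel₀ (inv_pos.2 hpos).ne' h1).symm
  · have : (fun t : ℝ => rlp s (t - τ) * rlp (1 - s) (x - t)) = fun _ => 0 := by
      funext t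
      by_cases h1 : 0 < t - τ
      · rw [rlp, rlp, if_neg (c := 0 < x - t) (by linarith), mul_zero]
      · rw [rlp, if_neg h1, zero_mul]
    rw [indicator_of_notMem (by exact h), this]
    simp

lemma integrableOn_Iio_of_zero {a : ℝ} {v : ℝ → ℝ} (hv : Continuous v)
    (h0 : ∀ x ≤ a, v x = 0) (x : ℝ) : IntegrableOn v (Iio x) := by
  have h1 : IntegrableOn v (Icc a x) := hv.continuousOn.integrableOn_Icc
  have h2 : IntegrableOn v (Iic a) :=
    (integrableOn_zero (α := ℝ) (ε' := ℝ) (s := Iic a) (μ := volume)).congr_fun (fun t ht => (h0 t ht).symm) measurableSet_Iic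
  refine (h2.union h1).mono_set ?_
  intro t ht
  rcases le_or_gt t a with h | h
  · exact Or.inl h
  · exact Or.inr ⟨h.le, le_of_lt ht⟩

lemma rlA_semigroup {s : ℝ} (hs : s ∈ Ioo (0:ℝ) 1) {a : ℝ} {v : ℝ → ℝ} (hv : Continuous v)
    (h0 : ∀ x ≤ a, v x = 0) (x : ℝ) :
    rlA (1 - s) (rlA s v) x = rlB s * ∫ t in Iio x, v t := by
  have hm1 := rlp_measurable s
  have hm2 := rlp_measurable (1 - s)
  have hm3 := hv.measurable
  have hInt : Integrable (Function.uncurry fun t τ : ℝ =>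
      v τ * (rlp s (t - τ) * rlp (1 - s) (x - t))) (volume.prod volume) := by
    rw [integrable_prod_iff']
    · refine ⟨Eventually.of_forall fun τ => ?_, ?_⟩
      · exact (rlB_shift hs (τ := τ) (x := x)).1.const_mul (v τ)
      · have : (fun τ => ∫ t : ℝ, ‖Function.uncurry (fun t τ : ℝ =>
            v τ * (rlp s (t - τ) * rlp (1 - s) (x - t))) (t, τ)‖)
            = (Iio x).indicator (fun τ => ‖v τ‖ * rlB s) := by
          funext τ
          simp only [Function.uncurry, norm_mul, Real.norm_of_nonneg (rlp_nonneg _ _)]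
          rw [integral_const_mul, (rlB_shift hs).2]
          by_cases h : τ ∈ Iio x
          · rw [indicator_of_mem h, indicator_of_mem h]
          · rw [indicator_of_notMem h, indicator_of_notMem h, mul_zero]
        rw [this, integrable_indicator_iff measurableSet_Iio]
        exact (integrableOn_Iio_of_zero hv h0 x).norm.mul_const _
    · apply Measurable.aestronglyMeasurable
      simp only [Function.uncurry_def]
      fun_prop
  have e1 : rlA (1 - s) (rlA s v) x
      = ∫ t : ℝ, ∫ τ : ℝ, v τ * (rlp s (t - τ) * rlp (1 - s) (x - t)) := by
    rw [rlA]
    congr 1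
    funext t
    rw [rlA, ← integral_mul_const]
    simp_rw [mul_assoc]
  rw [e1, integral_integral_swap hInt]
  simp_rw [integral_const_mul]
  have : (fun τ => v τ * ∫ t : ℝ, rlp s (t - τ) * rlp (1 - s) (x - t))
      = (Iio x).indicator (fun τ => rlB s * v τ) := by
    funext τ
    rw [(rlB_shift hs).2]
    by_cases h : τ ∈ Iio x
    · rw [indicator_of_mem h, indicator_of_mem h, mul_comm]
    · rw [indicator_of_notMem h, indicator_of_notMem h, mul_zero]
  rw [this, integral_indicator measurableSet_Iio, integral_const_mul]

lemma rlA_inj {s : ℝ} (hs : s ∈ Ioo (0:ℝ) 1) {a : ℝ} {v : ℝ → ℝ} (hv : Continuous v)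
    (h0 : ∀ x ≤ a, v x = 0) {b : ℝ} (hA : ∀ x ≤ b, rlA s v x = 0) : ∀ x ≤ b, v x = 0 := by
  have hI : ∀ x ≤ b, ∫ t in Iic x, v t = 0 := by
    intro x hx
    have h1 := rlA_semigroup hs hv h0 x
    have h2 : rlA (1 - s) (rlA s v) x = 0 := by
      rw [rlA]
      have : (fun t => rlA s v t * rlp (1 - s) (x - t)) = fun _ => 0 := by
        funext t
        by_cases ht : 0 < x - t
        · rw [hA t (by linarith), zero_mul]
        · rw [rlp, if_neg ht, mul_zero]
      rw [this, integral_zero]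
    rw [h2] at h1
    rw [integral_Iic_eq_integral_Iio]
    exact (mul_eq_zero.1 h1.symm).resolve_left (rlB_pos hs).ne'
  intro x hx
  have hd : HasDerivAt (fun y => ∫ t in (x - 1)..y, v t) (v x) x :=
    (hv.integral_hasStrictDerivAt (x - 1) x).hasDerivAt
  have hd1 : HasDerivWithinAt (fun y => ∫ t in (x - 1)..y, v t) (v x) (Iic x) x :=
    hd.hasDerivWithinAt
  have hz : ∀ y ∈ Iic x, (fun y => ∫ t in (x - 1)..y, v t) y = (fun _ => (0:ℝ)) y := by
    intro y hy
    rw [mem_Iic] at hy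
    have hi : ∀ z, IntegrableOn v (Iic z) := fun z =>
      (integrableOn_Iio_of_zero hv h0 (z + 1)).mono_set (fun t ht => by
        rw [mem_Iic] at ht; rw [mem_Iio]; linarith)
    simp only
    rw [← intervalIntegral.integral_Iic_sub_Iic (hi _) (hi _), hI y (by linarith),
      hI (x - 1) (by linarith), sub_zero]
  have hd2 : HasDerivWithinAt (fun y => ∫ t in (x - 1)..y, v t) 0 (Iic x) x :=
    (hasDerivWithinAt_const x (Iic x) (0:ℝ)).congr hz (hz x (mem_Iic.2 le_rfl))
  exact (uniqueDiffWithinAt_Iic x).eq_deriv _ hd1 hd2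

lemma piecewise_integral {α s h : ℝ} (hα : 0 < α) (hs : 0 < s) (hh : 0 < h) (c₁ c₂ : ℝ) :
    IntegrableOn (fun τ : ℝ => if τ ≤ h then c₁ * τ ^ (α - 1) else c₂ * τ ^ (-1 - s)) (Ioi 0) ∧
    ∫ τ in Ioi (0:ℝ), (if τ ≤ h then c₁ * τ ^ (α - 1) else c₂ * τ ^ (-1 - s))
      = c₁ * (h ^ α / α) + c₂ * (h ^ (-s) / s) := by
  have hI1 : IntegrableOn (fun τ : ℝ => c₁ * τ ^ (α - 1)) (Ioc 0 h) := by
    have := (intervalIntegral.intervalIntegrable_rpow' (a := 0) (b := h) (r := α - 1)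
      (by linarith)).const_mul c₁
    rwa [intervalIntegrable_iff_integrableOn_Ioc_of_le hh.le] at this
  have hI2 : IntegrableOn (fun τ : ℝ => c₂ * τ ^ (-1 - s)) (Ioi h) :=
    (integrableOn_Ioi_rpow_of_lt (by linarith) hh).const_mul c₂
  have c1 : ∀ τ ∈ Ioc 0 h, c₁ * τ ^ (α - 1)
      = (fun τ : ℝ => if τ ≤ h then c₁ * τ ^ (α - 1) else c₂ * τ ^ (-1 - s)) τ := by
    intro τ hτ
    simp only
    rw [if_pos hτ.2]
  have c2 : ∀ τ ∈ Ioi h, c₂ * τ ^ (-1 - s)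
      = (fun τ : ℝ => if τ ≤ h then c₁ * τ ^ (α - 1) else c₂ * τ ^ (-1 - s)) τ := by
    intro τ hτ
    simp only
    rw [if_neg (not_le.2 hτ)]
  have hJ1 := hI1.congr_fun c1 measurableSet_Ioc
  have hJ2 := hI2.congr_fun c2 measurableSet_Ioi
  have hu : Ioc 0 h ∪ Ioi h = Ioi (0:ℝ) := Ioc_union_Ioi_eq_Ioi hh.le
  constructor
  · rw [← hu]; exact hJ1.union hJ2
  · rw [← hu, setIntegral_union (Ioc_disjoint_Ioi le_rfl) measurableSet_Ioi hJ1 hJ2,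
      ← setIntegral_congr_fun measurableSet_Ioc c1, ← setIntegral_congr_fun measurableSet_Ioi c2,
      integral_const_mul, integral_const_mul, integral_Ioi_rpow_of_lt (by linarith) hh,
      ← intervalIntegral.integral_of_le hh.le, integral_rpow (Or.inl (by linarith))]
    have e1 : α - 1 + 1 = α := by ring
    have e2 : -1 - s + 1 = -s := by ring
    rw [e1, e2, Real.zero_rpow hα.ne', sub_zero, neg_div_neg_eq]

/-- Marchaud derivative (up to a constant). -/
noncomputable def rlD (s : ℝ) (f : ℝ → ℝ) (x : ℝ) : ℝ :=
  ∫ τ in Ioi (0:ℝ), (f x - f (x - τ)) * τ ^ (-1 - s)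

lemma rlD_dom {s α : ℝ} (hs : s ∈ Ioo (0:ℝ) 1) (hα : 0 < α)
    {a M : ℝ} (hM : 0 ≤ M) {f : ℝ → ℝ} (hf : ∀ x y, |f x - f y| ≤ M * |x - y| ^ (s + α))
    (h0 : ∀ x ≤ a, f x = 0) (X : ℝ) :
    ∃ m : ℝ → ℝ, IntegrableOn m (Ioi 0) ∧
      ∀ x ≤ X, ∀ τ ∈ Ioi (0:ℝ), ‖(f x - f (x - τ)) * τ ^ (-1 - s)‖ ≤ m τ := by
  have hs0 := hs.1
  have hS : ∀ x ≤ X, |f x| ≤ M * |X - a| ^ (s + α) := by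
    intro x hx
    by_cases h : x ≤ a
    · rw [h0 x h, abs_zero]; positivity
    · have h1 := hf x a
      rw [h0 a le_rfl, sub_zero] at h1
      refine h1.trans ?_
      have h2 : |x - a| ≤ |X - a| := by
        rw [abs_of_pos (by linarith), abs_of_pos (by linarith)]; linarith
      gcongr
  refine ⟨_, (piecewise_integral hα hs0 one_pos M (2 * (M * |X - a| ^ (s + α)))).1, ?_⟩
  intro x hx τ hτ
  rw [mem_Ioi] at hτ
  have hp : 0 < τ ^ (-1 - s) := by positivity
  rw [norm_mul, Real.norm_eq_abs, Real.norm_of_nonneg hp.le]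
  split_ifs with h
  · have h1 := hf x (x - τ)
    rw [show x - (x - τ) = τ by ring, abs_of_pos hτ] at h1
    calc _ ≤ M * τ ^ (s + α) * τ ^ (-1 - s) := by gcongr
      _ = _ := by rw [mul_assoc, ← Real.rpow_add hτ]; ring_nf
  · have h1 := hS x hx
    have h2 := hS (x - τ) (by linarith)
    have h3 := abs_sub (f x) (f (x - τ))
    gcongr
    linarith

lemma rlD_integrable {s α : ℝ} (hs : s ∈ Ioo (0:ℝ) 1) (hα : 0 < α)
    {a M : ℝ} (hM : 0 ≤ M) {f : ℝ → ℝ} (hf : ∀ x y, |f x - f y| ≤ M * |x - y| ^ (s + α))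
    (h0 : ∀ x ≤ a, f x = 0) (x : ℝ) :
    IntegrableOn (fun τ : ℝ => (f x - f (x - τ)) * τ ^ (-1 - s)) (Ioi 0) := by
  obtain ⟨m, hm, hb⟩ := rlD_dom hs hα hM hf h0 x
  have hc := (holder_continuous (by linarith [hs.1]) hf).measurable
  refine hm.mono' (Measurable.aestronglyMeasurable (by fun_prop)) ?_
  exact (ae_restrict_iff' measurableSet_Ioi).2 (Eventually.of_forall (hb x le_rfl))

lemma rlD_holder {s α : ℝ} (hs : s ∈ Ioo (0:ℝ) 1) (hα : 0 < α)
    {a M : ℝ} (hM : 0 ≤ M) {f : ℝ → ℝ} (hf : ∀ x y, |f x - f y| ≤ M * |x - y| ^ (s + α))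
    (h0 : ∀ x ≤ a, f x = 0) (x y : ℝ) :
    |rlD s f x - rlD s f y| ≤ (2 * (1 / α + 1 / s)) * M * |x - y| ^ α := by
  have hs0 := hs.1
  by_cases hxy : x = y
  · rw [hxy]; simp [Real.zero_rpow hα.ne']
  have hh : 0 < |x - y| := abs_pos.2 (sub_ne_zero.2 hxy)
  set h := |x - y| with hdef
  have ix := rlD_integrable hs hα hM hf h0 x
  have iy := rlD_integrable hs hα hM hf h0 y
  obtain ⟨hi, he⟩ := piecewise_integral hα hs0 hh (2 * M) (2 * M * h ^ (s + α))
  rw [rlD, rlD, ← integral_sub ix iy, ← Real.norm_eq_abs]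
  have := norm_integral_le_of_norm_le (f := fun τ => (f x - f (x - τ)) * τ ^ (-1 - s)
    - (f y - f (y - τ)) * τ ^ (-1 - s)) hi ?_
  · refine this.trans (le_of_eq ?_)
    have e5 : h ^ (s + α) * h ^ (-s) = h ^ α := by
      rw [← Real.rpow_add hh, show s + α + -s = α by ring]
    rw [he, ← e5]
    ring
  · refine (ae_restrict_iff' measurableSet_Ioi).2 (Eventually.of_forall fun τ hτ => ?_)
    rw [mem_Ioi] at hτ
    have hp : 0 < τ ^ (-1 - s) := by positivity
    rw [← sub_mul, norm_mul, Real.norm_eq_abs, Real.norm_of_nonneg hp.le]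
    split_ifs with hc
    · have h1 := hf x (x - τ)
      have h2 := hf y (y - τ)
      rw [show x - (x - τ) = τ by ring, abs_of_pos hτ] at h1
      rw [show y - (y - τ) = τ by ring, abs_of_pos hτ] at h2
      have h3 := abs_sub (f x - f (x - τ)) (f y - f (y - τ))
      calc _ ≤ (2 * M * τ ^ (s + α)) * τ ^ (-1 - s) := by
            gcongr; linarith
        _ = _ := by rw [mul_assoc, ← Real.rpow_add hτ]; ring_nf
    · have h1 := hf x y
      have h2 := hf (x - τ) (y - τ)
      rw [show x - τ - (y - τ) = x - y by ring] at h2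
      have h3 := abs_sub (f x - f y) (f (x - τ) - f (y - τ))
      rw [← hdef] at h1 h2
      gcongr
      rw [show f x - f (x - τ) - (f y - f (y - τ)) = f x - f y - (f (x - τ) - f (y - τ)) by ring]
      linarith

lemma rlD_zero (s : ℝ) {a : ℝ} {f : ℝ → ℝ} (h0 : ∀ x ≤ a, f x = 0) {x : ℝ} (hx : x ≤ a) :
    rlD s f x = 0 := by
  rw [rlD]
  have : ∀ τ ∈ Ioi (0:ℝ), (f x - f (x - τ)) * τ ^ (-1 - s) = 0 := by
    intro τ hτ
    rw [mem_Ioi] at hτ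
    rw [h0 x hx, h0 _ (by linarith)]; simp
  rw [setIntegral_congr_fun measurableSet_Ioi this]
  simp

lemma rlD_primitive {s α : ℝ} (hs : s ∈ Ioo (0:ℝ) 1) (hα : 0 < α)
    {a M : ℝ} (hM : 0 ≤ M) {f : ℝ → ℝ} (hf : ∀ x y, |f x - f y| ≤ M * |x - y| ^ (s + α))
    (h0 : ∀ x ≤ a, f x = 0) (X : ℝ) :
    ∫ x in Iio X, rlD s f x = s⁻¹ * rlA (1 - s) f X := by
  have hs0 := hs.1
  by_cases hX : X ≤ a
  · rw [rlA_zero _ h0 hX, mul_zero]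
    have : ∀ x ∈ Iio X, rlD s f x = 0 := fun x hx => rlD_zero s h0 (by
      rw [mem_Iio] at hx; linarith)
    rw [setIntegral_congr_fun measurableSet_Iio this]
    simp
  push Not at hX
  have hcont := holder_continuous (by linarith) hf
  have hmeas := hcont.measurable
  have e1 : ∫ x in Iio X, rlD s f x = ∫ x in Ioc a X, rlD s f x := by
    rw [← integral_Iic_eq_integral_Iio]
    refine (setIntegral_eq_of_subset_of_forall_sdiff_eq_zero measurableSet_Iic
      (fun x hx => hx.2) ?_)
    intro x hx
    apply rlD_zero s h0
    by_contra hxa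
    exact hx.2 ⟨not_le.1 hxa, hx.1⟩
  -- first exchange of integrals
  have hInt1 : Integrable (Function.uncurry fun x τ : ℝ => (f x - f (x - τ)) * τ ^ (-1 - s))
      ((volume.restrict (Ioc a X)).prod (volume.restrict (Ioi 0))) := by
    obtain ⟨m, hm, hb⟩ := rlD_dom hs hα hM hf h0 X
    have hc1 : Integrable (fun _ : ℝ => (1:ℝ)) (volume.restrict (Ioc a X)) :=
      integrableOn_const (by simp)
    refine (hc1.mul_prod hm).mono' ?_ ?_
    · apply Measurable.aestronglyMeasurable
      simp only [Function.uncurry_def]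
      fun_prop
    · rw [Measure.prod_restrict]
      refine (ae_restrict_iff' (measurableSet_Ioc.prod measurableSet_Ioi)).2
        (Eventually.of_forall fun z hz => ?_)
      rw [one_mul]
      exact hb z.1 hz.1.2 z.2 hz.2
  have e2 : ∫ x in Ioc a X, rlD s f x
      = ∫ τ in Ioi (0:ℝ), ∫ x in Ioc a X, (f x - f (x - τ)) * τ ^ (-1 - s) :=
    integral_integral_swap hInt1
  have e3 : ∀ τ ∈ Ioi (0:ℝ), ∫ x in Ioc a X, (f x - f (x - τ)) * τ ^ (-1 - s)
      = ∫ r in Ioi (0:ℝ), (Iio τ).indicator (fun _ => τ ^ (-1 - s)) r * f (X - r) := by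
    intro τ hτ
    rw [mem_Ioi] at hτ
    have hii : ∀ p q, IntervalIntegrable f volume p q := fun p q => hcont.intervalIntegrable p q
    have hii2 : IntervalIntegrable (fun x => f (x - τ)) volume a X :=
      (hcont.comp (continuous_sub_right τ)).intervalIntegrable _ _
    rw [integral_mul_const, ← intervalIntegral.integral_of_le hX.le,
      intervalIntegral.integral_sub (hii _ _) hii2,
      intervalIntegral.integral_comp_sub_right (fun x => f x),
      intervalIntegral.integral_interval_sub_interval_comm (hii _ _) (hii _ _) (hii _ _)]
    have z : ∫ x in a..(a - τ), f x = 0 := by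
      rw [intervalIntegral.integral_congr (g := fun _ => 0), intervalIntegral.integral_zero]
      intro x hx
      rw [uIcc_of_ge (by linarith)] at hx
      exact h0 x hx.2
    rw [z, zero_sub, ← intervalIntegral.integral_symm]
    have i1 : ∀ r, (Iio τ).indicator (fun _ => τ ^ (-1 - s)) r * f (X - r)
        = (Iio τ).indicator (fun r => f (X - r) * τ ^ (-1 - s)) r := by
      intro r
      by_cases h : r ∈ Iio τ
      · rw [indicator_of_mem h, indicator_of_mem h, mul_comm]
      · rw [indicator_of_notMem h, indicator_of_notMem h, zero_mul]
    simp_rw [i1]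
    rw [setIntegral_indicator measurableSet_Iio, Ioi_inter_Iio, integral_mul_const,
      ← integral_Ioc_eq_integral_Ioo, ← intervalIntegral.integral_of_le hτ.le,
      intervalIntegral.integral_comp_sub_left (fun x => f x), sub_zero]
  -- second exchange of integrals
  have tail : ∀ r ∈ Ioi (0:ℝ),
      IntegrableOn (fun τ : ℝ => (Iio τ).indicator (fun _ => τ ^ (-1 - s)) r) (Ioi 0) ∧
      ∫ τ in Ioi (0:ℝ), (Iio τ).indicator (fun _ => τ ^ (-1 - s)) r = s⁻¹ * rlp (1 - s) r := by
    intro r hr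
    rw [mem_Ioi] at hr
    have i2 : (fun τ : ℝ => (Iio τ).indicator (fun _ => τ ^ (-1 - s)) r)
        = (Ioi r).indicator (fun τ => τ ^ (-1 - s)) := by
      funext τ
      by_cases h : r < τ
      · rw [indicator_of_mem (by exact h), indicator_of_mem (by exact h)]
      · rw [indicator_of_notMem (by exact h), indicator_of_notMem (by exact h)]
    rw [i2]
    constructor
    · apply Integrable.integrableOn
      rw [integrable_indicator_iff measurableSet_Ioi]
      exact integrableOn_Ioi_rpow_of_lt (by linarith) hr
    · rw [setIntegral_indicator measurableSet_Ioi,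
        inter_eq_self_of_subset_right (Ioi_subset_Ioi hr.le),
        integral_Ioi_rpow_of_lt (by linarith) hr, rlp, if_pos hr,
        show -1 - s + 1 = -s by ring, show 1 - s - 1 = -s by ring, neg_div_neg_eq]
      field_simp
  have hA := rlA_integrable (σ := 1 - s) (by linarith [hs.2]) hcont h0 X
  have hA' : Integrable (fun r => f (X - r) * rlp (1 - s) r) := by
    have := hA.comp_sub_left X
    simpa using this
  have hInt2 : Integrable (Function.uncurry fun τ r : ℝ =>
      (Iio τ).indicator (fun _ => τ ^ (-1 - s)) r * f (X - r))
      ((volume.restrict (Ioi 0)).prod (volume.restrict (Ioi 0))) := by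
    rw [integrable_prod_iff']
    · constructor
      · refine (ae_restrict_iff' measurableSet_Ioi).2 (Eventually.of_forall fun r hr => ?_)
        exact (tail r hr).1.mul_const (f (X - r))
      · have hn := (hA'.norm.const_mul s⁻¹).integrableOn (s := Ioi 0)
        refine hn.congr_fun (fun r hr => ?_) measurableSet_Ioi
        simp only [Function.uncurry, norm_mul]
        rw [integral_mul_const]
        have : ∫ τ in Ioi (0:ℝ), ‖(Iio τ).indicator (fun _ => τ ^ (-1 - s)) r‖
            = ∫ τ in Ioi (0:ℝ), (Iio τ).indicator (fun _ => τ ^ (-1 - s)) r := by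
          refine setIntegral_congr_fun measurableSet_Ioi fun τ hτ => ?_
          rw [mem_Ioi] at hτ
          exact Real.norm_of_nonneg (indicator_nonneg (fun _ _ => by positivity) _)
        rw [this, (tail r hr).2, Real.norm_of_nonneg (rlp_nonneg _ _)]
        ring
    · apply Measurable.aestronglyMeasurable
      have : (Function.uncurry fun τ r : ℝ =>
          (Iio τ).indicator (fun _ => τ ^ (-1 - s)) r * f (X - r))
          = fun z : ℝ × ℝ => (if z.2 < z.1 then z.1 ^ (-1 - s) else 0) * f (X - z.2) := by
        funext z
        simp [Function.uncurry, indicator_apply]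
      rw [this]
      apply Measurable.mul
      · exact Measurable.ite (measurableSet_lt measurable_snd measurable_fst)
          (by fun_prop) (by fun_prop)
      · fun_prop
  rw [e1, e2, setIntegral_congr_fun measurableSet_Ioi e3, integral_integral_swap hInt2]
  have e4 : ∀ r ∈ Ioi (0:ℝ),
      ∫ τ in Ioi (0:ℝ), (Iio τ).indicator (fun _ => τ ^ (-1 - s)) r * f (X - r)
      = s⁻¹ * (f (X - r) * rlp (1 - s) r) := by
    intro r hr
    rw [integral_mul_const, (tail r hr).2]; ring
  rw [setIntegral_congr_fun measurableSet_Ioi e4, integral_const_mul, rlA,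
    ← integral_sub_left_eq_self (fun t => f t * rlp (1 - s) (X - t)) volume X]
  congr 1
  simp only [_root_.sub_sub_cancel]
  refine setIntegral_eq_integral_of_forall_compl_eq_zero fun r hr => ?_
  rw [mem_Ioi] at hr
  rw [rlp, if_neg hr, mul_zero]

/-- Existence: the Marchaud derivative inverts the fractional integral. -/
lemma rlA_rlD {s α : ℝ} (hs : s ∈ Ioo (0:ℝ) 1) (hα : 0 < α) (hsα : s + α < 1)
    {a M : ℝ} (hM : 0 ≤ M) {f : ℝ → ℝ} (hf : ∀ x y, |f x - f y| ≤ M * |x - y| ^ (s + α))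
    (h0 : ∀ x ≤ a, f x = 0) (x : ℝ) :
    rlA s (rlD s f) x = rlB s * s⁻¹ * f x := by
  have hs' : (1 - s) ∈ Ioo (0:ℝ) 1 := ⟨by linarith [hs.2], by linarith [hs.1]⟩
  have hs0 := hs.1
  have hDh := rlD_holder hs hα hM hf h0
  have hD0 : ∀ x ≤ a, rlD s f x = 0 := fun x hx => rlD_zero s h0 hx
  have hDc := holder_continuous hα hDh
  have hfc := holder_continuous (by linarith) hf
  have hgc := holder_continuous (by linarith) (rlA_holder hs hα hsα hDh hD0)
  have hg0 : ∀ x ≤ a, rlA s (rlD s f) x = 0 := fun x hx => rlA_zero s hD0 hx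
  have key := rlA_inj hs' (v := fun y => rlA s (rlD s f) y - rlB s * s⁻¹ * f y) (a := a) (b := x)
    (hgc.sub (continuous_const.mul hfc))
    (fun y hy => by rw [hg0 y hy, h0 y hy]; simp) ?_ x le_rfl
  · linarith
  · intro y _
    have h1 := rlA_semigroup hs hDc hD0 y
    rw [rlD_primitive hs hα hM hf h0 y] at h1
    have i1 := rlA_integrable hs'.1 hgc hg0 y
    have i2 := (rlA_integrable hs'.1 hfc h0 y).const_mul (rlB s * s⁻¹)
    have : rlA (1 - s) (fun y => rlA s (rlD s f) y - rlB s * s⁻¹ * f y) y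
        = rlA (1 - s) (rlA s (rlD s f)) y - rlB s * s⁻¹ * rlA (1 - s) f y := by
      rw [rlA, rlA, rlA, ← integral_const_mul, ← integral_sub i1 i2]
      congr 1
      funext t
      ring
    rw [this, h1]; ring

/-- Extension of a function on `[a,b]` to the line by its boundary values. -/
noncomputable def rlE (a b : ℝ) (v : ℝ → ℝ) (x : ℝ) : ℝ := v (max a (min b x))

lemma rlE_eq {a b : ℝ} (v : ℝ → ℝ) {x : ℝ} (hx : x ∈ Icc a b) : rlE a b v x = v x := by
  rw [rlE, min_eq_right hx.2, max_eq_right hx.1]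

lemma rlE_zero {a b : ℝ} {v : ℝ → ℝ} (hv : v a = 0) (x : ℝ) (hx : x ≤ a) :
    rlE a b v x = 0 := by
  rw [rlE, max_eq_left ((min_le_right _ _).trans hx), hv]

lemma rlE_holder {a b lam M : ℝ} (hab : a < b) (hl : 0 < lam) (hM : 0 ≤ M) {v : ℝ → ℝ}
    (hv : ∀ x ∈ Icc a b, ∀ y ∈ Icc a b, |v x - v y| ≤ M * |x - y| ^ lam) (x y : ℝ) :
    |rlE a b v x - rlE a b v y| ≤ M * |x - y| ^ lam := by
  have h := (LipschitzWith.projIcc hab.le).dist_le_mul x y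
  rw [Subtype.dist_eq, Real.dist_eq, Real.dist_eq] at h
  simp only [NNReal.coe_one, one_mul, coe_projIcc] at h
  have hm : ∀ z, max a (min b z) ∈ Icc a b := fun z =>
    ⟨le_max_left _ _, max_le hab.le (min_le_left _ _)⟩
  refine (hv _ (hm x) _ (hm y)).trans ?_
  gcongr

lemma RLint_eq {a b : ℝ} (s : ℝ) {u : ℝ → ℝ} (h0 : u a = 0) {x : ℝ} (hx : x ∈ Icc a b) :
    RLint a s u x = (Real.Gamma s)⁻¹ * rlA s (rlE a b u) x := by
  rw [RLint, rlA_eq s (rlE_zero h0) hx.1]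
  congr 1
  refine intervalIntegral.integral_congr fun t ht => ?_
  rw [uIcc_of_le hx.1] at ht
  rw [rlE_eq u ⟨ht.1, ht.2.trans hx.2⟩]

lemma RLint_fwd (a b s α : ℝ) (hab : a < b) (hs : s ∈ Ioo (0:ℝ) 1) (hα : 0 < α)
    (hsα : s + α < 1) : ∃ K ≥ (0:ℝ), ∀ (u : ℝ → ℝ) (M : ℝ), 0 ≤ M →
    (∀ x ∈ Icc a b, ∀ y ∈ Icc a b, |u x - u y| ≤ M * |x - y| ^ α) → u a = 0 →
    ∀ x ∈ Icc a b, ∀ y ∈ Icc a b, |RLint a s u x - RLint a s u y| ≤ K * M * |x - y| ^ (s + α) := by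
  have hG := Real.Gamma_pos_of_pos hs.1
  refine ⟨(Real.Gamma s)⁻¹ * ∫ w : ℝ, |w| ^ α * |rlp s (1 + w) - rlp s w|, ?_, ?_⟩
  · have : 0 ≤ ∫ w : ℝ, |w| ^ α * |rlp s (1 + w) - rlp s w| :=
      integral_nonneg fun w => by positivity
    positivity
  · intro u M hM hu h0 x hx y hy
    rw [RLint_eq s h0 hx, RLint_eq s h0 hy, ← mul_sub, abs_mul, abs_of_pos (inv_pos.2 hG)]
    have := rlA_holder hs hα hsα (rlE_holder hab hα hM hu) (rlE_zero h0) x y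
    calc _ ≤ (Real.Gamma s)⁻¹ * ((∫ w : ℝ, |w| ^ α * |rlp s (1 + w) - rlp s w|) * M
          * |x - y| ^ (s + α)) := by gcongr
      _ = _ := by ring

lemma RLint_inv (a b s α : ℝ) (hab : a < b) (hs : s ∈ Ioo (0:ℝ) 1) (hα : 0 < α)
    (hsα : s + α < 1) : ∃ K ≥ (0:ℝ), ∀ (f : ℝ → ℝ) (M : ℝ), 0 ≤ M →
    (∀ x ∈ Icc a b, ∀ y ∈ Icc a b, |f x - f y| ≤ M * |x - y| ^ (s + α)) → f a = 0 →
    ∃ u : ℝ → ℝ, (∀ x ∈ Icc a b, ∀ y ∈ Icc a b, |u x - u y| ≤ K * M * |x - y| ^ α) ∧ u a = 0 ∧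
      ∀ x ∈ Icc a b, f x = RLint a s u x := by
  have hG := Real.Gamma_pos_of_pos hs.1
  have hB := rlB_pos hs
  have hs0 := hs.1
  refine ⟨Real.Gamma s * (rlB s * s⁻¹)⁻¹ * (2 * (1 / α + 1 / s)), by positivity, ?_⟩
  intro f M hM hf h0
  have hE := rlE_holder hab (by linarith) hM hf
  have hE0 := rlE_zero (b := b) h0
  have hu0 : Real.Gamma s * (rlB s * s⁻¹)⁻¹ * rlD s (rlE a b f) a = 0 := by
    rw [rlD_zero s hE0 le_rfl, mul_zero]
  refine ⟨fun x => Real.Gamma s * (rlB s * s⁻¹)⁻¹ * rlD s (rlE a b f) x, ?_, hu0, ?_⟩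
  · intro x _ y _
    have hc : 0 < Real.Gamma s * (rlB s * s⁻¹)⁻¹ := by positivity
    rw [← mul_sub, abs_mul, abs_of_pos hc]
    calc _ ≤ Real.Gamma s * (rlB s * s⁻¹)⁻¹ * ((2 * (1 / α + 1 / s)) * M * |x - y| ^ α) := by
          gcongr
          exact rlD_holder hs hα hM hE hE0 x y
      _ = _ := by ring
  · intro x hx
    have h1 := rlA_rlD hs hα hsα hM hE hE0 x
    rw [rlA_eq s (fun z hz => rlD_zero s hE0 hz) hx.1, rlE_eq f hx] at h1
    rw [RLint]
    have : ∀ t : ℝ, Real.Gamma s * (rlB s * s⁻¹)⁻¹ * rlD s (rlE a b f) t * (x - t) ^ (s - 1)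
      = Real.Gamma s * (rlB s * s⁻¹)⁻¹ * (rlD s (rlE a b f) t * (x - t) ^ (s - 1)) :=
      fun t => mul_assoc _ _ _
    simp_rw [this]
    rw [intervalIntegral.integral_const_mul, h1]
    field_simp

lemma RLint_uniq {a b s α : ℝ} (hab : a < b) (hs : s ∈ Ioo (0:ℝ) 1) (hα : 0 < α)
    {u u' : ℝ → ℝ} (hu : IsHolderOn a b α u) (h0 : u a = 0)
    (hu' : IsHolderOn a b α u') (h0' : u' a = 0)
    (he : ∀ x ∈ Icc a b, RLint a s u x = RLint a s u' x) : ∀ x ∈ Icc a b, u x = u' x := by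
  obtain ⟨M, hM, hu⟩ := hu
  obtain ⟨M', hM', hu'⟩ := hu'
  have hG := Real.Gamma_pos_of_pos hs.1
  have c1 := holder_continuous hα (rlE_holder hab hα hM hu)
  have c2 := holder_continuous hα (rlE_holder hab hα hM' hu')
  have z1 := rlE_zero (b := b) h0
  have z2 := rlE_zero (b := b) h0'
  have key := rlA_inj hs (v := fun y => rlE a b u y - rlE a b u' y) (a := a) (b := b)
    (c1.sub c2) (fun y hy => by rw [z1 y hy, z2 y hy, sub_zero]) ?_
  · intro x hx
    have := key x hx.2
    rw [rlE_eq u hx, rlE_eq u' hx] at this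
    linarith
  · intro x hx
    have : rlA s (fun y => rlE a b u y - rlE a b u' y) x
        = rlA s (rlE a b u) x - rlA s (rlE a b u') x := by
      rw [rlA, rlA, rlA, ← integral_sub (rlA_integrable hs.1 c1 z1 x) (rlA_integrable hs.1 c2 z2 x)]
      congr 1
      funext t
      ring
    rw [this]
    by_cases hxa : x ≤ a
    · rw [rlA_zero s z1 hxa, rlA_zero s z2 hxa, sub_zero]
    · have hm : x ∈ Icc a b := ⟨by linarith, hx⟩
      have h1 := he x hm
      rw [RLint_eq s h0 hm, RLint_eq s h0' hm] at h1
      rw [mul_left_cancel₀ (inv_pos.2 hG).ne' h1, sub_self]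

lemma holderNorm_le {a b lam M : ℝ} (hl : 0 < lam) (hM : 0 ≤ M) {v : ℝ → ℝ}
    (hv : ∀ x ∈ Icc a b, ∀ y ∈ Icc a b, |v x - v y| ≤ M * |x - y| ^ lam) (h0 : v a = 0)
    (hab : a < b) : holderNorm a b lam v ≤ (1 + (b - a) ^ lam) * M := by
  have hba : 0 < b - a := by linarith
  have h1 : (⨆ x : Icc a b, |v x|) ≤ (b - a) ^ lam * M := by
    refine Real.iSup_le (fun x => ?_) (by positivity)
    have := hv x x.2 a ⟨le_rfl, hab.le⟩
    rw [h0, sub_zero] at this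
    refine this.trans ?_
    rw [mul_comm]
    have h2 : |(x:ℝ) - a| ≤ b - a := by
      rw [abs_of_nonneg (by linarith [x.2.1])]; linarith [x.2.2]
    gcongr
  have h2 : (⨆ q : {q : Set.Icc a b × Set.Icc a b // (q.1 : ℝ) ≠ (q.2 : ℝ)},
      |v q.val.1 - v q.val.2| / |(q.val.1 : ℝ) - (q.val.2 : ℝ)| ^ lam) ≤ M := by
    refine Real.iSup_le (fun q => ?_) hM
    have hp : 0 < |(q.val.1 : ℝ) - (q.val.2 : ℝ)| := abs_pos.2 (sub_ne_zero.2 q.2)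
    rw [div_le_iff₀ (by positivity)]
    exact hv _ q.val.1.2 _ q.val.2.2
  rw [holderNorm]
  linarith

lemma holderNorm_nonneg (a b lam : ℝ) (v : ℝ → ℝ) : 0 ≤ holderNorm a b lam v :=
  add_nonneg (Real.iSup_nonneg fun _ => abs_nonneg _) (Real.iSup_nonneg fun _ => by positivity)

lemma holder_of_norm {a b lam : ℝ} (hl : 0 < lam) {v : ℝ → ℝ} (hv : IsHolderOn a b lam v) :
    ∀ x ∈ Icc a b, ∀ y ∈ Icc a b, |v x - v y| ≤ holderNorm a b lam v * |x - y| ^ lam := by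
  obtain ⟨M, hM, hv⟩ := hv
  intro x hx y hy
  by_cases hxy : x = y
  · rw [hxy]; simp [Real.zero_rpow hl.ne']
  have hp : 0 < |x - y| := abs_pos.2 (sub_ne_zero.2 hxy)
  rw [← div_le_iff₀ (by positivity)]
  have hbdd : BddAbove (range fun q : {q : Set.Icc a b × Set.Icc a b // (q.1 : ℝ) ≠ (q.2 : ℝ)} =>
      |v q.val.1 - v q.val.2| / |(q.val.1 : ℝ) - (q.val.2 : ℝ)| ^ lam) := by
    refine ⟨M, ?_⟩
    rintro _ ⟨q, rfl⟩
    have hp : 0 < |(q.val.1 : ℝ) - (q.val.2 : ℝ)| := abs_pos.2 (sub_ne_zero.2 q.2)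
    simp only
    rw [div_le_iff₀ (by positivity)]
    exact hv _ q.val.1.2 _ q.val.2.2
  have h1 := le_ciSup hbdd ⟨(⟨x, hx⟩, ⟨y, hy⟩), hxy⟩
  have h2 : 0 ≤ ⨆ x : Icc a b, |v x| := Real.iSup_nonneg fun _ => abs_nonneg _
  rw [holderNorm]
  simp only at h1
  linarith

/-- for `s + α < 1`, `I_{a+}^s` is an isomorphism between the Hölder classes
of exponents `α` and `s + α` vanishing at `a`. -/
theorem rl_fracint_holder_iso (a b s α : ℝ) (hab : a < b) (hs : s ∈ Set.Ioo (0:ℝ) 1)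
    (hα : α ∈ Set.Ioo (0:ℝ) 1) (hsα : s + α < 1) :
    (∀ u : ℝ → ℝ, IsHolderOn a b α u → u a = 0 →
        IsHolderOn a b (s + α) (RLint a s u) ∧ RLint a s u a = 0) ∧
    (∀ f : ℝ → ℝ, IsHolderOn a b (s + α) f → f a = 0 →
        ∃ u : ℝ → ℝ, (IsHolderOn a b α u ∧ u a = 0 ∧
            ∀ x ∈ Set.Icc a b, f x = RLint a s u x) ∧
          ∀ u' : ℝ → ℝ, (IsHolderOn a b α u' ∧ u' a = 0 ∧
              ∀ x ∈ Set.Icc a b, f x = RLint a s u' x) →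
            ∀ x ∈ Set.Icc a b, u' x = u x) ∧
    (∃ C > (0:ℝ), ∃ D > (0:ℝ), ∀ u f : ℝ → ℝ,
        IsHolderOn a b α u → u a = 0 → IsHolderOn a b (s + α) f → f a = 0 →
        (∀ x ∈ Set.Icc a b, f x = RLint a s u x) →
        C * holderNorm a b (s + α) f ≤ holderNorm a b α u ∧
          holderNorm a b α u ≤ D * holderNorm a b (s + α) f) := by
  obtain ⟨K₁, hK₁, fwd⟩ := RLint_fwd a b s α hab hs hα.1 hsα
  obtain ⟨K₂, hK₂, inv⟩ := RLint_inv a b s α hab hs hα.1 hsα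
  have hβ : 0 < s + α := by linarith [hs.1, hα.1]
  have hba : 0 < b - a := by linarith
  refine ⟨?_, ?_, ?_⟩
  · rintro u ⟨M, hM, hu⟩ h0
    exact ⟨⟨K₁ * M, mul_nonneg hK₁ hM, fwd u M hM hu h0⟩, by simp [RLint]⟩
  · rintro f ⟨M, hM, hf⟩ h0
    obtain ⟨u, hu, hu0, hfu⟩ := inv f M hM hf h0
    have hH : IsHolderOn a b α u := ⟨K₂ * M, mul_nonneg hK₂ hM, hu⟩
    refine ⟨u, ⟨hH, hu0, hfu⟩, ?_⟩
    rintro u' ⟨hH', hu0', hfu'⟩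
    exact RLint_uniq hab hs hα.1 hH' hu0' hH hu0 (fun x hx => by rw [← hfu' x hx, hfu x hx])
  · refine ⟨((1 + (b - a) ^ (s + α)) * (K₁ + 1))⁻¹, by positivity,
      (1 + (b - a) ^ α) * (K₂ + 1), by positivity, ?_⟩
    intro u f hu hu0 hf hf0 hfu
    have nu := holderNorm_nonneg a b α u
    have nf := holderNorm_nonneg a b (s + α) f
    constructor
    · have h1 := fwd u _ nu (holder_of_norm hα.1 hu) hu0
      have h2 : holderNorm a b (s + α) f
          ≤ (1 + (b - a) ^ (s + α)) * (K₁ * holderNorm a b α u) := by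
        refine holderNorm_le hβ (by positivity) ?_ hf0 hab
        intro x hx y hy
        rw [hfu x hx, hfu y hy]
        exact h1 x hx y hy
      rw [inv_mul_le_iff₀ (by positivity)]
      refine h2.trans ?_
      rw [mul_assoc]
      gcongr
      linarith
    · obtain ⟨w, hw, hw0, hfw⟩ := inv f _ nf (holder_of_norm hβ hf) hf0
      have hH : IsHolderOn a b α w := ⟨_, by positivity, hw⟩
      have huw := RLint_uniq hab hs hα.1 hu hu0 hH hw0
        (fun x hx => by rw [← hfu x hx, hfw x hx])
      have h2 : holderNorm a b α u
          ≤ (1 + (b - a) ^ α) * (K₂ * holderNorm a b (s + α) f) := by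
        refine holderNorm_le hα.1 (by positivity) ?_ hu0 hab
        intro x hx y hy
        rw [huw x hx, huw y hy]
        exact hw x hx y hy
      refine h2.trans ?_
      rw [mul_assoc]
      gcongr
      linarith
end

section
/- Let a < b be real numbers, α ∈ (0,1), and let u : [a,b] → ℝ be Hölder continuous of exponent α with u(a) = 0. Then for every s ∈ (0,α) there exists a function v : [a,b] → ℝ, Hölder continuous of exponent α − s, such that I_{a+}^{1−s}[u](x) = ∫_a^x v(t) dt for every x ∈ [a,b]. In particular the Riemann–Liouville derivative D_{a+}^s u exists at every point of [a,b], equals v, and is Hölder continuous of exponent α − s. -/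
open MeasureTheory Set Filter ENNReal

lemma aux_cont {w : ℝ → ℝ} {M α : ℝ} (hα : 0 < α)
    (hw : ∀ x y, |w x - w y| ≤ M * |x - y| ^ α) : Continuous w := by
  rw [continuous_iff_continuousAt]
  intro x
  rw [ContinuousAt, tendsto_iff_dist_tendsto_zero]
  have h1 : Tendsto (fun y : ℝ => M * |y - x| ^ α) (nhds x) (nhds 0) := by
    have : Continuous (fun y : ℝ => M * |y - x| ^ α) :=
      continuous_const.mul ((continuous_id.sub continuous_const).abs.rpow_const
        (fun _ => Or.inr hα.le))
    have h := this.tendsto x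
    simpa [Real.zero_rpow hα.ne'] using h
  exact squeeze_zero (fun _ => dist_nonneg) (fun y => by rw [Real.dist_eq]; exact hw y x) h1

lemma aux_int {w : ℝ → ℝ} {M α s L : ℝ} (hα : 0 < α) (hs : s < α) (hL : 0 < L)
    (hw : ∀ x y, |w x - w y| ≤ M * |x - y| ^ α) (x : ℝ) :
    IntervalIntegrable (fun r => (w x - w (x - r)) * r ^ (-1 - s)) volume 0 L := by
  have hc := aux_cont hα hw
  have h1 : IntervalIntegrable (fun r : ℝ => M * r ^ (α - 1 - s)) volume 0 L :=
    (intervalIntegral.intervalIntegrable_rpow' (by linarith)).const_mul M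
  refine h1.mono_fun' (Measurable.aestronglyMeasurable ?_) ?_
  · have := hc.measurable
    fun_prop
  · rw [EventuallyLE, ae_restrict_iff' measurableSet_uIoc]
    refine Eventually.of_forall fun r hr => ?_
    rw [uIoc_of_le hL.le] at hr
    have hr0 := hr.1
    rw [norm_mul, Real.norm_eq_abs, Real.norm_eq_abs, abs_of_pos (Real.rpow_pos_of_pos hr0 _)]
    have h2 := hw x (x - r)
    rw [show x - (x - r) = r by ring, abs_of_pos hr0] at h2
    calc _ ≤ M * r ^ α * r ^ (-1 - s) := by gcongr
      _ = _ := by rw [mul_assoc, ← Real.rpow_add hr0]; ring_nf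

lemma aux_holder {w : ℝ → ℝ} {M α s L : ℝ} (hM : 0 ≤ M) (hα : 0 < α) (hs0 : 0 < s) (hs : s < α)
    (hL : 0 < L) (hw : ∀ x y, |w x - w y| ≤ M * |x - y| ^ α) (x y : ℝ) (hxy : |x - y| ≤ L) :
    |(∫ r in (0:ℝ)..L, (w x - w (x - r)) * r ^ (-1 - s)) -
      ∫ r in (0:ℝ)..L, (w y - w (y - r)) * r ^ (-1 - s)| ≤
      (2 * M / (α - s) + 2 * M / s) * |x - y| ^ (α - s) := by
  rcases eq_or_ne x y with rfl | hne
  · simp [Real.zero_rpow (sub_pos.2 hs).ne']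
  set h := |x - y| with hh
  have hpos : 0 < h := abs_pos.2 (sub_ne_zero.2 hne)
  have ix := aux_int hα hs hL hw x
  have iy := aux_int hα hs hL hw y
  have ixy := ix.sub iy
  rw [← intervalIntegral.integral_sub ix iy]
  have i1 := ixy.mono_set (c := 0) (d := h)
    (by rw [uIcc_of_le hpos.le, uIcc_of_le hL.le]; exact Icc_subset_Icc le_rfl hxy)
  have i2 := ixy.mono_set (c := h) (d := L)
    (by rw [uIcc_of_le hxy, uIcc_of_le hL.le]; exact Icc_subset_Icc hpos.le le_rfl)
  rw [← intervalIntegral.integral_add_adjacent_intervals i1 i2]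
  have hn0 : (0:ℝ) ∉ uIcc h L := by
    rw [uIcc_of_le hxy]; intro h'; exact absurd h'.1 (not_le.2 hpos)
  have b1 : ‖∫ r in (0:ℝ)..h, ((w x - w (x - r)) * r ^ (-1 - s) -
      (w y - w (y - r)) * r ^ (-1 - s))‖ ≤ ∫ r in (0:ℝ)..h, 2 * M * r ^ (α - 1 - s) := by
    refine intervalIntegral.norm_integral_le_of_norm_le hpos.le ?_
      ((intervalIntegral.intervalIntegrable_rpow' (by linarith)).const_mul _)
    refine Eventually.of_forall fun r hr => ?_
    have hr0 := hr.1
    rw [← sub_mul, norm_mul, Real.norm_eq_abs, Real.norm_eq_abs,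
      abs_of_pos (Real.rpow_pos_of_pos hr0 _)]
    have h2 := hw x (x - r)
    have h3 := hw y (y - r)
    rw [show x - (x - r) = r by ring, abs_of_pos hr0] at h2
    rw [show y - (y - r) = r by ring, abs_of_pos hr0] at h3
    have h4 := abs_sub (w x - w (x - r)) (w y - w (y - r))
    calc _ ≤ (2 * M * r ^ α) * r ^ (-1 - s) := by gcongr; linarith
      _ = _ := by rw [mul_assoc, ← Real.rpow_add hr0]; ring_nf
  have b2 : ‖∫ r in h..L, ((w x - w (x - r)) * r ^ (-1 - s) -
      (w y - w (y - r)) * r ^ (-1 - s))‖ ≤ ∫ r in h..L, 2 * M * h ^ α * r ^ (-1 - s) := by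
    refine intervalIntegral.norm_integral_le_of_norm_le hxy ?_
      ((intervalIntegral.intervalIntegrable_rpow (Or.inr hn0)).const_mul _)
    refine Eventually.of_forall fun r hr => ?_
    have hr0 := hpos.trans hr.1
    rw [← sub_mul, norm_mul, Real.norm_eq_abs, Real.norm_eq_abs,
      abs_of_pos (Real.rpow_pos_of_pos hr0 _)]
    have h2 := hw x y
    have h3 := hw (x - r) (y - r)
    rw [show x - r - (y - r) = x - y by ring] at h3
    have h4 := abs_sub (w x - w y) (w (x - r) - w (y - r))
    rw [show w x - w (x - r) - (w y - w (y - r)) = w x - w y - (w (x - r) - w (y - r)) by ring]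
    gcongr
    linarith
  rw [intervalIntegral.integral_const_mul, integral_rpow (Or.inl (by linarith))] at b1
  rw [intervalIntegral.integral_const_mul, integral_rpow (Or.inr ⟨by linarith, hn0⟩)] at b2
  rw [show α - 1 - s + 1 = α - s by ring, Real.zero_rpow (sub_pos.2 hs).ne'] at b1
  rw [show -1 - s + 1 = -s by ring] at b2
  have hLs : 0 < L ^ (-s) := Real.rpow_pos_of_pos hL _
  have b3 : 2 * M * h ^ α * ((L ^ (-s) - h ^ (-s)) / -s) ≤ 2 * M / s * h ^ (α - s) := by
    have e : h ^ (α - s) = h ^ α * h ^ (-s) := by rw [← Real.rpow_add hpos]; ring_nf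
    rw [e]
    have : (L ^ (-s) - h ^ (-s)) / -s ≤ h ^ (-s) / s := by
      rw [div_neg, ← neg_div]; gcongr; linarith
    calc _ ≤ 2 * M * h ^ α * (h ^ (-s) / s) := by gcongr
      _ = _ := by ring
  refine (abs_add_le _ _).trans ?_
  rw [Real.norm_eq_abs] at b1 b2
  have : 2 * M * ((h ^ (α - s) - 0) / (α - s)) = 2 * M / (α - s) * h ^ (α - s) := by ring
  linarith

lemma aux_prim {w : ℝ → ℝ} {M B α s L a x : ℝ} (hα : 0 < α) (hs0 : 0 < s) (hs : s < α)
    (hs1 : s < 1) (hL : 0 < L) (hw : ∀ x y, |w x - w y| ≤ M * |x - y| ^ α)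
    (hB : ∀ t, |w t| ≤ B) (h0 : ∀ t ≤ a, w t = 0) (hax : a ≤ x) (hxL : x - a ≤ L) :
    (∫ y in a..x, w y) * L ^ (-s) +
      s * (∫ y in a..x, ∫ r in (0:ℝ)..L, (w y - w (y - r)) * r ^ (-1 - s)) =
    ∫ r in (0:ℝ)..L, w (x - r) * r ^ (-s) := by
  have hc := aux_cont hα hw
  have hii : ∀ p q, IntervalIntegrable w volume p q := fun p q => hc.intervalIntegrable p q
  have hm := hc.measurable
  -- Fubini
  have hswap : (∫ y in a..x, ∫ r in (0:ℝ)..L, (w y - w (y - r)) * r ^ (-1 - s)) =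
      ∫ r in (0:ℝ)..L, ∫ y in a..x, (w y - w (y - r)) * r ^ (-1 - s) := by
    simp_rw [intervalIntegral.integral_of_le hL.le]
    refine intervalIntegral_integral_swap ?_
    have h1 : Integrable (fun r : ℝ => M * r ^ (α - 1 - s)) (volume.restrict (Ioc 0 L)) := by
      have : IntervalIntegrable (fun r : ℝ => M * r ^ (α - 1 - s)) volume 0 L :=
        (intervalIntegral.intervalIntegrable_rpow' (by linarith)).const_mul M
      exact this.1
    have : IsFiniteMeasure (volume.restrict (uIoc a x)) :=
      ⟨by rw [Measure.restrict_apply_univ, uIoc_of_le hax]; exact measure_Ioc_lt_top⟩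
    have h2 := h1.comp_snd (volume.restrict (uIoc a x))
    refine h2.mono' (Measurable.aestronglyMeasurable ?_) ?_
    · unfold Function.uncurry
      fun_prop
    · rw [Measure.prod_restrict, ae_restrict_iff' (measurableSet_uIoc.prod measurableSet_Ioc)]
      refine Eventually.of_forall fun p hp => ?_
      have hr0 : 0 < p.2 := hp.2.1
      simp only [Function.uncurry]
      rw [norm_mul, Real.norm_eq_abs, Real.norm_eq_abs, abs_of_pos (Real.rpow_pos_of_pos hr0 _)]
      have h2 := hw p.1 (p.1 - p.2)
      rw [show p.1 - (p.1 - p.2) = p.2 by ring, abs_of_pos hr0] at h2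
      calc _ ≤ M * p.2 ^ α * p.2 ^ (-1 - s) := by gcongr
        _ = _ := by rw [mul_assoc, ← Real.rpow_add hr0]; ring_nf
  set H : ℝ → ℝ := fun r => (∫ y in a..x, w y) - ∫ y in a..(x - r), w y with hH
  have hz : ∀ z ≤ a, ∫ y in a..z, w y = 0 := by
    intro z hz
    rw [intervalIntegral.integral_congr (g := fun _ => (0:ℝ)), intervalIntegral.integral_zero]
    intro y hy
    rw [uIcc_of_ge hz] at hy
    exact h0 y hy.2
  have hinner : (∫ r in (0:ℝ)..L, ∫ y in a..x, (w y - w (y - r)) * r ^ (-1 - s)) =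
      ∫ r in (0:ℝ)..L, H r * r ^ (-1 - s) := by
    refine intervalIntegral.integral_congr fun r hr => ?_
    rw [uIcc_of_le hL.le] at hr
    simp only [intervalIntegral.integral_mul_const]
    congr 1
    have hc2 : Continuous fun y => w (y - r) := hc.comp (continuous_id.sub continuous_const)
    rw [intervalIntegral.integral_sub (hii _ _) (hc2.intervalIntegrable _ _),
      intervalIntegral.integral_comp_sub_right (fun y => w y) r,
      ← intervalIntegral.integral_add_adjacent_intervals (hii (a - r) a) (hii a (x - r)),
      intervalIntegral.integral_symm a (a - r), hz (a - r) (by linarith [hr.1])]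
    simp [hH]
  have hHd : ∀ r, HasDerivAt H (w (x - r)) r := by
    intro r
    have h1 : HasDerivAt (fun z => ∫ y in a..z, w y) (w (x - r)) (x - r) :=
      intervalIntegral.integral_hasDerivAt_right (hii _ _)
        (hc.stronglyMeasurableAtFilter _ _) hc.continuousAt
    have h2 : HasDerivAt (fun r : ℝ => x - r) (-1) r := by
      simpa using (hasDerivAt_id r).const_sub x
    have h3 := (h1.comp r h2).const_sub (∫ y in a..x, w y)
    rw [mul_neg_one, neg_neg] at h3
    exact h3
  have hHb : ∀ r, 0 ≤ r → |H r| ≤ B * r := by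
    intro r hr
    have : H r = ∫ y in (x - r)..x, w y := by
      simp only [hH]
      rw [← intervalIntegral.integral_interval_sub_left (hii a x) (hii a (x - r))]
    rw [this]
    have h1 := intervalIntegral.norm_integral_le_of_norm_le_const (a := x - r) (b := x) (f := w)
      (C := B) (fun t _ => hB t)
    rwa [show x - (x - r) = r by ring, abs_of_nonneg hr] at h1
  have hHc : Continuous H := continuous_iff_continuousAt.2 fun r => (hHd r).continuousAt
  have hHm := hHc.measurable
  have int1 : IntervalIntegrable (fun r => w (x - r) * r ^ (-s)) volume 0 L :=
    (intervalIntegral.intervalIntegrable_rpow' (by linarith)).continuousOn_mul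
      (hc.comp (continuous_const.sub continuous_id)).continuousOn
  have int2 : IntervalIntegrable (fun r => H r * r ^ (-1 - s)) volume 0 L := by
    have h1 : IntervalIntegrable (fun r : ℝ => B * r ^ (-s)) volume 0 L :=
      (intervalIntegral.intervalIntegrable_rpow' (by linarith)).const_mul B
    refine h1.mono_fun' (Measurable.aestronglyMeasurable (by fun_prop)) ?_
    rw [EventuallyLE, ae_restrict_iff' measurableSet_uIoc]
    refine Eventually.of_forall fun r hr => ?_
    rw [uIoc_of_le hL.le] at hr
    have hr0 := hr.1
    rw [norm_mul, Real.norm_eq_abs, Real.norm_eq_abs, abs_of_pos (Real.rpow_pos_of_pos hr0 _)]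
    calc _ ≤ B * r * r ^ (-1 - s) := by gcongr; exact hHb r hr0.le
      _ = B * (r ^ (1:ℝ) * r ^ (-1 - s)) := by rw [Real.rpow_one]; ring
      _ = _ := by rw [← Real.rpow_add hr0]; ring_nf
  have hcont : ContinuousOn (fun r => H r * r ^ (-s)) (Icc 0 L) := by
    intro r hr
    rcases hr.1.eq_or_lt with rfl | hr0
    · have hH0 : H 0 = 0 := by simp [hH]
      rw [ContinuousWithinAt, hH0, zero_mul]
      have h1 : Tendsto (fun r : ℝ => B * r ^ (1 - s)) (nhdsWithin 0 (Icc 0 L)) (nhds 0) := by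
        have : Continuous (fun r : ℝ => B * r ^ (1 - s)) :=
          continuous_const.mul (continuous_id.rpow_const (fun _ => Or.inr (by linarith)))
        have h := this.tendsto 0
        rw [Real.zero_rpow (by linarith), mul_zero] at h
        exact h.mono_left nhdsWithin_le_nhds
      refine squeeze_zero_norm' ?_ h1
      filter_upwards [self_mem_nhdsWithin] with r hr
      rcases hr.1.eq_or_lt with rfl | hr0
      · rw [hH0, Real.zero_rpow (by linarith : (1 - s) ≠ 0)]; simp
      rw [norm_mul, Real.norm_eq_abs, Real.norm_eq_abs, abs_of_pos (Real.rpow_pos_of_pos hr0 _)]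
      calc _ ≤ B * r * r ^ (-s) := by gcongr; exact hHb r hr0.le
        _ = B * (r ^ (1:ℝ) * r ^ (-s)) := by rw [Real.rpow_one]; ring
        _ = _ := by rw [← Real.rpow_add hr0]; ring_nf
    · exact (hHc.continuousAt.mul
        (Real.continuousAt_rpow_const _ _ (Or.inl hr0.ne'))).continuousWithinAt
  have hftc := intervalIntegral.integral_eq_sub_of_hasDerivAt_of_le hL.le hcont
    (f' := fun r => w (x - r) * r ^ (-s) - s * (H r * r ^ (-1 - s))) (fun r hr => by
      have h1 := (hHd r).mul (Real.hasDerivAt_rpow_const (p := -s) (Or.inl hr.1.ne'))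
      refine h1.congr_deriv ?_
      rw [show -s - 1 = -1 - s by ring]; ring) (int1.sub (int2.const_mul s))
  rw [intervalIntegral.integral_sub int1 (int2.const_mul s),
    intervalIntegral.integral_const_mul] at hftc
  have hHL : H L = ∫ y in a..x, w y := by
    simp [hH, hz (x - L) (by linarith)]
  have hH0 : H 0 = 0 := by simp [hH]
  rw [hHL, hH0] at hftc
  rw [hswap, hinner]
  linarith

/-- if `u` is Hölder of exponent `α` with `u(a) = 0` and `s ∈ (0,α)`,
then `I_{a+}^{1-s}[u]` is a primitive of a Hölder function `v` of exponent `α - s`;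
in particular `D_{a+}^s u` exists at every point of `[a,b]` and equals `v`. -/
theorem rl_deriv_of_holder (a b s α : ℝ) (hab : a < b) (hα : α ∈ Set.Ioo (0:ℝ) 1)
    (hs : s ∈ Set.Ioo 0 α) (u : ℝ → ℝ) (hu : IsHolderOn a b α u) (hua : u a = 0) :
    ∃ v : ℝ → ℝ, IsHolderOn a b (α - s) v ∧
      (∀ x ∈ Set.Icc a b, RLint a (1 - s) u x = ∫ t in a..x, v t) ∧
      (∀ x ∈ Set.Icc a b,
        HasDerivWithinAt (RLint a (1 - s) u) (v x) (Set.Icc a b) x) := by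
  obtain ⟨M, hM, hu⟩ := hu
  obtain ⟨hα0, hα1⟩ := hα
  obtain ⟨hs0, hsα⟩ := hs
  set L := b - a with hLdef
  have hL : 0 < L := sub_pos.2 hab
  set w : ℝ → ℝ := fun t => u (max a (min b t)) with hwdef
  have hmem : ∀ t, max a (min b t) ∈ Icc a b := fun t =>
    ⟨le_max_left _ _, max_le hab.le (min_le_left _ _)⟩
  have hw : ∀ x y, |w x - w y| ≤ M * |x - y| ^ α := by
    intro x y
    refine (hu _ (hmem x) _ (hmem y)).trans ?_
    have h1 := abs_max_sub_max_le_max a (min b x) a (min b y)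
    have h2 := abs_min_sub_min_le_max b x b y
    simp only [sub_self, abs_zero] at h1 h2
    rw [max_eq_right (abs_nonneg (min b x - min b y))] at h1
    rw [max_eq_right (abs_nonneg (x - y))] at h2
    exact mul_le_mul_of_nonneg_left
      (Real.rpow_le_rpow (abs_nonneg _) (h1.trans h2) hα0.le) hM
  have h0 : ∀ t ≤ a, w t = 0 := by
    intro t ht
    simp only [hwdef]
    rw [min_eq_right (ht.trans hab.le), max_eq_left ht, hua]
  have hwu : ∀ t ∈ Icc a b, w t = u t := by
    intro t ht
    simp only [hwdef]
    rw [min_eq_right ht.2, max_eq_right ht.1]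
  have hB : ∀ t, |w t| ≤ M * L ^ α := by
    intro t
    have h1 := hu _ (hmem t) a ⟨le_rfl, hab.le⟩
    rw [hua, sub_zero] at h1
    refine h1.trans ?_
    gcongr
    rw [abs_of_nonneg (sub_nonneg.2 (hmem t).1)]
    exact sub_le_sub_right (hmem t).2 a
  have hc := aux_cont hα0 hw
  set G : ℝ → ℝ := fun x => ∫ r in (0:ℝ)..L, (w x - w (x - r)) * r ^ (-1 - s) with hG
  set K := 2 * M / (α - s) + 2 * M / s with hK
  have hαs : 0 < α - s := sub_pos.2 hsα
  have hK0 : 0 ≤ K := by positivity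
  have hGh : ∀ x y, |x - y| ≤ L → |G x - G y| ≤ K * |x - y| ^ (α - s) := fun x y hxy =>
    aux_holder hM hα0 hs0 hsα hL hw x y hxy
  have hGc : Continuous G := by
    rw [continuous_iff_continuousAt]
    intro x
    rw [ContinuousAt, tendsto_iff_dist_tendsto_zero]
    have h1 : Tendsto (fun y : ℝ => K * |y - x| ^ (α - s)) (nhds x) (nhds 0) := by
      have : Continuous (fun y : ℝ => K * |y - x| ^ (α - s)) :=
        continuous_const.mul ((continuous_id.sub continuous_const).abs.rpow_const
          (fun _ => Or.inr hαs.le))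
      have h := this.tendsto x
      simpa [Real.zero_rpow hαs.ne'] using h
    refine squeeze_zero' (Eventually.of_forall fun _ => dist_nonneg) ?_ h1
    filter_upwards [Metric.closedBall_mem_nhds x hL] with y hy
    rw [Real.dist_eq]
    exact hGh y x (by simpa [Real.dist_eq] using hy)
  set g := (Real.Gamma (1 - s))⁻¹ with hg
  have hg0 : 0 ≤ g := inv_nonneg.2 (Real.Gamma_pos_of_pos (by linarith)).le
  set v : ℝ → ℝ := fun x => g * (w x * L ^ (-s) + s * G x) with hv
  have hvc : Continuous v := by fun_prop
  have hprim : ∀ x ∈ Icc a b, RLint a (1 - s) u x = ∫ t in a..x, v t := by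
    intro x hx
    have hp := aux_prim hα0 hs0 hsα (hsα.trans hα1) hL hw hB h0 hx.1
      (show x - a ≤ L from sub_le_sub_right hx.2 a)
    have e1 : ∫ t in a..x, v t =
        g * ((∫ y in a..x, w y) * L ^ (-s) + s * ∫ y in a..x, G y) := by
      simp only [hv]
      rw [intervalIntegral.integral_const_mul, intervalIntegral.integral_add,
        intervalIntegral.integral_mul_const, intervalIntegral.integral_const_mul]
      · exact (hc.mul continuous_const).intervalIntegrable _ _
      · exact (continuous_const.mul hGc).intervalIntegrable _ _
    rw [e1, hp, RLint, ← hg]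
    congr 1
    have e2 : ∫ t in a..x, u t * (x - t) ^ (1 - s - 1) =
        ∫ t in a..x, w (x - (x - t)) * (x - t) ^ (-s) := by
      refine intervalIntegral.integral_congr fun t ht => ?_
      rw [uIcc_of_le hx.1] at ht
      show u t * (x - t) ^ (1 - s - 1) = w (x - (x - t)) * (x - t) ^ (-s)
      rw [_root_.sub_sub_cancel, hwu t ⟨ht.1, ht.2.trans hx.2⟩, show 1 - s - 1 = -s by ring]
    rw [e2, intervalIntegral.integral_comp_sub_left (fun r => w (x - r) * r ^ (-s)) x, sub_self]
    have int1 : ∀ p q, IntervalIntegrable (fun r => w (x - r) * r ^ (-s)) volume p q :=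
      fun p q => (intervalIntegral.intervalIntegrable_rpow' (by linarith)).continuousOn_mul
        (hc.comp (continuous_const.sub continuous_id)).continuousOn
    rw [← intervalIntegral.integral_add_adjacent_intervals (int1 0 (x - a)) (int1 (x - a) L)]
    rw [intervalIntegral.integral_congr (a := x - a) (b := L) (g := fun _ => (0:ℝ)),
      intervalIntegral.integral_zero, add_zero]
    intro r hr
    rw [uIcc_of_le (sub_le_sub_right hx.2 a)] at hr
    show w (x - r) * r ^ (-s) = 0
    rw [h0 (x - r) (by linarith [hr.1]), zero_mul]
  refine ⟨v, ⟨g * (M * L ^ s * L ^ (-s) + s * K), by positivity, ?_⟩, hprim, ?_⟩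
  · intro x hx y hy
    have hxy : |x - y| ≤ L := by
      rw [abs_le]; constructor <;> linarith [hx.1, hx.2, hy.1, hy.2]
    have h1 := hGh x y hxy
    have h2 : |w x - w y| ≤ M * L ^ s * |x - y| ^ (α - s) := by
      refine (hw x y).trans ?_
      have : |x - y| ^ α = |x - y| ^ s * |x - y| ^ (α - s) := by
        rw [← Real.rpow_add_of_nonneg (abs_nonneg _) hs0.le hαs.le]; ring_nf
      rw [this, ← mul_assoc]
      gcongr
    have e : v x - v y = g * ((w x - w y) * L ^ (-s) + s * (G x - G y)) := by
      simp only [hv]; ring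
    rw [e, abs_mul, abs_of_nonneg hg0]
    have h3 := abs_add_le ((w x - w y) * L ^ (-s)) (s * (G x - G y))
    rw [abs_mul, abs_mul, abs_of_pos hs0, abs_of_pos (Real.rpow_pos_of_pos hL _)] at h3
    calc _ ≤ g * (M * L ^ s * |x - y| ^ (α - s) * L ^ (-s) + s * (K * |x - y| ^ (α - s))) := by
          gcongr
          refine h3.trans ?_
          gcongr
      _ = _ := by ring
  · intro x hx
    have h1 : HasDerivAt (fun z => ∫ y in a..z, v y) (v x) x :=
      intervalIntegral.integral_hasDerivAt_right (hvc.intervalIntegrable _ _)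
        (hvc.stronglyMeasurableAtFilter _ _) hvc.continuousAt
    exact h1.hasDerivWithinAt.congr hprim (hprim x hx)
end

section
/- Let a < b be real numbers and 0 < s < s' < 1. Then there exists a constant C > 0, depending only on a, b, s and s', such that for every u ∈ L^1(a,b) with finite Gagliardo seminorm [u]_{W_G^{s',1}(a,b)} < ∞ and such that u = I_{a+}^s[φ] almost everywhere for some φ ∈ L^1(a,b), one has ‖φ‖_{L^1(a,b)} ≤ C (‖u‖_{L^1(a,b)} + [u]_{W_G^{s',1}(a,b)}). Since φ = D_{a+}^s u, this says ‖D_{a+}^s u‖_{L^1(a,b)} ≤ C ‖u‖_{W_G^{s',1}(a,b)}. -/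
open MeasureTheory Set Filter ENNReal

/-- truncated power -/
noncomputable def pw (p r : ℝ) : ℝ := (max r 0) ^ p

/-- second backward difference of the truncated power -/
noncomputable def dd (p h r : ℝ) : ℝ := pw p r - 2 * pw p (r - h) + pw p (r - 2 * h)

lemma pw_cont (p : ℝ) (hp : 0 < p) : Continuous (pw p) := by
  unfold pw
  exact (continuous_id.max continuous_const).rpow_const (fun x => Or.inr hp.le)

lemma dd_cont (p h : ℝ) (hp : 0 < p) : Continuous (dd p h) := by
  have := pw_cont p hp
  unfold dd
  fun_prop

lemma pw_nonneg (p r : ℝ) : 0 ≤ pw p r := Real.rpow_nonneg (le_max_right _ _) _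

lemma pw_of_nonpos (p r : ℝ) (hp : 0 < p) (hr : r ≤ 0) : pw p r = 0 := by
  unfold pw; rw [max_eq_right hr, Real.zero_rpow hp.ne']

lemma pw_of_pos (p r : ℝ) (hr : 0 ≤ r) : pw p r = r ^ p := by
  unfold pw; rw [max_eq_left hr]

lemma pw_mono (p : ℝ) (hp : 0 < p) : Monotone (pw p) := by
  intro x y h
  unfold pw
  exact Real.rpow_le_rpow (le_max_right _ _) (max_le_max_right _ h) hp.le

lemma dd_of_nonpos (p h r : ℝ) (hp : 0 < p) (hh : 0 < h) (hr : r ≤ 0) : dd p h r = 0 := by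
  unfold dd
  rw [pw_of_nonpos p _ hp hr, pw_of_nonpos p _ hp (by linarith), pw_of_nonpos p _ hp (by linarith)]
  ring

lemma dd_bound (p h r : ℝ) (hp : 0 < p) (hp2 : p < 2) (hh : 0 < h) (hr : 0 < r) :
    |dd p h r| ≤ 64 * h ^ 2 * r ^ (p - 2) := by
  rcases lt_or_ge r (4 * h) with h4 | h4
  · have e1 : r ^ p = r ^ 2 * r ^ (p - 2) := by
      rw [← Real.rpow_natCast r 2, ← Real.rpow_add hr]; congr 1; push_cast; ring
    have h0 := pw_of_pos p r hr.le
    have h1 := pw_mono p hp (show r - h ≤ r by linarith)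
    have h2 := pw_mono p hp (show r - 2 * h ≤ r by linarith)
    have h3 := pw_nonneg p (r - h)
    have h5 := pw_nonneg p (r - 2 * h)
    have h6 := pw_nonneg p r
    have : |dd p h r| ≤ 2 * r ^ p := by
      unfold dd
      rw [abs_le]; constructor <;> linarith
    have hpos : 0 < r ^ (p - 2) := Real.rpow_pos_of_pos hr _
    have hr2 : r ^ 2 ≤ 16 * h ^ 2 := by nlinarith
    have := mul_le_mul_of_nonneg_right hr2 hpos.le
    nlinarith [mul_nonneg (sq_nonneg h) hpos.le]
  · have key : ∀ x y q : ℝ, 0 < x → x < y → ∃ c ∈ Ioo x y, y ^ q - x ^ q = (q * c ^ (q - 1)) * (y - x) := by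
      intro x y q hx hxy
      obtain ⟨c, hc, hc'⟩ := exists_hasDerivAt_eq_slope (fun z => z ^ q) (fun z => q * z ^ (q - 1)) hxy
        (ContinuousOn.rpow_const continuousOn_id (fun z hz => Or.inl (lt_of_lt_of_le hx hz.1).ne'))
        (fun z hz => Real.hasDerivAt_rpow_const (Or.inl (hx.trans hz.1).ne'))
      refine ⟨c, hc, ?_⟩
      rw [hc']
      field_simp [(sub_pos.2 hxy).ne']
    obtain ⟨c1, hc1, e1⟩ := key (r - h) r p (by linarith) (by linarith)
    obtain ⟨c2, hc2, e2⟩ := key (r - 2 * h) (r - h) p (by linarith) (by linarith)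
    obtain ⟨c3, hc3, e3⟩ := key c2 c1 (p - 1) (by linarith [hc2.1]) (by linarith [hc2.2, hc1.1])
    have hc3' : r / 2 ≤ c3 := by linarith [hc3.1, hc2.1]
    have hX : c3 ^ (p - 1 - 1) ≤ 4 * r ^ (p - 2) := by
      have : c3 ^ (p - 1 - 1) ≤ (r / 2) ^ (p - 2) := by
        rw [show p - 1 - 1 = p - 2 by ring]
        exact Real.rpow_le_rpow_of_nonpos (by linarith) hc3' (by linarith)
      refine this.trans ?_
      rw [Real.div_rpow hr.le (by norm_num), div_eq_mul_inv, ← Real.rpow_neg (by norm_num), mul_comm]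
      refine mul_le_mul_of_nonneg_right ?_ (Real.rpow_nonneg hr.le _)
      calc (2:ℝ) ^ (-(p - 2)) ≤ 2 ^ (2:ℝ) := Real.rpow_le_rpow_of_exponent_le (by norm_num) (by linarith)
        _ = 4 := by norm_num
    have hX0 : 0 ≤ c3 ^ (p - 1 - 1) := Real.rpow_nonneg (by linarith) _
    have e : dd p h r = p * h * ((p - 1) * c3 ^ (p - 1 - 1) * (c1 - c2)) := by
      rw [← e3]
      unfold dd
      rw [pw_of_pos _ _ hr.le, pw_of_pos _ _ (by linarith), pw_of_pos _ _ (by linarith)]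
      linear_combination e1 - e2
    rw [e, abs_mul, abs_mul, abs_mul, abs_mul, abs_of_pos hp, abs_of_pos hh, abs_of_nonneg hX0,
      abs_of_nonneg (show 0 ≤ c1 - c2 by linarith [hc2.2, hc1.1])]
    have a1 : |p - 1| ≤ 1 := by rw [abs_le]; constructor <;> linarith
    have a2 : c1 - c2 ≤ 2 * h := by linarith [hc2.1, hc1.2]
    have hq : 0 ≤ r ^ (p - 2) := Real.rpow_nonneg hr.le _
    calc p * h * (|p - 1| * c3 ^ (p - 1 - 1) * (c1 - c2))
        ≤ 2 * h * (1 * (4 * r ^ (p - 2)) * (2 * h)) := by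
          have : 0 ≤ c1 - c2 := by linarith [hc2.2, hc1.1]
          gcongr
      _ ≤ _ := by nlinarith [mul_nonneg (sq_nonneg h) hq]

lemma int_pw (a b p y : ℝ) (hab : a < b) (hp : 0 < p) (hy : y ≤ b) :
    ∫ t in Ioo a b, pw p (y - t) = pw (p + 1) (y - a) / (p + 1) := by
  have hc := pw_cont p hp
  rw [← integral_Ioc_eq_integral_Ioo, ← intervalIntegral.integral_of_le hab.le,
    intervalIntegral.integral_comp_sub_left (fun t => pw p t) y]
  have z0 : ∀ c ≤ 0, ∀ d ≤ 0, ∫ t in c..d, pw p t = 0 := by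
    intro c hc d hd
    apply intervalIntegral.integral_zero_ae
    filter_upwards with t ht
    refine pw_of_nonpos p t hp ?_
    have := ht.2
    exact this.trans (max_le hc hd)
  rcases le_total (y - a) 0 with h | h
  · rw [z0 _ (by linarith) _ h, pw_of_nonpos _ _ (by linarith) h]; simp
  · rw [← intervalIntegral.integral_add_adjacent_intervals (b := 0) (hc.intervalIntegrable _ _)
      (hc.intervalIntegrable _ _), z0 _ (by linarith) _ le_rfl, zero_add]
    have : ∫ t in (0:ℝ)..(y - a), pw p t = ∫ t in (0:ℝ)..(y - a), t ^ p := by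
      apply intervalIntegral.integral_congr
      intro t ht
      rw [uIcc_of_le h] at ht
      exact pw_of_pos p t ht.1
    rw [this, integral_rpow (Or.inl (by linarith)), pw_of_pos _ _ h, Real.zero_rpow (by linarith)]
    simp

lemma bdd_int (a b : ℝ) (g : ℝ → ℝ) (hg : Continuous g) (f : ℝ → ℝ) (hf : IntegrableOn f (Ioo a b)) :
    IntegrableOn (fun t => f t * g t) (Ioo a b) := by
  obtain ⟨M, hM⟩ := (isCompact_Icc (a := a) (b := b)).exists_bound_of_continuousOn hg.continuousOn
  refine Integrable.mul_bdd (c := M) hf hg.aestronglyMeasurable ?_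
  filter_upwards [ae_restrict_mem measurableSet_Ioo] with t ht
  exact hM t ⟨ht.1.le, ht.2.le⟩

lemma int_mul_dd (a b p h x : ℝ) (hp : 0 < p) (f : ℝ → ℝ)
    (hf : IntegrableOn f (Ioo a b)) :
    ∫ t in Ioo a b, f t * dd p h (x - t) = (∫ t in Ioo a b, f t * pw p (x - t))
      - 2 * (∫ t in Ioo a b, f t * pw p (x - h - t)) + ∫ t in Ioo a b, f t * pw p (x - 2 * h - t) := by
  have hc := pw_cont p hp
  have i1 := bdd_int a b (fun t => pw p (x - t)) (by fun_prop) f hf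
  have i2 := bdd_int a b (fun t => pw p (x - h - t)) (by fun_prop) f hf
  have i3 := bdd_int a b (fun t => pw p (x - 2 * h - t)) (by fun_prop) f hf
  rw [← integral_const_mul, ← integral_sub i1 (i2.const_mul 2), ← integral_add (f := fun a => f a * pw p (x - a) - 2 * (f a * pw p (x - h - a))) (i1.sub (i2.const_mul 2)) i3]
  congr 1; ext t
  unfold dd
  simp only [show x - t - h = x - h - t by ring, show x - t - 2 * h = x - 2 * h - t by ring]
  ring

lemma int_dd (a b p h x : ℝ) (hab : a < b) (hp : 0 < p) (hh : 0 < h) (hx : x ≤ b) :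
    ∫ t in Ioo a b, dd p h (x - t) = dd (p + 1) h (x - a) / (p + 1) := by
  have := int_mul_dd a b p h x hp (fun _ => 1) (by simp)
  simp only [one_mul] at this
  rw [this, int_pw _ _ _ _ hab hp hx, int_pw _ _ _ _ hab hp (by linarith),
    int_pw _ _ _ _ hab hp (by linarith)]
  unfold dd
  simp only [show x - a - h = x - h - a by ring, show x - a - 2 * h = x - 2 * h - a by ring]
  ring

lemma beta_scale (s τ y : ℝ) (hy : τ < y) :
    ∫ t in τ..y, (y - t) ^ (1 - s) * (t - τ) ^ (s - 1)
      = (y - τ) * ∫ v in (0:ℝ)..1, (1 - v) ^ (1 - s) * v ^ (s - 1) := by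
  have h := intervalIntegral.mul_integral_comp_add_mul (a := 0) (b := 1)
    (f := fun t => (y - t) ^ (1 - s) * (t - τ) ^ (s - 1)) (y - τ) τ
  simp only [mul_zero, add_zero, mul_one, add_sub_cancel] at h
  rw [← h]
  congr 1
  apply intervalIntegral.integral_congr
  intro v hv
  rw [uIcc_of_le zero_le_one] at hv
  have hd : 0 < y - τ := sub_pos.2 hy
  simp only
  rw [show y - (τ + (y - τ) * v) = (y - τ) * (1 - v) by ring,
    show (τ + (y - τ) * v - τ) = (y - τ) * v by ring,
    Real.mul_rpow hd.le (by linarith [hv.2]), Real.mul_rpow hd.le hv.1]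
  have : (y - τ) ^ (1 - s) * (y - τ) ^ (s - 1) = 1 := by
    rw [← Real.rpow_add hd]; simp
  linear_combination ((1 - v) ^ (1 - s) * v ^ (s - 1)) * this

lemma beta_pos (s : ℝ) (hs : 0 < s) (hs1 : s < 1) :
    0 < ∫ v in (0:ℝ)..1, (1 - v) ^ (1 - s) * v ^ (s - 1) := by
  apply intervalIntegral.intervalIntegral_pos_of_pos_on
  · refine IntervalIntegrable.continuousOn_mul (intervalIntegral.intervalIntegrable_rpow' (by linarith)) ?_
    exact ContinuousOn.rpow_const (by fun_prop) (fun z hz => Or.inr (by linarith))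
  · intro v hv
    exact mul_pos (Real.rpow_pos_of_pos (by linarith [hv.2]) _) (Real.rpow_pos_of_pos hv.1 _)
  · norm_num

lemma W_identity (a b s : ℝ) (hab : a < b) (hs : 0 < s) (hs1 : s < 1) (u φ : ℝ → ℝ)
    (hφ : IntegrableOn φ (Ioo a b))
    (hrep : ∀ᵐ x ∂(volume.restrict (Ioo a b)), u x = RLint a s φ x) (y : ℝ) (hy : y ≤ b) :
    ∫ t in Ioo a b, φ t * pw 1 (y - t) =
      (Real.Gamma s / ∫ v in (0:ℝ)..1, (1 - v) ^ (1 - s) * v ^ (s - 1)) *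
      ∫ t in Ioo a b, u t * pw (1 - s) (y - t) := by
  have hB := beta_pos s hs hs1
  have hS := beta_scale s
  set B := ∫ v in (0:ℝ)..1, (1 - v) ^ (1 - s) * v ^ (s - 1) with hBdef
  have hΓ := Real.Gamma_pos_of_pos hs
  set φ0 := (Ioo a b).indicator φ with hφ0
  set g : ℝ → ℝ := (Ioo 0 (b - a)).indicator (fun r => r ^ (s - 1)) with hg
  set k : ℝ → ℝ := (Ioo a b).indicator (fun t => pw (1 - s) (y - t)) with hk
  have hpc := pw_cont (1 - s) (by linarith)
  have iφ0 : Integrable φ0 := (integrable_indicator_iff measurableSet_Ioo).2 hφ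
  have ig : Integrable g := by
    refine (integrable_indicator_iff measurableSet_Ioo).2 ?_
    have := intervalIntegral.intervalIntegrable_rpow' (a := 0) (b := b - a) (r := s - 1) (by linarith)
    rw [intervalIntegrable_iff_integrableOn_Ioo_of_le (by linarith)] at this
    exact this
  have mk : Measurable k := by
    refine Measurable.indicator ?_ measurableSet_Ioo
    exact (hpc.comp (by fun_prop : Continuous fun t => y - t)).measurable
  have bk : ∀ t, ‖k t‖ ≤ pw (1 - s) (b - a) := by
    intro t
    by_cases ht : t ∈ Ioo a b
    · rw [hk, indicator_of_mem ht, Real.norm_of_nonneg (pw_nonneg _ _)]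
      exact pw_mono _ (by linarith) (by linarith [ht.1])
    · rw [hk, indicator_of_notMem ht, norm_zero]; exact pw_nonneg _ _
  have i1 : Integrable (fun p : ℝ × ℝ => φ0 p.2 * g (p.1 - p.2)) (volume.prod volume) :=
    Integrable.convolution_integrand (ContinuousLinearMap.mul ℝ ℝ) iφ0 ig
  have i2 : Integrable (fun p : ℝ × ℝ => k p.1 * (φ0 p.2 * g (p.1 - p.2))) (volume.prod volume) :=
    i1.bdd_mul (mk.comp measurable_fst).aestronglyMeasurable (ae_of_all _ (fun p => bk p.1))
  have sw := integral_integral_swap (f := fun t τ => k t * (φ0 τ * g (t - τ))) i2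
  have inner1 : ∀ t ∈ Ioo a b, ∫ τ, φ0 τ * g (t - τ) = Real.Gamma s * RLint a s φ t := by
    intro t ht
    unfold RLint
    rw [← mul_assoc, mul_inv_cancel₀ hΓ.ne', one_mul, intervalIntegral.integral_of_le ht.1.le,
      integral_Ioc_eq_integral_Ioo, ← integral_indicator measurableSet_Ioo]
    congr 1; ext τ
    by_cases h1 : τ ∈ Ioo a t
    · rw [indicator_of_mem h1, hφ0, hg, indicator_of_mem (show τ ∈ Ioo a b from ⟨h1.1, h1.2.trans ht.2⟩),
        indicator_of_mem (show t - τ ∈ Ioo 0 (b - a) from ⟨by linarith [h1.2], by linarith [h1.1, ht.2]⟩)]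
    · rw [indicator_of_notMem h1]
      by_cases h2 : τ ∈ Ioo a b
      · have : t - τ ∉ Ioo 0 (b - a) := fun h => h1 ⟨h2.1, by linarith [h.1]⟩
        rw [hg, indicator_of_notMem this, mul_zero]
      · rw [hφ0, indicator_of_notMem h2, zero_mul]
  have inner2 : ∀ τ ∈ Ioo a b, ∫ t, k t * g (t - τ) = B * pw 1 (y - τ) := by
    intro τ hτ
    rcases le_or_gt y τ with h | h
    · rw [pw_of_nonpos 1 _ one_pos (by linarith), mul_zero]
      refine integral_eq_zero_of_ae (ae_of_all _ fun t => ?_)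
      simp only [Pi.zero_apply]
      rcases le_or_gt t τ with h1 | h1
      · rw [hg, indicator_of_notMem (fun h => by linarith [h.1]), mul_zero]
      · have : k t = 0 := by
          rw [hk]; apply indicator_apply_eq_zero.2
          intro _; exact pw_of_nonpos _ _ (by linarith) (by linarith)
        rw [this, zero_mul]
    · rw [pw_of_pos _ _ (by linarith), Real.rpow_one, mul_comm, ← hS τ y h,
        intervalIntegral.integral_of_le h.le,
        integral_Ioc_eq_integral_Ioo, ← integral_indicator measurableSet_Ioo]
      congr 1; ext t
      by_cases h1 : t ∈ Ioo τ y
      · rw [indicator_of_mem h1, hk, hg, indicator_of_mem (show t ∈ Ioo a b from ⟨hτ.1.trans h1.1, h1.2.trans_le hy⟩),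
          indicator_of_mem (show t - τ ∈ Ioo 0 (b - a) from ⟨by linarith [h1.1], by linarith [h1.2, hτ.1]⟩),
          pw_of_pos _ _ (by linarith [h1.2])]
      · rw [indicator_of_notMem h1]
        rcases le_or_gt t τ with h2 | h2
        · rw [hg, indicator_of_notMem (fun h => by linarith [h.1]), mul_zero]
        · have : k t = 0 := by
            rw [hk]; apply indicator_apply_eq_zero.2
            intro _
            refine pw_of_nonpos _ _ (by linarith) ?_
            by_contra hc
            exact h1 ⟨h2, by linarith⟩
          rw [this, zero_mul]
  have L : ∫ t, ∫ τ, k t * (φ0 τ * g (t - τ)) = Real.Gamma s * ∫ t in Ioo a b, u t * pw (1 - s) (y - t) := by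
    rw [← integral_const_mul, ← integral_indicator measurableSet_Ioo]
    apply integral_congr_ae
    rw [ae_restrict_iff' measurableSet_Ioo] at hrep
    filter_upwards [hrep] with t ht
    rw [integral_const_mul]
    by_cases h1 : t ∈ Ioo a b
    · rw [inner1 t h1, indicator_of_mem h1, hk, indicator_of_mem h1, ht h1]; ring
    · rw [indicator_of_notMem h1, hk, indicator_of_notMem h1, zero_mul]
  have R : ∫ τ, ∫ t, k t * (φ0 τ * g (t - τ)) = B * ∫ t in Ioo a b, φ t * pw 1 (y - t) := by
    rw [← integral_const_mul, ← integral_indicator measurableSet_Ioo]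
    apply integral_congr_ae
    refine ae_of_all _ fun τ => ?_
    simp only
    have : ∀ t, k t * (φ0 τ * g (t - τ)) = φ0 τ * (k t * g (t - τ)) := fun t => by ring
    simp_rw [this]
    rw [integral_const_mul]
    by_cases h1 : τ ∈ Ioo a b
    · rw [inner2 τ h1, indicator_of_mem h1, hφ0, indicator_of_mem h1]; ring
    · rw [indicator_of_notMem h1, hφ0, indicator_of_notMem h1, zero_mul]
  rw [L, R] at sw
  field_simp
  linarith

lemma hat_limit (a b : ℝ) (hab : a < b) (φ : ℝ → ℝ) (hφ : IntegrableOn φ (Ioo a b)) :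
    ∀ᵐ x ∂(volume.restrict (Ioo a b)),
      Tendsto (fun h => (∫ t in Ioo a b, φ t * dd 1 h (x - t)) / h ^ 2) (nhdsWithin 0 (Ioi 0)) (nhds (φ x)) := by
  set φ0 := (Ioo a b).indicator φ with hφ0
  have iφ0 : Integrable φ0 := (integrable_indicator_iff measurableSet_Ioo).2 hφ
  rw [ae_restrict_iff' measurableSet_Ioo]
  filter_upwards [IsUnifLocDoublingMeasure.ae_tendsto_average_norm_sub volume iφ0.locallyIntegrable 1] with x hx hxab
  have hδ : Tendsto (fun h : ℝ => 2 * h) (nhdsWithin 0 (Ioi 0)) (nhdsWithin 0 (Ioi 0)) := by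
    rw [tendsto_nhdsWithin_iff]
    constructor
    · have : Tendsto (fun h : ℝ => 2 * h) (nhds 0) (nhds (2 * 0)) := by
        exact (continuous_const.mul continuous_id).tendsto 0
      rw [mul_zero] at this
      exact this.mono_left nhdsWithin_le_nhds
    · filter_upwards [self_mem_nhdsWithin] with h hh
      have : 0 < h := hh
      simpa using this
  have H := hx (fun _ => x) (fun h : ℝ => 2 * h) hδ (by
    filter_upwards [self_mem_nhdsWithin] with h hh
    have : 0 < h := hh
    exact Metric.mem_closedBall_self (by linarith))
  have H4 := H.const_mul 4
  rw [mul_zero] at H4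
  rw [tendsto_iff_norm_sub_tendsto_zero]
  refine squeeze_zero' (Eventually.of_forall fun _ => norm_nonneg _) ?_ H4
  have hev : ∀ᶠ h in nhdsWithin (0:ℝ) (Ioi 0), h < (x - a) / 2 := by
    apply mem_nhdsWithin_of_mem_nhds
    exact Iio_mem_nhds (by linarith [hxab.1])
  filter_upwards [self_mem_nhdsWithin, hev] with h hh hlt
  have hh : 0 < h := hh
  have hddc := dd_cont 1 h one_pos
  have hφx : φ0 x = φ x := indicator_of_mem hxab _
  have i1 := bdd_int a b (fun t => dd 1 h (x - t)) (by fun_prop) φ hφ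
  have i2 := bdd_int a b (fun t => dd 1 h (x - t)) (by fun_prop) (fun _ => φ x) (by simp)
  have hone : ∫ t in Ioo a b, dd 1 h (x - t) = h ^ 2 := by
    rw [int_dd a b 1 h x hab one_pos hh hxab.2.le]
    unfold dd
    rw [pw_of_pos _ _ (by linarith), pw_of_pos _ _ (by linarith), pw_of_pos _ _ (by linarith)]
    norm_num
    ring
  have e : (∫ t in Ioo a b, φ t * dd 1 h (x - t)) / h ^ 2 - φ x
      = (∫ t in Ioo a b, (φ t - φ x) * dd 1 h (x - t)) / h ^ 2 := by
    simp_rw [sub_mul]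
    rw [integral_sub i1 i2, integral_const_mul, hone]
    field_simp
  rw [e, norm_div, Real.norm_of_nonneg (sq_nonneg h)]
  have ddb : ∀ r, |dd 1 h r| ≤ (Icc 0 (2 * h)).indicator (fun _ => h) r := by
    intro r
    unfold dd pw
    simp only [Real.rpow_one]
    by_cases hr : r ∈ Icc 0 (2 * h)
    · rw [indicator_of_mem hr, max_eq_left hr.1, max_eq_right (by linarith [hr.2] : r - 2 * h ≤ 0)]
      rcases le_total (r - h) 0 with h1 | h1
      · rw [max_eq_right h1, abs_le]; constructor <;> linarith [hr.1, hr.2]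
      · rw [max_eq_left h1, abs_le]; constructor <;> linarith [hr.1, hr.2]
    · rw [indicator_of_notMem hr]
      rcases lt_or_ge r 0 with h1 | h1
      · rw [max_eq_right h1.le, max_eq_right (by linarith), max_eq_right (by linarith)]; simp
      · have : 2 * h < r := by
          by_contra hc
          exact hr ⟨h1, by linarith⟩
        rw [max_eq_left h1, max_eq_left (by linarith), max_eq_left (by linarith)]
        apply le_of_eq; rw [abs_eq_zero]; ring
  have main : ‖∫ t in Ioo a b, (φ t - φ x) * dd 1 h (x - t)‖ ≤
      h * ∫ t in Metric.closedBall x (2 * h), ‖φ0 t - φ0 x‖ := by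
    have iL : IntegrableOn (fun t => ‖φ0 t - φ0 x‖) (Metric.closedBall x (2 * h)) := by
      refine Integrable.norm (Integrable.sub iφ0.integrableOn ?_)
      exact integrableOn_const (by exact measure_closedBall_lt_top.ne)
    rw [← integral_const_mul, ← integral_indicator measurableSet_Ioo,
      ← integral_indicator measurableSet_closedBall]
    apply norm_integral_le_of_norm_le
    · exact (integrable_indicator_iff measurableSet_closedBall).2 (iL.const_mul h)
    · refine ae_of_all _ fun t => ?_
      by_cases ht : t ∈ Ioo a b
      · rw [indicator_of_mem ht, norm_mul]
        have hb := ddb (x - t)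
        by_cases hc : x - t ∈ Icc 0 (2 * h)
        · rw [indicator_of_mem hc] at hb
          rw [indicator_of_mem (show t ∈ Metric.closedBall x (2 * h) by
            rw [Metric.mem_closedBall, Real.dist_eq, abs_le]; constructor <;> linarith [hc.1, hc.2])]
          have : φ0 t = φ t := indicator_of_mem ht _
          rw [this, hφx, mul_comm h]
          exact mul_le_mul_of_nonneg_left hb (norm_nonneg _)
        · rw [indicator_of_notMem hc] at hb
          have : ‖dd 1 h (x - t)‖ = 0 := le_antisymm hb (norm_nonneg _)
          rw [this, mul_zero]
          exact indicator_nonneg (fun _ _ => mul_nonneg hh.le (norm_nonneg _)) _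
      · rw [indicator_of_notMem ht, norm_zero]
        exact indicator_nonneg (fun _ _ => mul_nonneg hh.le (norm_nonneg _)) _
  rw [setAverage_eq, Measure.real, Real.volume_closedBall, ENNReal.toReal_ofReal (by linarith), smul_eq_mul]
  rw [div_le_iff₀ (by positivity)]
  refine main.trans (le_of_eq ?_)
  field_simp
  ring

lemma kappa_int (a s y : ℝ) (hs : 0 < s) (hy : a < y) :
    ∫⁻ x in Ioo ((a + y) / 2) y, ENNReal.ofReal ((x - a) ^ (-1 - s))
      = ENNReal.ofReal ((2 ^ s - 1) / s * (y - a) ^ (-s)) := by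
  have hlt : (a + y) / 2 < y := by linarith
  have hc : ContinuousOn (fun x : ℝ => (x - a) ^ (-1 - s)) (Icc ((a + y) / 2) y) := by
    refine ContinuousOn.rpow_const (by fun_prop) (fun z hz => Or.inl ?_)
    have : 0 < z - a := by linarith [hz.1]
    exact this.ne'
  have hi : IntegrableOn (fun x : ℝ => (x - a) ^ (-1 - s)) (Ioo ((a + y) / 2) y) :=
    (hc.integrableOn_compact isCompact_Icc).mono_set Ioo_subset_Icc_self
  rw [← ofReal_integral_eq_lintegral_ofReal hi]
  · congr 1
    rw [← integral_Ioc_eq_integral_Ioo, ← intervalIntegral.integral_of_le hlt.le,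
      intervalIntegral.integral_comp_sub_right (fun x => x ^ (-1 - s)) a, integral_rpow]
    · have hp : 0 < y - a := by linarith
      rw [show -1 - s + 1 = -s by ring, show (a + y) / 2 - a = (y - a) / 2 by ring,
        Real.div_rpow hp.le (by norm_num), Real.rpow_neg (by norm_num : (0:ℝ) ≤ 2)]
      field_simp
      ring
    · right
      refine ⟨by linarith, ?_⟩
      rw [uIcc_of_le (by linarith)]
      intro h
      linarith [h.1]
  · filter_upwards [ae_restrict_mem measurableSet_Ioo] with x hx
    exact Real.rpow_nonneg (by linarith [hx.1]) _

lemma rpow_compare (L s s' r : ℝ) (hss : s < s') (hr : 0 < r) (hrL : r ≤ L) :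
    r ^ (-1 - s) ≤ L ^ (s' - s) * (r ^ (1 + s'))⁻¹ := by
  rw [← Real.rpow_neg hr.le, show -1 - s = (s' - s) + -(1 + s') by ring, Real.rpow_add hr]
  exact mul_le_mul_of_nonneg_right (Real.rpow_le_rpow hr.le hrL (by linarith)) (Real.rpow_nonneg hr.le _)

lemma hardy_eps (a b s s' : ℝ) (hab : a < b) (hs : 0 < s) (hss' : s < s') (hs1 : s < 1)
    (u : ℝ → ℝ) (hu : IntegrableOn u (Ioo a b))
    (hG : IntegrableOn (fun q : ℝ × ℝ => |u q.1 - u q.2| / |q.1 - q.2| ^ (1 + s'))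
        (Ioo a b ×ˢ Ioo a b)) (ε : ℝ) (hε : 0 < ε) :
    ∫⁻ x in Ioo (a + ε) ((a + b) / 2), ENNReal.ofReal (|u x| * (x - a) ^ (-s)) ≤
      ENNReal.ofReal (((b - a) ^ (s' - s) * (∫ q in Ioo a b ×ˢ Ioo a b,
        |u q.1 - u q.2| / |q.1 - q.2| ^ (1 + s')) + (2 ^ s - 1) / s * (((b - a) / 2) ^ (-s) *
          ∫ x in Ioo a b, |u x|)) / (1 - (2 ^ s - 1) / s)) := by
  set κ : ℝ := (2 ^ s - 1) / s with hκ
  have hκ1 : κ < 1 := by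
    have := rpow_one_add_lt_one_add_mul_self (s := 1) (by norm_num) one_ne_zero hs hs1
    norm_num at this
    rw [hκ, div_lt_one hs]
    linarith
  have hκ0 : 0 ≤ κ := by
    have : (1:ℝ) ≤ 2 ^ s := Real.one_le_rpow (by norm_num) hs.le
    exact div_nonneg (by linarith) hs.le
  set μ := (volume : Measure ℝ).restrict (Ioo a b) with hμ
  set m := (a + b) / 2 with hm
  have hGp : Integrable (fun q : ℝ × ℝ => |u q.1 - u q.2| / |q.1 - q.2| ^ (1 + s')) (μ.prod μ) := by
    rw [hμ, Measure.prod_restrict]; exact hG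
  have hGe : ∫ q in Ioo a b ×ˢ Ioo a b, |u q.1 - u q.2| / |q.1 - q.2| ^ (1 + s')
      = ∫ q, |u q.1 - u q.2| / |q.1 - q.2| ^ (1 + s') ∂(μ.prod μ) := by
    rw [hμ, Measure.prod_restrict]; rfl
  rw [hGe]
  have mu : AEMeasurable u μ := hu.aestronglyMeasurable.aemeasurable
  set S := Ioo (a + ε) m with hS
  have hSsub : S ⊆ Ioo a b := fun x hx => ⟨by linarith [hx.1], by
    have := hx.2; rw [hm] at this; linarith⟩
  set A := ∫⁻ x in S, ENNReal.ofReal (|u x| * (x - a) ^ (-s)) with hA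
  set E : Set (ℝ × ℝ) := {z | z.1 ∈ S ∧ z.1 < z.2 ∧ z.2 < 2 * z.1 - a} with hE
  have mE : MeasurableSet E := by
    refine (measurable_fst measurableSet_Ioo).inter ((measurableSet_lt measurable_fst measurable_snd).inter
      (measurableSet_lt measurable_snd (by fun_prop)))
  have mw : Measurable fun x : ℝ => (x - a) ^ (-1 - s) := by fun_prop
  have mAE1 : AEMeasurable (fun z : ℝ × ℝ => E.indicator
      (fun z => ENNReal.ofReal (|u z.1| * (z.1 - a) ^ (-1 - s))) z) (μ.prod μ) := by
    refine AEMeasurable.indicator ?_ mE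
    have h1 : AEMeasurable (fun z : ℝ × ℝ => u z.1) (μ.prod μ) := mu.comp_fst
    exact ((measurable_abs.comp_aemeasurable h1).mul (mw.comp measurable_fst).aemeasurable).ennreal_ofReal
  have mAE2 : AEMeasurable (fun z : ℝ × ℝ => E.indicator
      (fun z => ENNReal.ofReal (|u z.2| * (z.1 - a) ^ (-1 - s))) z) (μ.prod μ) := by
    refine AEMeasurable.indicator ?_ mE
    have h1 : AEMeasurable (fun z : ℝ × ℝ => u z.2) (μ.prod μ) := mu.comp_snd
    exact ((measurable_abs.comp_aemeasurable h1).mul (mw.comp measurable_fst).aemeasurable).ennreal_ofReal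
  have eA : A = ∫⁻ z, E.indicator
      (fun z => ENNReal.ofReal (|u z.1| * (z.1 - a) ^ (-1 - s))) z ∂(μ.prod μ) := by
    rw [lintegral_prod _ mAE1, hA, ← lintegral_indicator measurableSet_Ioo,
      hμ, ← lintegral_indicator measurableSet_Ioo]
    congr 1; ext x
    by_cases hx : x ∈ S
    · rw [indicator_of_mem hx, indicator_of_mem (hSsub hx)]
      have e1 : ∀ y, E.indicator (fun z => ENNReal.ofReal (|u z.1| * (z.1 - a) ^ (-1 - s))) (x, y)
          = (Ioo x (2 * x - a)).indicator (fun _ => ENNReal.ofReal (|u x| * (x - a) ^ (-1 - s))) y := by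
        intro y
        by_cases hy : y ∈ Ioo x (2 * x - a)
        · rw [indicator_of_mem hy, indicator_of_mem (show (x, y) ∈ E from ⟨hx, hy.1, hy.2⟩)]
        · rw [indicator_of_notMem hy, indicator_of_notMem (fun h => hy ⟨h.2.1, h.2.2⟩)]
      simp_rw [e1]
      have hxa : 0 < x - a := by linarith [hx.1]
      have hsub : Ioo x (2 * x - a) ∩ Ioo a b = Ioo x (2 * x - a) := by
        apply inter_eq_left.2
        intro y hy
        have h2 := hx.2
        rw [hm] at h2
        exact ⟨by linarith [hy.1], by linarith [hy.2]⟩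
      rw [lintegral_indicator measurableSet_Ioo, Measure.restrict_restrict measurableSet_Ioo, hsub,
        setLIntegral_const, Real.volume_Ioo,
        ← ENNReal.ofReal_mul (mul_nonneg (abs_nonneg _) (Real.rpow_nonneg hxa.le _))]
      congr 1
      have : (x - a) ^ (-s) = (x - a) ^ (-1 - s) * (x - a) := by
        rw [← Real.rpow_add_one hxa.ne']; congr 1; ring
      rw [this]; ring
    · rw [indicator_of_notMem hx]
      symm
      apply indicator_apply_eq_zero.2
      intro _
      have e1 : ∀ y, E.indicator (fun z => ENNReal.ofReal (|u z.1| * (z.1 - a) ^ (-1 - s))) (x, y) = 0 :=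
        fun y => indicator_of_notMem (fun h => hx h.1) _
      simp_rw [e1]; simp
  have le1 : A ≤ (∫⁻ z, ENNReal.ofReal ((b - a) ^ (s' - s) * (|u z.1 - u z.2| / |z.1 - z.2| ^ (1 + s'))) ∂(μ.prod μ))
      + ∫⁻ z, E.indicator (fun z => ENNReal.ofReal (|u z.2| * (z.1 - a) ^ (-1 - s))) z ∂(μ.prod μ) := by
    rw [← lintegral_add_right' _ mAE2, eA]
    refine lintegral_mono fun z => ?_
    by_cases hz : z ∈ E
    · rw [indicator_of_mem hz, indicator_of_mem hz]
      obtain ⟨h1, h2, h3⟩ := hz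
      have hxa : 0 < z.1 - a := by linarith [h1.1]
      have hd : |z.1 - z.2| = z.2 - z.1 := by rw [abs_sub_comm, abs_of_pos (by linarith)]
      have h4 := h1.2
      rw [hm] at h4
      rw [← ENNReal.ofReal_add (by positivity) (mul_nonneg (abs_nonneg _) (Real.rpow_nonneg hxa.le _))]
      apply ENNReal.ofReal_le_ofReal
      have t1 : |u z.1| ≤ |u z.1 - u z.2| + |u z.2| := by
        have := abs_add_le (u z.1 - u z.2) (u z.2); simpa using this
      have hw : 0 ≤ (z.1 - a) ^ (-1 - s) := Real.rpow_nonneg hxa.le _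
      have t2 : (z.1 - a) ^ (-1 - s) ≤ (b - a) ^ (s' - s) * (|z.1 - z.2| ^ (1 + s'))⁻¹ := by
        rw [hd]
        refine le_trans ?_ (rpow_compare (b - a) s s' (z.2 - z.1) hss' (by linarith) (by linarith))
        exact Real.rpow_le_rpow_of_nonpos (by linarith) (by linarith) (by linarith)
      calc |u z.1| * (z.1 - a) ^ (-1 - s) ≤ (|u z.1 - u z.2| + |u z.2|) * (z.1 - a) ^ (-1 - s) :=
            mul_le_mul_of_nonneg_right t1 hw
        _ = |u z.1 - u z.2| * (z.1 - a) ^ (-1 - s) + |u z.2| * (z.1 - a) ^ (-1 - s) := by ring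
        _ ≤ |u z.1 - u z.2| * ((b - a) ^ (s' - s) * (|z.1 - z.2| ^ (1 + s'))⁻¹)
            + |u z.2| * (z.1 - a) ^ (-1 - s) := by gcongr
        _ = _ := by rw [div_eq_mul_inv]; ring
    · rw [indicator_of_notMem hz]; exact zero_le
  set Nn := ((b - a) / 2) ^ (-s) * ∫ x, |u x| ∂μ with hNn
  have iu : Integrable (fun x => |u x|) μ := hu.abs
  have hNn0 : 0 ≤ Nn := mul_nonneg (Real.rpow_nonneg (by linarith) _) (integral_nonneg fun _ => abs_nonneg _)
  have le2 : ∫⁻ z, E.indicator (fun z => ENNReal.ofReal (|u z.2| * (z.1 - a) ^ (-1 - s))) z ∂(μ.prod μ)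
      ≤ ENNReal.ofReal κ * (A + ENNReal.ofReal Nn) := by
    rw [lintegral_prod_symm _ mAE2]
    have step : ∀ y ∈ Ioo a b, ∫⁻ x, E.indicator (fun z => ENNReal.ofReal (|u z.2| * (z.1 - a) ^ (-1 - s))) (x, y) ∂μ
        ≤ ENNReal.ofReal κ * (S.indicator (fun y => ENNReal.ofReal (|u y| * (y - a) ^ (-s))) y
          + ENNReal.ofReal (((b - a) / 2) ^ (-s) * |u y|)) := by
      intro y hy
      by_cases hya : a + ε < y
      · have p1 : ∀ x, E.indicator (fun z => ENNReal.ofReal (|u z.2| * (z.1 - a) ^ (-1 - s))) (x, y)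
            ≤ (Ioo ((a + y) / 2) y).indicator (fun x => ENNReal.ofReal |u y| * ENNReal.ofReal ((x - a) ^ (-1 - s))) x := by
          intro x
          by_cases hx : (x, y) ∈ E
          · obtain ⟨h1, h2, h3⟩ := id hx
            simp only at h1 h2 h3
            rw [indicator_of_mem hx, indicator_of_mem (show x ∈ Ioo ((a + y) / 2) y from ⟨by linarith, h2⟩),
              ENNReal.ofReal_mul (abs_nonneg _)]
          · rw [indicator_of_notMem hx]; exact zero_le
        calc ∫⁻ x, E.indicator (fun z => ENNReal.ofReal (|u z.2| * (z.1 - a) ^ (-1 - s))) (x, y) ∂μ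
            ≤ ∫⁻ x, E.indicator (fun z => ENNReal.ofReal (|u z.2| * (z.1 - a) ^ (-1 - s))) (x, y) :=
              lintegral_mono' Measure.restrict_le_self le_rfl
          _ ≤ ∫⁻ x, (Ioo ((a + y) / 2) y).indicator (fun x => ENNReal.ofReal |u y| * ENNReal.ofReal ((x - a) ^ (-1 - s))) x :=
              lintegral_mono p1
          _ = ENNReal.ofReal |u y| * ENNReal.ofReal (κ * (y - a) ^ (-s)) := by
              rw [lintegral_indicator measurableSet_Ioo, lintegral_const_mul _ (by fun_prop), kappa_int a s y hs hy.1]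
          _ = ENNReal.ofReal κ * ENNReal.ofReal (|u y| * (y - a) ^ (-s)) := by
              rw [← ENNReal.ofReal_mul (abs_nonneg _), ← ENNReal.ofReal_mul hκ0]; congr 1; ring
          _ ≤ _ := by
              gcongr
              by_cases hyS : y ∈ S
              · rw [indicator_of_mem hyS]; exact le_self_add
              · rw [indicator_of_notMem hyS, zero_add]
                apply ENNReal.ofReal_le_ofReal
                rw [mul_comm]
                refine mul_le_mul_of_nonneg_right ?_ (abs_nonneg _)
                have : m ≤ y := by
                  by_contra hc; exact hyS ⟨hya, by linarith⟩
                rw [hm] at this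
                exact Real.rpow_le_rpow_of_nonpos (by linarith) (by linarith) (by linarith)
      · have p1 : ∀ x, E.indicator (fun z => ENNReal.ofReal (|u z.2| * (z.1 - a) ^ (-1 - s))) (x, y) = 0 := by
          intro x
          refine indicator_of_notMem (fun h => hya ?_) _
          exact h.1.1.trans h.2.1
        simp_rw [p1]; simp
    calc _ ≤ ∫⁻ y, ENNReal.ofReal κ * (S.indicator (fun y => ENNReal.ofReal (|u y| * (y - a) ^ (-s))) y
          + ENNReal.ofReal (((b - a) / 2) ^ (-s) * |u y|)) ∂μ := by
          apply lintegral_mono_ae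
          filter_upwards [ae_restrict_mem measurableSet_Ioo] with y hy using step y hy
      _ = _ := by
          rw [lintegral_const_mul' _ _ ENNReal.ofReal_ne_top, lintegral_add_right']
          · congr 2
            · rw [lintegral_indicator measurableSet_Ioo, hμ, Measure.restrict_restrict measurableSet_Ioo,
                inter_eq_left.2 hSsub]
            · rw [hNn, ← integral_const_mul, ofReal_integral_eq_lintegral_ofReal (iu.const_mul _)]
              exact ae_of_all _ fun y => mul_nonneg (Real.rpow_nonneg (by linarith) _) (abs_nonneg _)
          · exact (iu.const_mul _).aestronglyMeasurable.aemeasurable.ennreal_ofReal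
  have fin : A ≠ ⊤ := by
    have : A ≤ ∫⁻ x, ENNReal.ofReal (ε ^ (-s) * |u x|) ∂μ := by
      rw [hA]
      calc _ ≤ ∫⁻ x in S, ENNReal.ofReal (ε ^ (-s) * |u x|) := by
            apply setLIntegral_mono_ae' measurableSet_Ioo
            refine ae_of_all _ fun x hx => ENNReal.ofReal_le_ofReal ?_
            rw [mul_comm]
            refine mul_le_mul_of_nonneg_right ?_ (abs_nonneg _)
            exact Real.rpow_le_rpow_of_nonpos hε (by linarith [hx.1]) (by linarith)
        _ ≤ _ := lintegral_mono_set hSsub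
    refine ne_top_of_le_ne_top ?_ this
    rw [← ofReal_integral_eq_lintegral_ofReal (iu.const_mul _)
      (ae_of_all _ fun y => mul_nonneg (Real.rpow_nonneg hε.le _) (abs_nonneg _))]
    exact ENNReal.ofReal_ne_top
  have hGn : ∀ z : ℝ × ℝ, 0 ≤ (b - a) ^ (s' - s) * (|u z.1 - u z.2| / |z.1 - z.2| ^ (1 + s')) := fun z =>
    mul_nonneg (Real.rpow_nonneg (by linarith) _) (by positivity)
  rw [← ofReal_integral_eq_lintegral_ofReal (hGp.const_mul _) (ae_of_all _ hGn), integral_const_mul] at le1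
  set G' := (b - a) ^ (s' - s) * ∫ q, |u q.1 - u q.2| / |q.1 - q.2| ^ (1 + s') ∂(μ.prod μ) with hG'
  have hG'0 : 0 ≤ G' := mul_nonneg (Real.rpow_nonneg (by linarith) _) (integral_nonneg fun _ => by positivity)
  have tot := le1.trans (add_le_add_right le2 _)
  rw [← ENNReal.ofReal_toReal fin] at tot ⊢
  have hA0 : 0 ≤ A.toReal := ENNReal.toReal_nonneg
  rw [← ENNReal.ofReal_add hA0 hNn0, ← ENNReal.ofReal_mul hκ0, ← ENNReal.ofReal_add hG'0 (by positivity),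
    ENNReal.ofReal_le_ofReal_iff (by positivity)] at tot
  apply ENNReal.ofReal_le_ofReal
  rw [le_div_iff₀ (by linarith)]
  linarith

lemma hardy (a b s s' : ℝ) (hab : a < b) (hs : 0 < s) (hss' : s < s') (hs1 : s < 1) :
    ∃ C ≥ (0:ℝ), ∀ u : ℝ → ℝ, IntegrableOn u (Ioo a b) →
      IntegrableOn (fun q : ℝ × ℝ => |u q.1 - u q.2| / |q.1 - q.2| ^ (1 + s')) (Ioo a b ×ˢ Ioo a b) →
      IntegrableOn (fun x => |u x| * (x - a) ^ (-s)) (Ioo a b) ∧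
      ∫ x in Ioo a b, |u x| * (x - a) ^ (-s) ≤ C * ((∫ x in Ioo a b, |u x|) +
          ∫ q in Ioo a b ×ˢ Ioo a b, |u q.1 - u q.2| / |q.1 - q.2| ^ (1 + s')) := by
  set κ : ℝ := (2 ^ s - 1) / s with hκ
  have hκ1 : κ < 1 := by
    have := rpow_one_add_lt_one_add_mul_self (s := 1) (by norm_num) one_ne_zero hs hs1
    norm_num at this
    rw [hκ, div_lt_one hs]
    linarith
  have hκ0 : 0 ≤ κ := by
    have : (1:ℝ) ≤ 2 ^ s := Real.one_le_rpow (by norm_num) hs.le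
    exact div_nonneg (by linarith) hs.le
  have hP : 0 ≤ (b - a) ^ (s' - s) := Real.rpow_nonneg (by linarith) _
  have hQ : 0 ≤ ((b - a) / 2) ^ (-s) := Real.rpow_nonneg (by linarith) _
  have hκ2 : 0 < 1 - κ := by linarith
  set P := (b - a) ^ (s' - s)
  set Q := ((b - a) / 2) ^ (-s) with hQdef
  refine ⟨P / (1 - κ) + κ * Q / (1 - κ) + Q, by positivity, fun u hu hG => ?_⟩
  set U := ∫ x in Ioo a b, |u x| with hU
  set Gg := ∫ q in Ioo a b ×ˢ Ioo a b, |u q.1 - u q.2| / |q.1 - q.2| ^ (1 + s')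
  have hU0 : 0 ≤ U := integral_nonneg fun _ => abs_nonneg _
  have hGg0 : 0 ≤ Gg := integral_nonneg fun _ => by positivity
  have heps := hardy_eps a b s s' hab hs hss' hs1 u hu hG
  have iu : IntegrableOn (fun x => |u x|) (Ioo a b) := hu.abs
  set m := (a + b) / 2 with hm
  have half : ∫⁻ x in Ioo a m, ENNReal.ofReal (|u x| * (x - a) ^ (-s)) ≤
      ENNReal.ofReal ((P * Gg + κ * (Q * U)) / (1 - κ)) := by
    have hun : Ioo a m = ⋃ n : ℕ, Ioo (a + 1 / ((n:ℝ) + 1)) m := by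
      ext x
      simp only [mem_iUnion, mem_Ioo]
      constructor
      · rintro ⟨h1, h2⟩
        obtain ⟨n, hn⟩ := exists_nat_one_div_lt (sub_pos.2 h1)
        exact ⟨n, by linarith, h2⟩
      · rintro ⟨n, h1, h2⟩
        have : 0 < 1 / ((n:ℝ) + 1) := by positivity
        exact ⟨by linarith, h2⟩
    rw [hun, setLIntegral_iUnion_of_directed]
    · exact iSup_le fun n => heps _ (by positivity)
    · apply Monotone.directed_le
      intro i j hij
      apply Ioo_subset_Ioo_left
      have := Nat.one_div_le_one_div (α := ℝ) hij
      linarith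
  have full : ∫⁻ x in Ioo a b, ENNReal.ofReal (|u x| * (x - a) ^ (-s)) ≤
      ENNReal.ofReal ((P * Gg + κ * (Q * U)) / (1 - κ) + Q * U) := by
    calc _ ≤ ∫⁻ x in Ioo a b, ((Ioo a m).indicator (fun x => ENNReal.ofReal (|u x| * (x - a) ^ (-s))) x
          + ENNReal.ofReal (Q * |u x|)) := by
          apply setLIntegral_mono_ae' measurableSet_Ioo
          refine ae_of_all _ fun x hx => ?_
          by_cases hxm : x < m
          · rw [indicator_of_mem (show x ∈ Ioo a m from ⟨hx.1, hxm⟩)]; exact le_self_add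
          · rw [indicator_of_notMem (fun h => hxm h.2), zero_add]
            apply ENNReal.ofReal_le_ofReal
            rw [mul_comm]
            refine mul_le_mul_of_nonneg_right ?_ (abs_nonneg _)
            rw [hm] at hxm
            exact Real.rpow_le_rpow_of_nonpos (by linarith) (by linarith) (by linarith)
      _ = (∫⁻ x in Ioo a m, ENNReal.ofReal (|u x| * (x - a) ^ (-s))) + ENNReal.ofReal (Q * U) := by
          rw [lintegral_add_right']
          · congr 1
            · rw [lintegral_indicator measurableSet_Ioo, Measure.restrict_restrict measurableSet_Ioo,
                inter_eq_left.2 (Ioo_subset_Ioo_right (by rw [hm]; linarith))]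
            · rw [hU, ← integral_const_mul, ofReal_integral_eq_lintegral_ofReal (iu.const_mul _)]
              exact ae_of_all _ fun y => mul_nonneg hQ (abs_nonneg _)
          · exact (iu.const_mul _).aestronglyMeasurable.aemeasurable.ennreal_ofReal
      _ ≤ _ := by
          rw [ENNReal.ofReal_add (by positivity) (by positivity)]
          gcongr
  have hnn : 0 ≤ᵐ[volume.restrict (Ioo a b)] fun x => |u x| * (x - a) ^ (-s) := by
    filter_upwards [ae_restrict_mem measurableSet_Ioo] with x hx
    exact mul_nonneg (abs_nonneg _) (Real.rpow_nonneg (by linarith [hx.1]) _)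
  have hms : AEStronglyMeasurable (fun x => |u x| * (x - a) ^ (-s)) (volume.restrict (Ioo a b)) :=
    iu.aestronglyMeasurable.mul (by fun_prop : Measurable fun x : ℝ => (x - a) ^ (-s)).aestronglyMeasurable
  refine ⟨⟨hms, ?_⟩, ?_⟩
  · rw [hasFiniteIntegral_iff_ofReal hnn]
    exact full.trans_lt ENNReal.ofReal_lt_top
  · rw [integral_eq_lintegral_of_nonneg_ae hnn hms]
    refine (ENNReal.toReal_mono ENNReal.ofReal_ne_top full).trans ?_
    rw [ENNReal.toReal_ofReal (by positivity)]
    have e : (P / (1 - κ) + κ * Q / (1 - κ) + Q) * (U + Gg) =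
        ((P * Gg + κ * (Q * U)) / (1 - κ) + Q * U) + (P / (1 - κ) * U + (κ * Q / (1 - κ) + Q) * Gg) := by ring
    rw [e]
    have : 0 ≤ P / (1 - κ) * U + (κ * Q / (1 - κ) + Q) * Gg := by positivity
    linarith

lemma pointwise_bound (a b s s' : ℝ) (hab : a < b)
    (hs : 0 < s) (hss' : s < s') (hs1 : s < 1) : ∃ c > (0:ℝ), ∀ u φ : ℝ → ℝ,
      IntegrableOn u (Ioo a b) → IntegrableOn φ (Ioo a b) →
      IntegrableOn (fun q : ℝ × ℝ => |u q.1 - u q.2| / |q.1 - q.2| ^ (1 + s')) (Ioo a b ×ˢ Ioo a b) →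
      (∀ᵐ x ∂(volume.restrict (Ioo a b)), u x = RLint a s φ x) →
      ∀ᵐ x ∂(volume.restrict (Ioo a b)), |φ x| ≤ c *
        ((b - a) ^ (s' - s) * (∫ t in Ioo a b, |u x - u t| / |x - t| ^ (1 + s')) + |u x| * (x - a) ^ (-s)) := by
  have hcpos : 0 < Real.Gamma s / ∫ v in (0:ℝ)..1, (1 - v) ^ (1 - s) * v ^ (s - 1) :=
    div_pos (Real.Gamma_pos_of_pos hs) (beta_pos s hs hs1)
  refine ⟨64 * (Real.Gamma s / ∫ v in (0:ℝ)..1, (1 - v) ^ (1 - s) * v ^ (s - 1)), by positivity, ?_⟩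
  intro u φ hu hφ hG hrep
  have hW := W_identity a b s hab hs hs1 u φ hφ hrep
  set c := Real.Gamma s / ∫ v in (0:ℝ)..1, (1 - v) ^ (1 - s) * v ^ (s - 1) with hc
  have hGp : Integrable (fun q : ℝ × ℝ => |u q.1 - u q.2| / |q.1 - q.2| ^ (1 + s'))
      ((volume.restrict (Ioo a b)).prod (volume.restrict (Ioo a b))) := by
    rw [Measure.prod_restrict]; exact hG
  filter_upwards [hat_limit a b hab φ hφ, hGp.prod_right_ae, ae_restrict_mem measurableSet_Ioo] with x hlim hF hx
  set F := ∫ t in Ioo a b, |u x - u t| / |x - t| ^ (1 + s') with hFdef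
  refine le_of_tendsto hlim.abs ?_
  filter_upwards [self_mem_nhdsWithin] with h hh
  have hh : 0 < h := hh
  have hp : 0 < 1 - s := by linarith
  have hddc := dd_cont (1 - s) h hp
  have e1 : ∫ t in Ioo a b, φ t * dd 1 h (x - t) = c * ∫ t in Ioo a b, u t * dd (1 - s) h (x - t) := by
    rw [int_mul_dd a b 1 h x one_pos φ hφ, int_mul_dd a b (1 - s) h x hp u hu,
      hW x hx.2.le, hW (x - h) (by linarith [hx.2]), hW (x - 2 * h) (by linarith [hx.2])]
    ring
  have i1 := bdd_int a b (fun t => dd (1 - s) h (x - t)) (by fun_prop) u hu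
  have i2 := bdd_int a b (fun t => dd (1 - s) h (x - t)) (by fun_prop) (fun _ => u x) (by simp)
  have e2 : ∫ t in Ioo a b, u t * dd (1 - s) h (x - t) =
      (∫ t in Ioo a b, (u t - u x) * dd (1 - s) h (x - t)) + u x * ∫ t in Ioo a b, dd (1 - s) h (x - t) := by
    simp_rw [sub_mul]
    rw [integral_sub i1 i2, integral_const_mul]
    ring
  have hP : 0 ≤ (b - a) ^ (s' - s) := Real.rpow_nonneg (by linarith) _
  have b1 : |∫ t in Ioo a b, (u t - u x) * dd (1 - s) h (x - t)| ≤ 64 * h ^ 2 * (b - a) ^ (s' - s) * F := by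
    rw [hFdef, ← integral_const_mul, ← Real.norm_eq_abs]
    apply norm_integral_le_of_norm_le (hF.const_mul _)
    filter_upwards [ae_restrict_mem measurableSet_Ioo] with t ht
    rw [norm_mul, Real.norm_eq_abs, Real.norm_eq_abs]
    rcases le_or_gt (x - t) 0 with h0 | h0
    · rw [dd_of_nonpos _ _ _ hp hh h0, abs_zero, mul_zero]
      positivity
    · have q1 := dd_bound (1 - s) h (x - t) hp (by linarith) hh h0
      have q2 := rpow_compare (b - a) s s' (x - t) hss' h0 (by linarith [ht.1, hx.2])
      rw [show 1 - s - 2 = -1 - s by ring] at q1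
      rw [abs_of_pos h0, abs_sub_comm (u t)]
      calc |u x - u t| * |dd (1 - s) h (x - t)|
          ≤ |u x - u t| * (64 * h ^ 2 * ((b - a) ^ (s' - s) * ((x - t) ^ (1 + s'))⁻¹)) := by
            refine mul_le_mul_of_nonneg_left (q1.trans ?_) (abs_nonneg _)
            exact mul_le_mul_of_nonneg_left q2 (by positivity)
        _ = _ := by rw [div_eq_mul_inv]; ring
  have b2 : |∫ t in Ioo a b, dd (1 - s) h (x - t)| ≤ 64 * h ^ 2 * (x - a) ^ (-s) := by
    rw [int_dd a b (1 - s) h x hab hp hh hx.2.le, abs_div, abs_of_pos (by linarith : 0 < 1 - s + 1)]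
    have := dd_bound (1 - s + 1) h (x - a) (by linarith) (by linarith) hh (by linarith [hx.1])
    rw [show 1 - s + 1 - 2 = -s by ring] at this
    refine (div_le_self (abs_nonneg _) (by linarith)).trans this
  rw [e1, e2, abs_div, abs_mul, abs_of_pos hcpos, abs_of_pos (by positivity : 0 < h ^ 2), div_le_iff₀ (by positivity)]
  have b3 := abs_add_le (∫ t in Ioo a b, (u t - u x) * dd (1 - s) h (x - t))
    (u x * ∫ t in Ioo a b, dd (1 - s) h (x - t))
  rw [abs_mul] at b3
  have b4 := mul_le_mul_of_nonneg_left b2 (abs_nonneg (u x))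
  refine (mul_le_mul_of_nonneg_left (b3.trans (add_le_add b1 b4)) hcpos.le).trans (le_of_eq ?_)
  ring

/-- if `u ∈ L^1(a,b)` has finite Gagliardo `W^{s',1}` seminorm and is
represented as `u = I_{a+}^s[φ]` with `φ ∈ L^1`, then
`‖φ‖_{L^1} ≤ C (‖u‖_{L^1} + [u]_{W_G^{s',1}})`, i.e. `‖D_{a+}^s u‖_{L^1} ≤ C ‖u‖_{W_G^{s',1}}`. -/
theorem rl_deriv_le_gagliardo (a b s s' : ℝ) (hab : a < b)
    (hs : 0 < s) (hss' : s < s') (hs' : s' < 1) :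
    ∃ C > (0:ℝ), ∀ u φ : ℝ → ℝ,
      IntegrableOn u (Set.Ioo a b) → IntegrableOn φ (Set.Ioo a b) →
      IntegrableOn (fun q : ℝ × ℝ => |u q.1 - u q.2| / |q.1 - q.2| ^ (1 + s'))
        (Set.Ioo a b ×ˢ Set.Ioo a b) →
      (∀ᵐ x ∂(volume.restrict (Set.Ioo a b)), u x = RLint a s φ x) →
      (∫ x in Set.Ioo a b, |φ x|) ≤
        C * ((∫ x in Set.Ioo a b, |u x|) +
          ∫ q in Set.Ioo a b ×ˢ Set.Ioo a b, |u q.1 - u q.2| / |q.1 - q.2| ^ (1 + s')) := by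
  have hs1 : s < 1 := hss'.trans hs'
  obtain ⟨c, hc, hpt⟩ := pointwise_bound a b s s' hab hs hss' hs1
  obtain ⟨K, hK, hH⟩ := hardy a b s s' hab hs hss' hs1
  have hP : 0 < (b - a) ^ (s' - s) := Real.rpow_pos_of_pos (by linarith) _
  refine ⟨c * ((b - a) ^ (s' - s) + K), by positivity, ?_⟩
  intro u φ hu hφ hG hrep
  obtain ⟨hi, hle⟩ := hH u hu hG
  have hpt := hpt u φ hu hφ hG hrep
  have hGp : Integrable (fun q : ℝ × ℝ => |u q.1 - u q.2| / |q.1 - q.2| ^ (1 + s'))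
      ((volume.restrict (Ioo a b)).prod (volume.restrict (Ioo a b))) := by
    rw [Measure.prod_restrict]; exact hG
  have hGe : ∫ q in Ioo a b ×ˢ Ioo a b, |u q.1 - u q.2| / |q.1 - q.2| ^ (1 + s')
      = ∫ x in Ioo a b, ∫ t in Ioo a b, |u x - u t| / |x - t| ^ (1 + s') := by
    rw [← integral_prod _ hGp, Measure.prod_restrict]; rfl
  have hU0 : 0 ≤ ∫ x in Ioo a b, |u x| := integral_nonneg fun _ => abs_nonneg _
  have iF := hGp.integral_prod_left
  simp only at iF
  have hmono := integral_mono_ae hφ.abs (((iF.const_mul ((b - a) ^ (s' - s))).add hi).const_mul c) hpt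
  simp only [Pi.add_apply] at hmono
  rw [integral_const_mul, integral_add (iF.const_mul ((b - a) ^ (s' - s))) hi, integral_const_mul, ← hGe] at hmono
  refine hmono.trans ?_
  rw [mul_assoc]
  refine mul_le_mul_of_nonneg_left ?_ hc.le
  rw [add_mul]
  refine add_le_add ?_ hle
  exact mul_le_mul_of_nonneg_left (by linarith) hP.le
end

section
/- Let a < b be real numbers, g ∈ L^1(a,b), and let u(x) := ∫_a^x g(t) dt for x ∈ [a,b] (so u ∈ W^{1,1}(a,b) with u(a) = 0 and u' = g). Then for each s ∈ (0,1) the Riemann–Liouville derivative satisfies D_{a+}^s u = I_{a+}^{1−s}[g] almost everywhere on (a,b), and ‖D_{a+}^s u − g‖_{L^1(a,b)} → 0 as s → 1−. -/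
open MeasureTheory Set Filter ENNReal

/-- truncated Riemann–Liouville kernel -/
noncomputable def rlK (L σ : ℝ) : ℝ → ℝ :=
  Set.indicator (Set.Ioo 0 L) (fun r => (Real.Gamma σ)⁻¹ * r ^ (σ - 1))

lemma rlK_integrable {L σ : ℝ} (hL : 0 < L) (hσ : 0 < σ) : Integrable (rlK L σ) := by
  unfold rlK
  rw [integrable_indicator_iff measurableSet_Ioo]
  apply Integrable.const_mul
  exact (intervalIntegral.integrableOn_Ioo_rpow_iff hL).2 (by linarith)

lemma rlint_congr {a σ x : ℝ} {g h : ℝ → ℝ} (hx : a ≤ x) (hgh : ∀ t ∈ Set.Ioc a x, g t = h t) :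
    RLint a σ g x = RLint a σ h x := by
  unfold RLint
  congr 1
  apply intervalIntegral.integral_congr_ae
  refine Eventually.of_forall fun t ht => ?_
  rw [uIoc_of_le hx] at ht
  simp only [hgh t ht]

lemma rlint_rep {a b σ x : ℝ} {h : ℝ → ℝ} (hx : a < x) (hxb : x ≤ b) (h0 : ∀ t ≤ a, h t = 0) :
    RLint a σ h x = ∫ r, rlK (b - a) σ r * h (x - r) := by
  unfold RLint
  have h1 := intervalIntegral.integral_comp_sub_left (a := 0) (b := x - a)
    (fun t => h t * (x - t) ^ (σ - 1)) x
  simp only [_root_.sub_sub_cancel, sub_zero] at h1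
  rw [← h1, intervalIntegral.integral_of_le (by linarith), integral_Ioc_eq_integral_Ioo,
    ← integral_const_mul, ← integral_indicator measurableSet_Ioo]
  congr 1
  ext r
  unfold rlK
  by_cases hr : r ∈ Set.Ioo 0 (x - a)
  · have hr' : r ∈ Set.Ioo 0 (b - a) := ⟨hr.1, by linarith [hr.2]⟩
    simp only [hr, hr', indicator_of_mem]
    ring
  · rw [indicator_of_notMem hr]
    by_cases hr' : r ∈ Set.Ioo 0 (b - a)
    · rw [h0 (x - r), mul_zero]
      by_contra hc
      exact hr ⟨hr'.1, by linarith⟩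
    · rw [indicator_of_notMem hr', zero_mul]

lemma rl_prod_int {K G : ℝ → ℝ} (hK : Integrable K) (hG : Integrable G) :
    Integrable (fun p : ℝ × ℝ => K p.2 * G (p.1 - p.2)) (volume.prod volume) := by
  simpa using hK.convolution_integrand (ContinuousLinearMap.mul ℝ ℝ) hG

lemma rl_conv_int {K G : ℝ → ℝ} (hK : Integrable K) (hG : Integrable G) :
    Integrable (fun x => ∫ r, K r * G (x - r)) :=
  (rl_prod_int hK hG).integral_prod_left

lemma rl_fubini {K G : ℝ → ℝ} {a x : ℝ} (hK : Integrable K) (hG : Integrable G) (hx : a ≤ x)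
    (hK0 : ∀ r ≤ 0, K r = 0) (h0 : ∀ t ≤ a, G t = 0) :
    ∫ y in a..x, (∫ r, K r * G (y - r)) = ∫ r, K r * ∫ t in a..(x - r), G t := by
  rw [intervalIntegral.integral_of_le hx, integral_integral_swap]
  · congr 1
    ext r
    rw [integral_const_mul, ← intervalIntegral.integral_of_le hx]
    rcases le_or_gt r 0 with hr | hr
    · rw [hK0 r hr]; simp
    · congr 1
      rw [intervalIntegral.integral_comp_sub_right,
        ← intervalIntegral.integral_add_adjacent_intervals (b := a)
          hG.intervalIntegrable hG.intervalIntegrable]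
      have : ∫ t in (a - r)..a, G t = ∫ t in (a - r)..a, (0 : ℝ) := by
        apply intervalIntegral.integral_congr
        intro t ht
        rw [uIcc_of_le (by linarith)] at ht
        exact h0 t ht.2
      rw [this]; simp
  · have := rl_prod_int hK hG
    have h2 := this.restrict (s := Set.Ioc a x ×ˢ Set.univ)
    rw [← Measure.prod_restrict, Measure.restrict_univ] at h2
    exact h2

lemma rl_transl {G : ℝ → ℝ} (hG : Integrable G) :
    Tendsto (fun r : ℝ => ∫ x, |G (x - r) - G x|) (nhds 0) (nhds 0) := by
  rw [Metric.tendsto_nhds]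
  intro ε hε
  obtain ⟨φ, hφc, hφ, hφC, hφi⟩ :=
    hG.exists_hasCompactSupport_integral_sub_le (show 0 < ε / 4 by linarith)
  have key : Tendsto (fun r : ℝ => ∫ x, |φ (x - r) - φ x|) (nhds 0) (nhds 0) := by
    obtain ⟨C, hC⟩ := hφC.bounded_above_of_compact_support hφc |> fun h => h
    obtain ⟨R, hR⟩ := hφc.isCompact.isBounded.subset_closedBall 0
    have hz : ∀ y, R < |y| → φ y = 0 := by
      intro y hy
      by_contra hne
      have := hR (subset_tsupport _ hne)
      simp at this
      linarith
    suffices h : Tendsto (fun r : ℝ => ∫ x, |φ (x - r) - φ x|) (nhds 0)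
        (nhds (∫ x, |φ (x - 0) - φ x|)) by simpa using h
    apply tendsto_integral_filter_of_dominated_convergence
      (Set.indicator (Set.Icc (-(R + 1)) (R + 1)) (fun _ => C + C))
    · exact Eventually.of_forall fun r => by
        apply Continuous.aestronglyMeasurable; fun_prop
    · have : ∀ᶠ r : ℝ in nhds 0, |r| < 1 := by
        have := Metric.ball_mem_nhds (0 : ℝ) one_pos
        filter_upwards [this] with r hr
        simpa using hr
      filter_upwards [this] with r hr
      refine Eventually.of_forall fun x => ?_
      by_cases hx : x ∈ Set.Icc (-(R + 1)) (R + 1)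
      · rw [indicator_of_mem hx, Real.norm_eq_abs, abs_abs]
        have h1 := hC (x - r)
        have h2 := hC x
        rw [Real.norm_eq_abs] at h1 h2
        exact (abs_sub _ _).trans (add_le_add h1 h2)
      · rw [indicator_of_notMem hx]
        have hx' : R + 1 < |x| := by
          by_contra hc
          exact hx (abs_le.1 (not_lt.1 hc))
        have h3 := abs_sub_abs_le_abs_sub x r
        rw [hz x (by linarith), hz (x - r) (by linarith)]
        simp
    · rw [integrable_indicator_iff measurableSet_Icc]
      exact integrableOn_const (by simp)
    · refine Eventually.of_forall fun x => ?_
      have : Continuous fun r => |φ (x - r) - φ x| := by fun_prop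
      exact this.tendsto 0
  rw [Metric.tendsto_nhds] at key
  filter_upwards [key (ε / 4) (by linarith)] with r hr
  have hnn : ∀ f : ℝ → ℝ, 0 ≤ ∫ x, |f x| := fun f => integral_nonneg fun x => abs_nonneg _
  rw [Real.dist_eq, sub_zero, abs_of_nonneg (hnn _)] at hr ⊢
  have i1 : Integrable fun x => |G (x - r) - φ (x - r)| := ((hG.sub hφi).comp_sub_right r).abs
  have i2 : Integrable fun x => |φ (x - r) - φ x| := ((hφi.comp_sub_right r).sub hφi).abs
  have i3 : Integrable fun x => |G x - φ x| := (hG.sub hφi).abs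
  have i12 : Integrable fun x => |G (x - r) - φ (x - r)| + |φ (x - r) - φ x| := i1.add i2
  have e1 : ∫ x, |G (x - r) - φ (x - r)| = ∫ x, |G x - φ x| :=
    integral_sub_right_eq_self (fun x => |G x - φ x|) r
  have e2 : ∫ x, |G x - φ x| ≤ ε / 4 := by simpa using hφ
  have : ∫ x, |G (x - r) - G x| ≤
      ∫ x, (|G (x - r) - φ (x - r)| + |φ (x - r) - φ x| + |G x - φ x|) := by
    apply integral_mono ((hG.comp_sub_right r).sub hG).abs (i12.add i3)
    intro x
    have := abs_sub_le (G (x - r)) (φ (x - r)) (G x)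
    have h2 := abs_sub_le (φ (x - r)) (φ x) (G x)
    rw [abs_sub_comm (φ x) (G x)] at h2
    show |G (x - r) - G x| ≤ |G (x - r) - φ (x - r)| + |φ (x - r) - φ x| + |G x - φ x|
    linarith
  rw [integral_add i12 i3, integral_add i1 i2] at this
  linarith

lemma rl_gamma : Tendsto (fun σ : ℝ => Real.Gamma (σ + 1)) (nhdsWithin 0 (Set.Ioi 0)) (nhds 1) := by
  have h : ContinuousAt Real.Gamma 1 :=
    (Real.differentiableAt_Gamma (fun m => by
      have : (0 : ℝ) ≤ m := Nat.cast_nonneg m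
      intro h; linarith)).continuousAt
  have h2 : Tendsto (fun σ : ℝ => σ + 1) (nhdsWithin 0 (Set.Ioi 0)) (nhds 1) := by
    have : Continuous fun σ : ℝ => σ + 1 := by fun_prop
    simpa using (this.tendsto 0).mono_left nhdsWithin_le_nhds
  have := h.tendsto.comp h2
  rwa [Real.Gamma_one] at this

lemma rl_gamma_inv : Tendsto (fun σ : ℝ => (Real.Gamma σ)⁻¹) (nhdsWithin 0 (Set.Ioi 0))
    (nhds 0) := by
  have h : Tendsto (fun σ : ℝ => σ / Real.Gamma (σ + 1)) (nhdsWithin 0 (Set.Ioi 0))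
      (nhds (0 / 1)) :=
    (tendsto_id.mono_left nhdsWithin_le_nhds).div rl_gamma one_ne_zero
  rw [zero_div] at h
  refine h.congr' ?_
  filter_upwards [self_mem_nhdsWithin] with σ hσ
  have hσ : 0 < σ := hσ
  rw [Real.Gamma_add_one hσ.ne']
  have := Real.Gamma_pos_of_pos hσ
  field_simp

lemma rl_mass {L : ℝ} (hL : 0 < L) :
    Tendsto (fun σ : ℝ => ∫ r in Set.Ioo 0 L, (Real.Gamma σ)⁻¹ * r ^ (σ - 1))
      (nhdsWithin 0 (Set.Ioi 0)) (nhds 1) := by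
  have h : Tendsto (fun σ : ℝ => L ^ σ / Real.Gamma (σ + 1)) (nhdsWithin 0 (Set.Ioi 0))
      (nhds (1 / 1)) := by
    refine Tendsto.div ?_ rl_gamma one_ne_zero
    have : Continuous fun σ : ℝ => L ^ σ := Real.continuous_const_rpow hL.ne'
    simpa using (this.tendsto 0).mono_left nhdsWithin_le_nhds
  rw [div_one] at h
  refine h.congr' ?_
  filter_upwards [self_mem_nhdsWithin] with σ hσ
  have hσ : 0 < σ := hσ
  rw [integral_const_mul, ← integral_Ioc_eq_integral_Ioo, ← intervalIntegral.integral_of_le hL.le,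
    integral_rpow (Or.inl (by linarith)), Real.Gamma_add_one hσ.ne']
  have := Real.Gamma_pos_of_pos hσ
  simp only [sub_add_cancel, Real.zero_rpow hσ.ne', sub_zero]
  field_simp

lemma rl_peak {L : ℝ} (hL : 0 < L) {w : ℝ → ℝ} (hw : IntegrableOn w (Set.Ioo 0 L))
    (hw0 : Tendsto w (nhds 0) (nhds 0)) :
    Tendsto (fun σ : ℝ => ∫ r, rlK L σ r * w r) (nhdsWithin 0 (Set.Ioi 0)) (nhds 0) := by
  have h := tendsto_setIntegral_peak_smul_of_integrableOn_of_tendsto (μ := volume)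
    (s := Set.Ioo 0 L) (t := Set.Ioo 0 L) (x₀ := (0 : ℝ)) (g := w) (a := 0)
    (l := nhdsWithin (0 : ℝ) (Set.Ioi 0)) (φ := fun σ r => (Real.Gamma σ)⁻¹ * r ^ (σ - 1))
    measurableSet_Ioo measurableSet_Ioo le_rfl self_mem_nhdsWithin (by simp) ?_ ?_ (rl_mass hL) ?_
    hw (hw0.mono_left nhdsWithin_le_nhds)
  · refine h.congr fun σ => ?_
    rw [← integral_indicator measurableSet_Ioo]
    congr 1
    ext r
    unfold rlK
    by_cases hr : r ∈ Set.Ioo 0 L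
    · simp [hr]
    · rw [indicator_of_notMem hr, indicator_of_notMem hr, zero_mul]
  · filter_upwards [self_mem_nhdsWithin] with σ hσ r hr
    have := Real.Gamma_pos_of_pos hσ
    have := hr.1
    positivity
  · intro u hu h0
    obtain ⟨δ, hδ, hδu⟩ := Metric.isOpen_iff.1 hu 0 h0
    have hb : Tendsto (fun σ : ℝ => (Real.Gamma σ)⁻¹ * δ ^ (σ - 1)) (nhdsWithin 0 (Set.Ioi 0))
        (nhds 0) := by
      have : Continuous fun σ : ℝ => δ ^ (σ - 1) :=
        (Real.continuous_const_rpow hδ.ne').comp (by fun_prop)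
      simpa using rl_gamma_inv.mul ((this.tendsto 0).mono_left nhdsWithin_le_nhds)
    rw [Metric.tendstoUniformlyOn_iff]
    intro ε hε
    have h1 : ∀ᶠ σ : ℝ in nhdsWithin 0 (Set.Ioi 0), σ < 1 :=
      nhdsWithin_le_nhds (Iio_mem_nhds one_pos)
    filter_upwards [self_mem_nhdsWithin, h1, hb.eventually (Iio_mem_nhds hε)] with σ hσ hσ1 hlt r hr
    have hG := Real.Gamma_pos_of_pos hσ
    have hr0 : 0 < r := hr.1.1
    have hδr : δ ≤ r := by
      by_contra hc
      apply hr.2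
      apply hδu
      simp [abs_of_pos hr0]
      linarith
    have hle : r ^ (σ - 1) ≤ δ ^ (σ - 1) :=
      Real.rpow_le_rpow_of_nonpos hδ hδr (by linarith)
    simp only [Pi.zero_apply, dist_zero_left, Real.norm_eq_abs]
    rw [abs_of_nonneg (by positivity)]
    refine lt_of_le_of_lt ?_ hlt
    gcongr
  · refine Eventually.of_forall fun σ => ?_
    apply Measurable.aestronglyMeasurable
    fun_prop

lemma rl_L1 {L : ℝ} (hL : 0 < L) {G : ℝ → ℝ} (hG : Integrable G) :
    Tendsto (fun σ : ℝ => ∫ x, |(∫ r, rlK L σ r * G (x - r)) - G x|)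
      (nhdsWithin 0 (Set.Ioi 0)) (nhds 0) := by
  set w : ℝ → ℝ := fun r => ∫ x, |G (x - r) - G x| with hwdef
  have hwm : AEStronglyMeasurable w volume := by
    have : AEStronglyMeasurable (fun p : ℝ × ℝ => |G (p.2 - p.1) - G p.2|)
        (volume.prod volume) := by
      have h1 : AEStronglyMeasurable (fun p : ℝ × ℝ => G (p.2 - p.1)) (volume.prod volume) := by
        have := hG.aestronglyMeasurable.comp_quasiMeasurePreserving
          (quasiMeasurePreserving_sub_of_right_invariant volume volume)
        exact this.prod_swap
      exact (h1.sub hG.aestronglyMeasurable.comp_snd).norm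
    exact this.integral_prod_right'
  have hwi : IntegrableOn w (Set.Ioo 0 L) := by
    refine Measure.integrableOn_of_bounded (M := 2 * ∫ x, |G x|) (by simp) hwm ?_
    refine Eventually.of_forall fun r => ?_
    rw [Real.norm_eq_abs, abs_of_nonneg (integral_nonneg fun x => abs_nonneg _)]
    have e1 : ∫ x, |G (x - r)| = ∫ x, |G x| := integral_sub_right_eq_self (fun x => |G x|) r
    have : w r ≤ ∫ x, (|G (x - r)| + |G x|) := by
      apply integral_mono ((hG.comp_sub_right r).sub hG).abs
        ((hG.comp_sub_right r).abs.add hG.abs)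
      intro x
      exact abs_sub _ _
    rw [integral_add (hG.comp_sub_right r).abs hG.abs, e1] at this
    linarith
  have hp := rl_peak hL hwi (rl_transl hG)
  have hm : Tendsto (fun σ : ℝ => |(∫ r, rlK L σ r) - 1| * ∫ x, |G x|)
      (nhdsWithin 0 (Set.Ioi 0)) (nhds 0) := by
    have : Tendsto (fun σ : ℝ => ∫ r, rlK L σ r) (nhdsWithin 0 (Set.Ioi 0)) (nhds 1) := by
      refine (rl_mass hL).congr fun σ => ?_
      rw [← integral_indicator measurableSet_Ioo]; rfl
    simpa using ((this.sub_const 1).abs).mul_const (∫ x, |G x|)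
  have hs := hp.add hm
  rw [add_zero] at hs
  refine tendsto_of_tendsto_of_tendsto_of_le_of_le' tendsto_const_nhds hs
    (Eventually.of_forall fun σ => integral_nonneg fun x => abs_nonneg _) ?_
  filter_upwards [self_mem_nhdsWithin] with σ hσ
  have hσ : 0 < σ := hσ
  have hK := rlK_integrable hL hσ
  have hKn : ∀ r, 0 ≤ rlK L σ r := by
    intro r
    refine indicator_nonneg (fun r hr => ?_) r
    have := Real.Gamma_pos_of_pos hσ
    have := hr.1
    positivity
  have hP1 := rl_prod_int hK hG
  have hP2 : Integrable (fun p : ℝ × ℝ => rlK L σ p.2 * G p.1) (volume.prod volume) := by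
    have := hG.mul_prod hK
    simpa only [mul_comm] using this
  have hP : Integrable (fun p : ℝ × ℝ => rlK L σ p.2 * (G (p.1 - p.2) - G p.1))
      (volume.prod volume) := by
    have := hP1.sub hP2
    refine this.congr (Eventually.of_forall fun p => ?_)
    simp only [Pi.sub_apply]
    ring
  have hA : Integrable (fun x => ∫ r, |rlK L σ r * (G (x - r) - G x)|) :=
    hP.abs.integral_prod_left
  have hB : ∫ x, ∫ r, |rlK L σ r * (G (x - r) - G x)| = ∫ r, rlK L σ r * w r := by
    rw [integral_integral_swap hP.abs]
    congr 1
    ext r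
    simp only [abs_mul, abs_of_nonneg (hKn r)]
    rw [integral_const_mul]
  rw [← hB, ← integral_const_mul, ← integral_add hA (hG.abs.const_mul _)]
  apply integral_mono_ae ((rl_conv_int hK hG).sub hG).abs (hA.add (hG.abs.const_mul _))
  filter_upwards [hP1.prod_right_ae] with x hx
  have hx2 : Integrable fun r => rlK L σ r * G x := hK.mul_const _
  have e : (∫ r, rlK L σ r * G (x - r)) - G x =
      (∫ r, rlK L σ r * (G (x - r) - G x)) + ((∫ r, rlK L σ r) - 1) * G x := by
    simp only [mul_sub]
    rw [integral_sub hx hx2, integral_mul_const]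
    ring
  show |(∫ r, rlK L σ r * G (x - r)) - G x| ≤ _
  rw [e]
  refine (abs_add_le _ _).trans ?_
  rw [abs_mul]
  exact add_le_add (abs_integral_le_integral_abs) le_rfl

/-- for `u(x) = ∫_a^x g`, one has `D_{a+}^s u = I_{a+}^{1-s}[g]` a.e. and
`‖D_{a+}^s u − g‖_{L^1(a,b)} → 0` as `s → 1-`. -/
theorem rl_deriv_tendsto_L1 (a b : ℝ) (hab : a < b)
    (g : ℝ → ℝ) (hg : IntegrableOn g (Set.Ioo a b)) :
    (∀ s ∈ Set.Ioo (0:ℝ) 1, ∀ᵐ x ∂(volume.restrict (Set.Ioo a b)),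
      HasDerivAt (RLint a (1 - s) (fun y => ∫ t in a..y, g t)) (RLint a (1 - s) g x) x) ∧
    Filter.Tendsto (fun s : ℝ => ∫ x in Set.Ioo a b, |RLint a (1 - s) g x - g x|)
      (nhdsWithin 1 (Set.Iio 1)) (nhds 0) := by
  have hL : 0 < b - a := by linarith
  set G : ℝ → ℝ := Set.indicator (Set.Ioo a b) g with hGdef
  have hG : Integrable G := (integrable_indicator_iff measurableSet_Ioo).2 hg
  have hG0 : ∀ t ≤ a, G t = 0 := fun t ht => indicator_of_notMem (fun h => by
    have := h.1; linarith) _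
  have hGe : ∀ x ∈ Set.Ioo a b, G x = g x := fun x hx => indicator_of_mem hx _
  have hrep : ∀ σ, ∀ x ∈ Set.Ioo a b,
      RLint a σ g x = ∫ r, rlK (b - a) σ r * G (x - r) := by
    intro σ x hx
    rw [← rlint_rep hx.1 hx.2.le hG0]
    exact rlint_congr hx.1.le fun t ht => (hGe t ⟨ht.1, by linarith [ht.2, hx.2]⟩).symm
  constructor
  · intro s hs
    have hσ : 0 < 1 - s := by linarith [hs.2]
    have hK := rlK_integrable hL hσ
    have hF := rl_conv_int hK hG
    have hd := LocallyIntegrable.ae_hasDerivAt_integral hF.locallyIntegrable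
    rw [ae_restrict_iff' measurableSet_Ioo]
    filter_upwards [hd] with x hx hxI
    rw [hrep _ x hxI]
    refine (hx a).congr_of_eventuallyEq ?_
    filter_upwards [Ioo_mem_nhds hxI.1 hxI.2] with y hy
    have hK0 : ∀ r ≤ 0, rlK (b - a) (1 - s) r = 0 := fun r hr =>
      indicator_of_notMem (fun h => by have := h.1; linarith) _
    rw [rl_fubini hK hG hy.1.le hK0 hG0]
    have hU0 : ∀ z ≤ a, ∫ t in a..z, G t = 0 := by
      intro z hz
      have : ∫ t in a..z, G t = ∫ t in a..z, (0 : ℝ) := by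
        apply intervalIntegral.integral_congr
        intro t ht
        rw [uIcc_of_ge hz] at ht
        exact hG0 t ht.2
      rw [this]; simp
    rw [← rlint_rep (h := fun z => ∫ t in a..z, G t) hy.1 hy.2.le hU0]
    refine rlint_congr hy.1.le fun z hz => ?_
    apply intervalIntegral.integral_congr_ae
    refine Eventually.of_forall fun t ht => ?_
    rw [uIoc_of_le hz.1.le] at ht
    exact (hGe t ⟨ht.1, by linarith [ht.2, hz.2, hy.2]⟩).symm
  · have ht : Tendsto (fun s : ℝ => 1 - s) (nhdsWithin 1 (Set.Iio 1))
        (nhdsWithin 0 (Set.Ioi 0)) := by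
      apply tendsto_nhdsWithin_of_tendsto_nhds_of_eventually_within
      · have : Continuous fun s : ℝ => 1 - s := by fun_prop
        simpa using (this.tendsto 1).mono_left nhdsWithin_le_nhds
      · filter_upwards [self_mem_nhdsWithin] with s hs
        have : s < 1 := hs
        show 0 < 1 - s
        linarith
    have h := (rl_L1 hL hG).comp ht
    refine tendsto_of_tendsto_of_tendsto_of_le_of_le' tendsto_const_nhds h
      (Eventually.of_forall fun σ => integral_nonneg fun x => abs_nonneg _) ?_
    filter_upwards [self_mem_nhdsWithin] with s hs
    have hs : s < 1 := hs
    have hK := rlK_integrable hL (show 0 < 1 - s by linarith)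
    have e : ∫ x in Set.Ioo a b, |RLint a (1 - s) g x - g x| =
        ∫ x in Set.Ioo a b, |(∫ r, rlK (b - a) (1 - s) r * G (x - r)) - G x| := by
      apply setIntegral_congr_fun measurableSet_Ioo
      intro x hx
      simp only [hrep _ x hx, hGe x hx]
    rw [e]
    exact setIntegral_le_integral ((rl_conv_int hK hG).sub hG).abs
      (Eventually.of_forall fun x => abs_nonneg _)
end

section
/- Let a < b be real numbers and s ∈ (0,1). Let c ∈ ℝ, g ∈ L^1(a,b), let (x_k) be a sequence of points of (a,b) and (p_k) a sequence of reals with Σ_k |p_k| < ∞, and define the SBV function u(x) := c + ∫_a^x g(t) dt + Σ_k p_k·χ_{[x_k,b]}(x) for x ∈ [a,b]. Then the function h_s(t) := c (t−a)^{−s}/Γ(1−s) + I_{a+}^{1−s}[g](t) + (1/Γ(1−s)) Σ_k p_k (t−x_k)^{−s} χ_{(x_k,b]}(t) belongs to L^1(a,b), and I_{a+}^{1−s}[u](x) = ∫_a^x h_s(t) dt for every x ∈ [a,b]. In particular I_{a+}^{1−s}[u] ∈ W^{1,1}(a,b), so u belongs to the Riemann–Liouville fractional Sobolev space W^{s,1}_{RL,a+}(a,b),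 and D_{a+}^s u = h_s almost everywhere. -/
open MeasureTheory Set Filter ENNReal

/-- Fubini for a kernel with uniformly bounded mass. -/
lemma rl_fubini_s17 {Ω : Type*} [MeasurableSpace Ω] (ν : Measure Ω) [SFinite ν] (f : Ω → ℝ)
    (hf : Integrable f ν) (a x : ℝ) (k : ℝ → Ω → ℝ) (hk : Measurable (Function.uncurry k))
    (P : Ω → ℝ) (C : ℝ)
    (h0 : ∀ t ω, t ∈ Ioc a x → 0 ≤ k t ω)
    (hki : ∀ᵐ ω ∂ν, IntegrableOn (fun t => k t ω) (Ioc a x))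
    (hP : ∀ᵐ ω ∂ν, ∫ t in Ioc a x, k t ω = P ω)
    (hC : ∀ᵐ ω ∂ν, P ω ≤ C) :
    IntegrableOn (fun t => ∫ ω, f ω * k t ω ∂ν) (Ioc a x) ∧
      ∫ t in Ioc a x, ∫ ω, f ω * k t ω ∂ν = ∫ ω, f ω * P ω ∂ν := by
  have hm : AEStronglyMeasurable (Function.uncurry fun t ω => f ω * k t ω)
      ((volume.restrict (Ioc a x)).prod ν) := by
    have h1 : AEStronglyMeasurable (fun z : ℝ × Ω => f z.2)
        ((volume.restrict (Ioc a x)).prod ν) := hf.aestronglyMeasurable.comp_snd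
    exact h1.mul hk.aestronglyMeasurable
  have hint : Integrable (Function.uncurry fun t ω => f ω * k t ω)
      ((volume.restrict (Ioc a x)).prod ν) := by
    rw [integrable_prod_iff' hm]
    refine ⟨?_, ?_⟩
    · filter_upwards [hki] with ω h
      exact h.const_mul (f ω)
    · refine Integrable.mono' (hf.norm.mul_const C) hm.norm.prod_swap.integral_prod_right' ?_
      filter_upwards [hP, hC] with ω h1 h2
      have : ∫ t in Ioc a x, ‖Function.uncurry (fun t ω => f ω * k t ω) (t, ω)‖
          = ‖f ω‖ * P ω := by
        rw [← h1, ← integral_const_mul]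
        refine setIntegral_congr_fun measurableSet_Ioc fun t ht => ?_
        simp only [Function.uncurry, norm_mul]
        rw [Real.norm_of_nonneg (h0 t ω ht)]
      have hP0 : 0 ≤ P ω := by
        rw [← h1]
        exact setIntegral_nonneg measurableSet_Ioc fun t ht => h0 t ω ht
      rw [this, Real.norm_of_nonneg (by positivity)]
      gcongr
  refine ⟨hint.integral_prod_left, ?_⟩
  rw [integral_integral_swap hint]
  refine integral_congr_ae ?_
  filter_upwards [hP] with ω h1
  rw [← h1, integral_const_mul]

lemma rl_ker1 (s : ℝ) (hs : s ∈ Ioo (0:ℝ) 1) (a x y : ℝ) (hay : a ≤ y) :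
    IntegrableOn (fun t => if y < t then (t - y) ^ (-s) else 0) (Ioc a x) ∧
    ∫ t in Ioc a x, (if y < t then (t - y) ^ (-s) else 0) =
      (max (x - y) 0) ^ (1 - s) / (1 - s) := by
  have e : (fun t => if y < t then (t - y) ^ (-s) else 0) =
      (Ioi y).indicator (fun t => (t - y) ^ (-s)) := by
    ext t; simp [indicator]
  have h1 : (-1:ℝ) < -s := by linarith [hs.2]
  have e2 : Ioc a x ∩ Ioi y = Ioc y x := by
    ext t; simp only [mem_inter_iff, mem_Ioc, mem_Ioi]; constructor
    · rintro ⟨⟨_, h⟩, h'⟩; exact ⟨h', h⟩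
    · rintro ⟨h, h'⟩; exact ⟨⟨by linarith, h'⟩, h⟩
  rw [e, setIntegral_indicator measurableSet_Ioi, e2]
  have hz : (0:ℝ) ^ (1 - s) = 0 := Real.zero_rpow (by linarith [hs.2])
  rw [IntegrableOn, integrable_indicator_iff measurableSet_Ioi, IntegrableOn,
    Measure.restrict_restrict measurableSet_Ioi, inter_comm, e2]
  rcases le_total x y with h | h
  · rw [Ioc_eq_empty (by linarith), max_eq_right (by linarith), hz]; simp
  · constructor
    · have := (intervalIntegral.intervalIntegrable_rpow' (a := y - y) (b := x - y) h1).comp_sub_right y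
      simp only [sub_add_cancel] at this
      exact (intervalIntegrable_iff_integrableOn_Ioc_of_le h).1 this
    · rw [← intervalIntegral.integral_of_le h, max_eq_left (by linarith),
        intervalIntegral.integral_comp_sub_right (fun t => t ^ (-s)), integral_rpow (Or.inl h1),
        sub_self, show -s + 1 = 1 - s by ring, hz, sub_zero]

lemma rl_ker2 (s : ℝ) (hs : s ∈ Ioo (0:ℝ) 1) (a x y : ℝ) (hay : a ≤ y) :
    IntegrableOn (fun t => if y ≤ t then (x - t) ^ (-s) else 0) (Ioc a x) ∧
    ∫ t in Ioc a x, (if y ≤ t then (x - t) ^ (-s) else 0) =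
      (max (x - y) 0) ^ (1 - s) / (1 - s) := by
  have e : (fun t => if y ≤ t then (x - t) ^ (-s) else 0) =
      (Ici y).indicator (fun t => (x - t) ^ (-s)) := by
    ext t; simp [indicator]
  have h1 : (-1:ℝ) < -s := by linarith [hs.2]
  have e2 : (Ioc a x ∩ Ici y : Set ℝ) =ᵐ[volume] (Ioc y x : Set ℝ) := by
    have : (Ioc a x ∩ Ioi y : Set ℝ) = Ioc y x := by
      ext t; simp only [mem_inter_iff, mem_Ioc, mem_Ioi]; constructor
      · rintro ⟨⟨_, h⟩, h'⟩; exact ⟨h', h⟩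
      · rintro ⟨h, h'⟩; exact ⟨⟨by linarith, h'⟩, h⟩
    rw [← this]
    exact (ae_eq_refl _).inter Ioi_ae_eq_Ici.symm
  rw [e, setIntegral_indicator measurableSet_Ici]
  have hz : (0:ℝ) ^ (1 - s) = 0 := Real.zero_rpow (by linarith [hs.2])
  rw [IntegrableOn, integrable_indicator_iff measurableSet_Ici, IntegrableOn,
    Measure.restrict_restrict measurableSet_Ici, inter_comm, Measure.restrict_congr_set e2]
  rcases le_total x y with h | h
  · rw [Ioc_eq_empty (by linarith), max_eq_right (by linarith), hz]; simp
  · constructor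
    · have := (intervalIntegral.intervalIntegrable_rpow' (a := x - y) (b := x - x) h1).comp_sub_left x
      rw [_root_.sub_sub_cancel, _root_.sub_sub_cancel] at this
      exact (intervalIntegrable_iff_integrableOn_Ioc_of_le h).1 this
    · rw [← intervalIntegral.integral_of_le h, max_eq_left (by linarith),
        intervalIntegral.integral_comp_sub_left (fun t => t ^ (-s)), integral_rpow (Or.inl h1),
        sub_self, show -s + 1 = 1 - s by ring, hz, sub_zero]

lemma rl_main {Ω : Type*} [MeasurableSpace Ω] (ν : Measure Ω) [SFinite ν] (f : Ω → ℝ)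
    (hf : Integrable f ν) (ξ : Ω → ℝ) (hξ : Measurable ξ) (s : ℝ) (hs : s ∈ Ioo (0:ℝ) 1)
    (a x : ℝ) (ha : ∀ᵐ ω ∂ν, a ≤ ξ ω) :
    IntegrableOn (fun t => ∫ ω, f ω * (if ξ ω < t then (t - ξ ω) ^ (-s) else 0) ∂ν) (Ioc a x) ∧
    IntegrableOn (fun t => (∫ ω, f ω * (if ξ ω ≤ t then 1 else 0) ∂ν) * (x - t) ^ (-s))
      (Ioc a x) ∧
    ∫ t in Ioc a x, (∫ ω, f ω * (if ξ ω ≤ t then 1 else 0) ∂ν) * (x - t) ^ (-s) =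
      ∫ t in Ioc a x, ∫ ω, f ω * (if ξ ω < t then (t - ξ ω) ^ (-s) else 0) ∂ν := by
  have hC : ∀ᵐ ω ∂ν, (max (x - ξ ω) 0) ^ (1 - s) / (1 - s) ≤
      (max (x - a) 0) ^ (1 - s) / (1 - s) := by
    filter_upwards [ha] with ω h
    have h1 : 0 < 1 - s := by linarith [hs.2]
    gcongr
  have A := rl_fubini_s17 ν f hf a x (fun t ω => if ξ ω < t then (t - ξ ω) ^ (-s) else 0)
    (Measurable.ite (measurableSet_lt (hξ.comp measurable_snd) measurable_fst)
      ((measurable_fst.sub (hξ.comp measurable_snd)).pow_const _) measurable_const)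
    (fun ω => (max (x - ξ ω) 0) ^ (1 - s) / (1 - s)) _
    (fun t ω _ => by
      split_ifs with h
      · exact Real.rpow_nonneg (by linarith) _
      · exact le_rfl)
    (by filter_upwards [ha] with ω h using (rl_ker1 s hs a x _ h).1)
    (by filter_upwards [ha] with ω h using (rl_ker1 s hs a x _ h).2) hC
  have B := rl_fubini_s17 ν f hf a x (fun t ω => if ξ ω ≤ t then (x - t) ^ (-s) else 0)
    (Measurable.ite (measurableSet_le (hξ.comp measurable_snd) measurable_fst)
      ((measurable_const.sub measurable_fst).pow_const _) measurable_const)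
    (fun ω => (max (x - ξ ω) 0) ^ (1 - s) / (1 - s)) _
    (fun t ω ht => by
      split_ifs with h
      · exact Real.rpow_nonneg (by linarith [ht.2]) _
      · exact le_rfl)
    (by filter_upwards [ha] with ω h using (rl_ker2 s hs a x _ h).1)
    (by filter_upwards [ha] with ω h using (rl_ker2 s hs a x _ h).2) hC
  have e : (fun t => (∫ ω, f ω * (if ξ ω ≤ t then 1 else 0) ∂ν) * (x - t) ^ (-s)) =
      fun t => ∫ ω, f ω * (if ξ ω ≤ t then (x - t) ^ (-s) else 0) ∂ν := by
    ext t
    rw [← integral_mul_const]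
    congr 1; ext ω
    split_ifs <;> simp
  rw [e]
  exact ⟨A.1, B.1, B.2.trans A.2.symm⟩

lemma rl_add3 (S : Set ℝ) (f g h : ℝ → ℝ) (hf : IntegrableOn f S) (hg : IntegrableOn g S)
    (hh : IntegrableOn h S) : ∫ t in S, (f t + g t + h t) =
      (∫ t in S, f t) + (∫ t in S, g t) + ∫ t in S, h t := by
  rw [← integral_add hf hg]
  exact integral_add (hf.add hg) hh

lemma rl_count (f : ℕ → ℝ) : ∫ k, f k ∂Measure.count = ∑' k, f k := by
  by_cases h : Integrable f Measure.count
  · rw [integral_countable h]; simp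
  · rw [integral_undef h, tsum_eq_zero_of_not_summable]
    rw [integrable_count_iff] at h
    exact fun h' => h h'.abs

/-- an SBV function `u(x) = c + ∫_a^x g + Σ_k p_k χ_{[x_k,b]}(x)` belongs to
the Riemann–Liouville fractional Sobolev space: `I_{a+}^{1-s}[u]` is the primitive of the
`L^1` function `h_s`, so `D_{a+}^s u = h_s` a.e. -/
theorem sbv_mem_rl_sobolev (a b s : ℝ) (hab : a < b) (hs : s ∈ Set.Ioo (0:ℝ) 1)
    (c : ℝ) (g : ℝ → ℝ) (hg : IntegrableOn g (Set.Ioo a b))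
    (xk : ℕ → ℝ) (hxk : ∀ k, xk k ∈ Set.Ioo a b)
    (p : ℕ → ℝ) (hp : Summable fun k => |p k|) :
    IntegrableOn
      (fun t => c * (t - a) ^ (-s) / Real.Gamma (1 - s) + RLint a (1 - s) g t +
        (Real.Gamma (1 - s))⁻¹ *
          ∑' k, Set.indicator (Set.Ioc (xk k) b) (fun y => p k * (y - xk k) ^ (-s)) t)
      (Set.Ioo a b) ∧
    (∀ x ∈ Set.Icc a b,
      RLint a (1 - s)
          (fun y => c + (∫ t in a..y, g t) +
            ∑' k, Set.indicator (Set.Icc (xk k) b) (fun _ => p k) y) x =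
        ∫ t in a..x,
          (c * (t - a) ^ (-s) / Real.Gamma (1 - s) + RLint a (1 - s) g t +
            (Real.Gamma (1 - s))⁻¹ *
              ∑' k, Set.indicator (Set.Ioc (xk k) b) (fun y => p k * (y - xk k) ^ (-s)) t)) ∧
    (∀ᵐ x ∂(volume.restrict (Set.Ioo a b)),
      HasDerivAt
        (RLint a (1 - s)
          (fun y => c + (∫ t in a..y, g t) +
            ∑' k, Set.indicator (Set.Icc (xk k) b) (fun _ => p k) y))
        (c * (x - a) ^ (-s) / Real.Gamma (1 - s) + RLint a (1 - s) g x +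
          (Real.Gamma (1 - s))⁻¹ *
            ∑' k, Set.indicator (Set.Ioc (xk k) b) (fun y => p k * (y - xk k) ^ (-s)) x)
        x) := by
  -- the three pieces of `u` and of `h_s`
  set G := Real.Gamma (1 - s) with hG
  have M1 := fun x => rl_main (Measure.dirac a) (fun _ => c) (integrable_const c)
    (fun y : ℝ => y) measurable_id s hs a x (by simp [ae_dirac_eq])
  have M2 := fun x => rl_main (volume.restrict (Ioo a b)) g hg (fun y : ℝ => y) measurable_id s hs
    a x (by filter_upwards [ae_restrict_mem measurableSet_Ioo] with y hy using hy.1.le)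
  have M3 := fun x => rl_main (Measure.count : Measure ℕ) p (integrable_count_iff.2 hp)
    xk (measurable_of_countable _) s hs a x (by filter_upwards with k using (hxk k).1.le)
  simp only [integral_dirac, rl_count] at M1 M2 M3
  set U : ℝ → ℝ := fun y => c + (∫ t in a..y, g t) +
            ∑' k, Set.indicator (Set.Icc (xk k) b) (fun _ => p k) y with hU
  set H : ℝ → ℝ := fun t => c * (t - a) ^ (-s) / G + RLint a (1 - s) g t +
        G⁻¹ * ∑' k, Set.indicator (Set.Ioc (xk k) b) (fun y => p k * (y - xk k) ^ (-s)) t with hH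
  have HU : ∀ t ∈ Ioc a b, U t = c * (if a ≤ t then 1 else 0) +
      (∫ y in Ioo a b, g y * (if y ≤ t then 1 else 0)) +
      ∑' k, p k * (if xk k ≤ t then 1 else 0) := by
    intro t ht
    simp only [hU]
    congr 1
    · congr 1
      · simp [ht.1.le]
      · have : (fun y => g y * (if y ≤ t then (1:ℝ) else 0)) = (Iic t).indicator g := by
          ext y; simp [indicator]
        rw [this, ← integral_Ioc_eq_integral_Ioo, setIntegral_indicator measurableSet_Iic,
          intervalIntegral.integral_of_le ht.1.le]
        congr 2
        ext y; simp only [mem_inter_iff, mem_Ioc, mem_Iic]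
        constructor
        · rintro ⟨h, h'⟩; exact ⟨⟨h, h'.trans ht.2⟩, h'⟩
        · rintro ⟨⟨h, _⟩, h'⟩; exact ⟨h, h'⟩
    · congr 1; ext k; simp [indicator, ht.2]
  have HH : ∀ t ∈ Ioc a b, H t = G⁻¹ * (c * (if a < t then (t - a) ^ (-s) else 0) +
      (∫ y in Ioo a b, g y * (if y < t then (t - y) ^ (-s) else 0)) +
      ∑' k, p k * (if xk k < t then (t - xk k) ^ (-s) else 0)) := by
    intro t ht
    simp only [hH, RLint, ← hG, mul_add]
    congr 1
    · congr 1
      · simp [ht.1]; ring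
      · congr 1
        have : (fun y => g y * (if y < t then (t - y) ^ (-s) else 0)) =
            (Iio t).indicator (fun y => g y * (t - y) ^ (-s)) := by
          ext y; simp [indicator]
        rw [this, setIntegral_indicator measurableSet_Iio,
          intervalIntegral.integral_of_le ht.1.le, integral_Ioc_eq_integral_Ioo,
          show 1 - s - 1 = -s by ring]
        congr 2
        ext y; simp only [mem_inter_iff, mem_Ioo, mem_Iio]
        constructor
        · rintro ⟨h, h'⟩; exact ⟨⟨h, h'.trans_le ht.2⟩, h'⟩
        · rintro ⟨⟨h, _⟩, h'⟩; exact ⟨h, h'⟩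
    · congr 2; ext k; simp [indicator, ht.2]
  have I1 : IntegrableOn H (Ioc a b) := by
    refine IntegrableOn.congr_fun ?_ (fun t ht => (HH t ht).symm) measurableSet_Ioc
    exact (((M1 b).1.add (M2 b).1).add (M3 b).1).const_mul G⁻¹
  have I2 : ∀ x ∈ Icc a b, RLint a (1 - s) U x = ∫ t in a..x, H t := by
    intro x hx
    rw [RLint, intervalIntegral.integral_of_le hx.1, intervalIntegral.integral_of_le hx.1,
      show 1 - s - 1 = -s by ring, ← hG]
    have sub : Ioc a x ⊆ Ioc a b := Ioc_subset_Ioc_right hx.2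
    rw [setIntegral_congr_fun measurableSet_Ioc (fun t ht => HH t (sub ht)), integral_const_mul,
      rl_add3 _ _ _ _ (M1 x).1 (M2 x).1 (M3 x).1,
      ← (M1 x).2.2, ← (M2 x).2.2, ← (M3 x).2.2,
      ← rl_add3 _ _ _ _ (M1 x).2.1 (M2 x).2.1 (M3 x).2.1]
    congr 1
    refine setIntegral_congr_fun measurableSet_Ioc fun t ht => ?_
    simp only [HU t (sub ht), add_mul]
  refine ⟨I1.mono_set Ioo_subset_Ioc_self, I2, ?_⟩
  rw [ae_restrict_iff' measurableSet_Ioo]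
  have hI : IntervalIntegrable H volume a b :=
    (intervalIntegrable_iff_integrableOn_Ioc_of_le hab.le).2 I1
  filter_upwards [hI.ae_hasDerivAt_integral] with x hx hxm
  rw [uIcc_of_le hab.le] at hx
  have := hx (Ioo_subset_Icc_self hxm) a (left_mem_Icc.2 hab.le)
  refine this.congr_of_eventuallyEq ?_
  filter_upwards [Ioo_mem_nhds hxm.1 hxm.2] with y hy
  exact I2 y (Ioo_subset_Icc_self hy)
end
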